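/- arXiv:2307.12011 — 2 statements merged into one kernel-verified Lean document; each statement's English description precedes it below -/
import Mathlib

section
/- Suppose F has exactly two zeros u_m < u_M in (0,1), with F > 0 on (0,u_m), F < 0 on (u_m, u_M), and F > 0 on (u_M, 1] (so the critical manifold is S-shaped with fold points at u_m and u_M), and suppose 0 < δ < 1/(1+η) with u_m < u* < u_M, where u* = √(δη/(1−δ)). Then there exists ε₀ > 0 such that for every ε ∈ (0, ε₀), the system du/dt = f(u,v), dv/dt = εg(u,v) has a nonconstant periodic solution with values in the open first quadrant (a relaxation oscillation), and it is unique: any two nonconstant periodic solutions of the system in the open first quadrant have the same orbit. -/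
/-- `f(u,v) = u(1−u)(u+θ)(u²+η) − u²v`. -/
def fPoly (θ η : ℝ) (u v : ℝ) : ℝ := u * (1 - u) * (u + θ) * (u ^ 2 + η) - u ^ 2 * v

/-- `g(u,v) = u²v − δv(u²+η)`. -/
def gPoly (δ η : ℝ) (u v : ℝ) : ℝ := u ^ 2 * v - δ * v * (u ^ 2 + η)

/-- The quartic `F(u) = 3u⁴ − 2(1−θ)u³ − (θ−η)u² + ηθ`. -/
def quarticF (θ η : ℝ) (u : ℝ) : ℝ :=
  3 * u ^ 4 - 2 * (1 - θ) * u ^ 3 - (θ - η) * u ^ 2 + η * θ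

/-- `(u, v)` is a solution of `du/dt = f(u,v)`, `dv/dt = εg(u,v)` on all of `ℝ`. -/
def IsSolution (δ θ η ε : ℝ) (u v : ℝ → ℝ) : Prop :=
  ∀ t : ℝ, HasDerivAt u (fPoly θ η (u t) (v t)) t ∧
    HasDerivAt v (ε * gPoly δ η (u t) (v t)) t

/-- A relaxation-oscillation candidate: a nonconstant periodic solution with values
in the open first quadrant. -/
def IsPeriodicOrbitInQuadrant (δ θ η ε : ℝ) (u v : ℝ → ℝ) : Prop :=
  IsSolution δ θ η ε u v ∧ (∀ t : ℝ, 0 < u t ∧ 0 < v t) ∧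
    (∃ T > (0:ℝ), ∀ t : ℝ, u (t + T) = u t ∧ v (t + T) = v t) ∧
    (∃ t s : ℝ, (u t, v t) ≠ (u s, v s))

section ROProof
open Set Filter Topology

lemma ro_pos_right {f : ℝ → ℝ} {d t : ℝ} (h : HasDerivAt f d t) (hd : 0 < d) :
    ∀ᶠ y in 𝓝[>] t, f t < f y := by
  have h1 := (hasDerivAt_iff_tendsto_slope.1 h).mono_left
    (nhdsWithin_mono t (s := Ioi t) (fun y hy => (ne_of_gt hy : y ≠ t)))
  filter_upwards [h1.eventually (lt_mem_nhds hd), self_mem_nhdsWithin] with y hy hy2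
  have hy2 : t < y := hy2
  rw [slope_def_field] at hy
  have : 0 < y - t := sub_pos.2 hy2
  have := (div_pos_iff_of_pos_right this).1 hy
  linarith

lemma ro_pos_left {f : ℝ → ℝ} {d t : ℝ} (h : HasDerivAt f d t) (hd : 0 < d) :
    ∀ᶠ y in 𝓝[<] t, f y < f t := by
  have h1 := (hasDerivAt_iff_tendsto_slope.1 h).mono_left
    (nhdsWithin_mono t (s := Iio t) (fun y hy => (ne_of_lt hy : y ≠ t)))
  filter_upwards [h1.eventually (lt_mem_nhds hd), self_mem_nhdsWithin] with y hy hy2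
  have hy2 : y < t := hy2
  rw [slope_def_field] at hy
  by_contra hc
  have := div_nonpos_of_nonneg_of_nonpos (sub_nonneg.2 (not_lt.1 hc)) (sub_nonpos.2 hy2.le)
  linarith

/-- first time `f` becomes nonnegative -/
lemma ro_first {f : ℝ → ℝ} (hf : Continuous f) {α β : ℝ} (hab : α ≤ β) (h0 : f α < 0)
    (h1 : 0 ≤ f β) : ∃ t ∈ Ioc α β, f t = 0 ∧ ∀ y ∈ Ico α t, f y < 0 := by
  let S := {t | t ∈ Icc α β ∧ 0 ≤ f t}
  have hS : IsCompact S := by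
    apply (isCompact_Icc (a := α) (b := β)).inter_right
    exact isClosed_le continuous_const hf
  obtain ⟨t, ht, hmin⟩ := hS.exists_isLeast ⟨β, ⟨hab, le_rfl⟩, h1⟩
  have hbefore : ∀ y ∈ Ico α t, f y < 0 := by
    intro y hy
    by_contra hc
    have := hmin ⟨⟨hy.1, hy.2.le.trans ht.1.2⟩, not_lt.1 hc⟩
    exact absurd hy.2 (not_lt.2 this)
  have hat : α < t := by
    rcases ht.1.1.eq_or_lt with h | h
    · rw [← h] at ht; exact absurd ht.2 (not_le.2 h0)
    · exact h
  refine ⟨t, ⟨hat, ht.1.2⟩, le_antisymm ?_ ht.2, hbefore⟩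
  by_contra hc
  obtain ⟨y, hy, hy2⟩ := intermediate_value_Icc hat.le hf.continuousOn (show (0:ℝ) ∈ Icc (f α) (f t) from ⟨h0.le, ht.2⟩)
  rcases hy.2.eq_or_lt with h | h
  · subst h; exact hc hy2.le
  · have := hbefore y ⟨hy.1, h⟩; linarith

lemma ro_last {f : ℝ → ℝ} (hf : Continuous f) {α β : ℝ} (hab : α ≤ β) (h0 : 0 ≤ f α)
    (h1 : f β < 0) : ∃ t ∈ Ico α β, f t = 0 ∧ ∀ y ∈ Ioc t β, f y < 0 := by
  obtain ⟨t, ht, h2, h3⟩ := ro_first (f := fun t => f (-t)) (by fun_prop) (α := -β) (β := -α)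
    (by linarith) (by simpa using h1) (by simpa using h0)
  refine ⟨-t, ⟨by linarith [ht.2], by linarith [ht.1]⟩, h2, fun y hy => ?_⟩
  have := h3 (-y) ⟨by linarith [hy.2], by linarith [hy.1]⟩
  simpa using this

lemma ro_first_deriv {f : ℝ → ℝ} {α t d : ℝ} (hat : α < t) (h : HasDerivAt f d t) (h0 : f t = 0)
    (hb : ∀ y ∈ Ico α t, f y < 0) : 0 ≤ d := by
  by_contra hc
  have h1 := ro_pos_left (f := fun y => - f y) h.neg (by linarith)
  obtain ⟨y, hy1, hy2⟩ := (h1.and (Ioo_mem_nhdsLT hat)).exists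
  have := hb y ⟨hy2.1.le, hy2.2⟩
  linarith

lemma ro_last_deriv {f : ℝ → ℝ} {β t d : ℝ} (hat : t < β) (h : HasDerivAt f d t) (h0 : f t = 0)
    (hb : ∀ y ∈ Ioc t β, f y < 0) : d ≤ 0 := by
  by_contra hc
  have h1 := ro_pos_right h (by linarith)
  obtain ⟨y, hy1, hy2⟩ := (h1.and (Ioo_mem_nhdsGT hat)).exists
  have := hb y ⟨hy2.1, hy2.2.le⟩
  linarith

/-- no downward crossing of zero -/
lemma ro_nc {f : ℝ → ℝ} (hf : Continuous f) {α β : ℝ} (h0 : 0 ≤ f α)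
    (hd : ∀ t ∈ Icc α β, f t = 0 → ∃ d > 0, HasDerivAt f d t) : ∀ t ∈ Ioc α β, 0 < f t := by
  intro t ht
  by_contra hc
  obtain ⟨γ, hγ, hγ2⟩ : ∃ γ ∈ Ico α t, 0 < f γ := by
    rcases h0.eq_or_lt with h | h
    · obtain ⟨d, hd0, hd1⟩ := hd α ⟨le_rfl, ht.1.le.trans ht.2⟩ h.symm
      obtain ⟨y, hy1, hy2⟩ := ((ro_pos_right hd1 hd0).and (Ioo_mem_nhdsGT ht.1)).exists
      exact ⟨y, ⟨hy2.1.le, hy2.2⟩, by linarith⟩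
    · exact ⟨α, ⟨le_rfl, ht.1⟩, h⟩
  obtain ⟨y, hy, hy2, hy3⟩ := ro_first (f := fun t => - f t) (by fun_prop) hγ.2.le (by simpa using hγ2)
    (by simpa using not_lt.1 hc)
  have hy2 : f y = 0 := by simpa using hy2
  obtain ⟨d, hd0, hd1⟩ := hd y ⟨hγ.1.trans hy.1.le, hy.2.trans ht.2⟩ hy2
  have := ro_first_deriv hy.1 hd1.neg (by simpa using hy2) hy3
  linarith

lemma ro_mono {f f' : ℝ → ℝ} {α β : ℝ} (hab : α ≤ β) (h : ∀ t ∈ Icc α β, HasDerivAt f (f' t) t)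
    (h' : ∀ t ∈ Ioo α β, 0 ≤ f' t) : f α ≤ f β := by
  have := monotoneOn_of_deriv_nonneg (convex_Icc α β) (fun t ht => (h t ht).continuousAt.continuousWithinAt)
    (fun t ht => by rw [interior_Icc] at ht; exact (h t (Ioo_subset_Icc_self ht)).differentiableAt.differentiableWithinAt)
    (fun t ht => by
      rw [interior_Icc] at ht; rw [(h t (Ioo_subset_Icc_self ht)).deriv]; exact h' t ht)
  exact this ⟨le_rfl, hab⟩ ⟨hab, le_rfl⟩ hab

lemma ro_smonoOn {f f' : ℝ → ℝ} {α β : ℝ} (h : ∀ t ∈ Icc α β, HasDerivAt f (f' t) t)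
    (h' : ∀ t ∈ Ioo α β, 0 < f' t) : StrictMonoOn f (Icc α β) := by
  exact strictMonoOn_of_deriv_pos (convex_Icc α β) (fun t ht => (h t ht).continuousAt.continuousWithinAt)
    (fun t ht => by
      rw [interior_Icc] at ht; rw [(h t (Ioo_subset_Icc_self ht)).deriv]; exact h' t ht)

lemma ro_lin {f f' : ℝ → ℝ} {α r : ℝ} (h : ∀ t, HasDerivAt f (f' t) t)
    (h' : ∀ t, α ≤ t → r ≤ f' t) : ∀ t, α ≤ t → f α + r * (t - α) ≤ f t := by
  intro t ht
  have := ro_mono (f := fun t => f t - r * t) (f' := fun t => f' t - r * 1) ht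
    (fun t _ => (h t).sub ((hasDerivAt_id t).const_mul r)) (fun t ht => by
      have := h' t ht.1.le; linarith)
  linarith

/-- If the derivative is bounded below by a positive constant, every level is exceeded. -/
lemma ro_exceed {f f' : ℝ → ℝ} {α r : ℝ} (hr : 0 < r) (h : ∀ t, HasDerivAt f (f' t) t)
    (h' : ∀ t, α ≤ t → r ≤ f' t) (M : ℝ) : ∃ t, α ≤ t ∧ M < f t := by
  refine ⟨α + (|M - f α| + 1) / r, by have : 0 ≤ (|M - f α| + 1) / r := by positivity
                                      linarith, ?_⟩
  have := ro_lin h h' (α + (|M - f α| + 1) / r) (by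
    have : 0 ≤ (|M - f α| + 1) / r := by positivity
    linarith)
  have e : r * (α + (|M - f α| + 1) / r - α) = |M - f α| + 1 := by field_simp; ring
  rw [e] at this
  have := le_abs_self (M - f α)
  linarith

lemma ro_inv {y : ℝ → ℝ} (hy : Continuous y) {α β : ℝ} (hab : α ≤ β)
    (hm : StrictMonoOn y (Icc α β)) :
    ∃ g : ℝ → ℝ, Continuous g ∧ (∀ z ∈ Icc (y α) (y β), g z ∈ Icc α β ∧ y (g z) = z) ∧
      (∀ t ∈ Icc α β, g (y t) = t) := by
  let c : ℝ → ℝ := fun t => max α (min β t)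
  have hc : Continuous c := by fun_prop
  have hcm : ∀ t, c t ∈ Icc α β := fun t => ⟨le_max_left _ _, max_le hab (min_le_left _ _)⟩
  have hcid : ∀ t ∈ Icc α β, c t = t := fun t ht => by simp [c, ht.1, ht.2]
  let Y : ℝ → ℝ := fun t => y (c t) + (t - c t)
  have hY : Continuous Y := by fun_prop
  have hYm : StrictMono Y := by
    intro t t' htt
    have h1 : c t ≤ c t' := max_le_max le_rfl (min_le_min le_rfl htt.le)
    have h2 : t - c t ≤ t' - c t' := by
      simp only [c]; grind
    rcases h1.eq_or_lt with h | h
    · simp only [Y]; rw [h]; linarith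
    · have := hm (hcm t) (hcm t') h
      simp only [Y]; linarith
  have hYs : Function.Surjective Y := by
    apply hY.surjective
    · have : Tendsto (fun t : ℝ => t + (y β - β)) atTop atTop := tendsto_atTop_add_const_right _ _ tendsto_id
      refine this.congr' ?_
      filter_upwards [eventually_ge_atTop β] with t ht
      have : c t = β := by simp [c, ht, hab]
      simp only [Y, this]; ring
    · have : Tendsto (fun t : ℝ => t + (y α - α)) atBot atBot := tendsto_atBot_add_const_right _ _ tendsto_id
      refine this.congr' ?_
      filter_upwards [eventually_le_atBot α] with t ht
      have : c t = α := by simp [c, ht]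
      simp only [Y, this]; ring
  let e := hYm.orderIsoOfSurjective Y hYs
  have heY : ∀ t, e t = Y t := fun t => rfl
  have hYid : ∀ t ∈ Icc α β, Y t = y t := fun t ht => by simp [Y, hcid t ht]
  have hleft : ∀ t ∈ Icc α β, e.symm (y t) = t := fun t ht => by
    rw [← hYid t ht, ← heY, e.symm_apply_apply]
  refine ⟨e.symm, e.symm.continuous, ?_, hleft⟩
  intro z hz
  obtain ⟨t, ht, rfl⟩ := intermediate_value_Icc hab hy.continuousOn hz
  rw [hleft t ht]; exact ⟨ht, rfl⟩

lemma ro_graph {y1 y2 E1 E2 dy1 dy2 dE1 dE2 : ℝ → ℝ} {α1 β1 α2 β2 : ℝ} (h1 : α1 < β1) (h2 : α2 < β2)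
    (cy2 : Continuous y2) (cE2 : Continuous E2)
    (hy1 : ∀ t ∈ Icc α1 β1, HasDerivAt y1 (dy1 t) t) (hy2 : ∀ t ∈ Icc α2 β2, HasDerivAt y2 (dy2 t) t)
    (hE1 : ∀ t ∈ Icc α1 β1, HasDerivAt E1 (dE1 t) t) (hE2 : ∀ t ∈ Icc α2 β2, HasDerivAt E2 (dE2 t) t)
    (p1 : ∀ t ∈ Ioo α1 β1, 0 < dy1 t) (p2 : ∀ t ∈ Ioo α2 β2, 0 < dy2 t)
    (ea : y1 α1 = y2 α2) (eb : y1 β1 = y2 β2) :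
    ((∀ t1 ∈ Ioo α1 β1, ∀ t2 ∈ Ioo α2 β2, y1 t1 = y2 t2 → dE2 t2 / dy2 t2 ≤ dE1 t1 / dy1 t1) →
      E2 β2 - E2 α2 ≤ E1 β1 - E1 α1) ∧
    ((∀ t1 ∈ Ioo α1 β1, ∀ t2 ∈ Ioo α2 β2, y1 t1 = y2 t2 → dE2 t2 / dy2 t2 < dE1 t1 / dy1 t1) →
      E2 β2 - E2 α2 < E1 β1 - E1 α1) := by
  have m1 := ro_smonoOn hy1 p1
  have m2 := ro_smonoOn hy2 p2
  obtain ⟨g, cg, hg, hg'⟩ := ro_inv cy2 h2.le m2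
  let T : ℝ → ℝ := fun t => g (y1 t)
  have hIoo : ∀ t ∈ Ioo α1 β1, y1 t ∈ Ioo (y2 α2) (y2 β2) := fun t ht => by
    rw [← ea, ← eb]
    exact ⟨m1 ⟨le_rfl, h1.le⟩ (Ioo_subset_Icc_self ht) ht.1, m1 (Ioo_subset_Icc_self ht) ⟨h1.le, le_rfl⟩ ht.2⟩
  have hT : ∀ t ∈ Ioo α1 β1, T t ∈ Ioo α2 β2 ∧ y2 (T t) = y1 t := fun t ht => by
    have h := hIoo t ht
    obtain ⟨h3, h4⟩ : T t ∈ Icc α2 β2 ∧ y2 (T t) = y1 t := hg _ (Ioo_subset_Icc_self h)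
    refine ⟨⟨lt_of_le_of_ne h3.1 ?_, lt_of_le_of_ne h3.2 ?_⟩, h4⟩
    · intro h5; rw [← h5] at h4; exact absurd h4 h.1.ne
    · intro h5; rw [h5] at h4; exact absurd h4 h.2.ne'
  have hTd : ∀ t ∈ Ioo α1 β1, HasDerivAt T ((dy2 (T t))⁻¹ * dy1 t) t := fun t ht => by
    have h := hIoo t ht
    have hgd : HasDerivAt g (dy2 (T t))⁻¹ (y1 t) := by
      apply HasDerivAt.of_local_left_inverse cg.continuousAt (hy2 _ (Ioo_subset_Icc_self (hT t ht).1))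
        (p2 _ (hT t ht).1).ne'
      filter_upwards [Ioo_mem_nhds h.1 h.2] with z hz
      exact (hg z (Ioo_subset_Icc_self hz)).2
    exact hgd.comp t (hy1 t (Ioo_subset_Icc_self ht))
  let D : ℝ → ℝ := fun t => E2 (T t) - E1 t
  have hD : ∀ t ∈ Ioo α1 β1, HasDerivAt D (dE2 (T t) * ((dy2 (T t))⁻¹ * dy1 t) - dE1 t) t := fun t ht =>
    ((hE2 _ (Ioo_subset_Icc_self (hT t ht).1)).comp t (hTd t ht)).sub (hE1 t (Ioo_subset_Icc_self ht))
  have cD : ContinuousOn D (Icc α1 β1) := fun t ht => by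
    have : ContinuousAt D t := by
      apply ContinuousAt.sub _ (hE1 t ht).continuousAt
      exact cE2.continuousAt.comp (cg.continuousAt.comp (hy1 t ht).continuousAt)
    exact this.continuousWithinAt
  have dα : D α1 = E2 α2 - E1 α1 := by
    simp only [D, T]; rw [ea, hg' α2 ⟨le_rfl, h2.le⟩]
  have dβ : D β1 = E2 β2 - E1 β1 := by
    simp only [D, T]; rw [eb, hg' β2 ⟨h2.le, le_rfl⟩]
  have key : ∀ t ∈ Ioo α1 β1, dE2 (T t) * ((dy2 (T t))⁻¹ * dy1 t) - dE1 t
      = dy1 t * (dE2 (T t) / dy2 (T t) - dE1 t / dy1 t) := fun t ht => by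
    have := (p1 t ht).ne'
    have := (p2 _ (hT t ht).1).ne'
    field_simp
  constructor
  · intro hc
    have := antitoneOn_of_deriv_nonpos (convex_Icc α1 β1) cD
      (fun t ht => by rw [interior_Icc] at ht; exact (hD t ht).differentiableAt.differentiableWithinAt)
      (fun t ht => by
        rw [interior_Icc] at ht; rw [(hD t ht).deriv, key t ht]
        exact mul_nonpos_of_nonneg_of_nonpos (p1 t ht).le (sub_nonpos.2 (hc t ht _ (hT t ht).1 (hT t ht).2.symm)))
    have := this ⟨le_rfl, h1.le⟩ ⟨h1.le, le_rfl⟩ h1.le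
    rw [dα, dβ] at this; linarith
  · intro hc
    have := strictAntiOn_of_deriv_neg (convex_Icc α1 β1) cD
      (fun t ht => by
        rw [interior_Icc] at ht; rw [(hD t ht).deriv, key t ht]
        exact mul_neg_of_pos_of_neg (p1 t ht) (sub_neg.2 (hc t ht _ (hT t ht).1 (hT t ht).2.symm)))
    have := this ⟨le_rfl, h1.le⟩ ⟨h1.le, le_rfl⟩ h1
    rw [dα, dβ] at this; linarith

/-- two planar arcs which do not meet and are graphs keep their order -/
lemma ro_order {y1 z1 y2 z2 : ℝ → ℝ} {α1 β1 α2 β2 : ℝ} (h2 : α2 ≤ β2)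
    (cy1 : Continuous y1) (cz1 : Continuous z1) (cy2 : Continuous y2) (cz2 : Continuous z2)
    (m2 : StrictMonoOn y2 (Icc α2 β2))
    (hr : ∀ t ∈ Icc α1 β1, y1 t ∈ Icc (y2 α2) (y2 β2))
    (hne : ∀ t1 ∈ Icc α1 β1, ∀ t2 ∈ Icc α2 β2, y1 t1 = y2 t2 → z1 t1 ≠ z2 t2)
    {s1 s2 : ℝ} (hs1 : s1 ∈ Icc α1 β1) (hs2 : s2 ∈ Icc α2 β2) (es : y1 s1 = y2 s2) (ls : z1 s1 < z2 s2) :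
    ∀ t1 ∈ Icc α1 β1, ∀ t2 ∈ Icc α2 β2, y1 t1 = y2 t2 → z1 t1 < z2 t2 := by
  obtain ⟨g, cg, hg, hg'⟩ := ro_inv cy2 h2 m2
  intro t1 ht1 t2 ht2 e
  by_contra hc
  let D : ℝ → ℝ := fun t => z2 (g (y1 t)) - z1 t
  have cD : Continuous D := by fun_prop
  have d1 : 0 ≤ D s1 := by simp only [D]; rw [es, hg' s2 hs2]; linarith
  have d2 : D t1 ≤ 0 := by simp only [D]; rw [e, hg' t2 ht2]; linarith
  have := (isPreconnected_Icc (a := α1) (b := β1)).intermediate_value ht1 hs1 cD.continuousOn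
  obtain ⟨t, ht, h0⟩ := this (show (0:ℝ) ∈ Icc (D t1) (D s1) from ⟨d2, d1⟩)
  obtain ⟨h3, h4⟩ := hg (y1 t) (hr t ht)
  refine hne t ht _ h3 h4.symm ?_
  simp only [D] at h0; linarith

lemma ro_lip_comp {x h : ℝ → ℝ} {t : ℝ} {K : NNReal} (hx : HasDerivAt x 0 t) (hh : LipschitzWith K h) :
    HasDerivAt (fun t => h (x t)) 0 t := by
  rw [hasDerivAt_iff_isLittleO] at hx ⊢
  simp only [smul_zero, sub_zero] at hx ⊢
  refine Asymptotics.IsBigO.trans_isLittleO ?_ hx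
  refine Asymptotics.IsBigO.of_bound K (Eventually.of_forall fun y => ?_)
  simpa [Real.dist_eq] using hh.dist_le_mul (x y) (x t)

/-- global solutions of bounded Lipschitz autonomous systems -/
lemma ro_global {E : Type*} [NormedAddCommGroup E] [NormedSpace ℝ E] [CompleteSpace E] (V : E → E)
    {K L : NNReal} (hK : LipschitzWith K V) (hL : ∀ z, ‖V z‖ ≤ L) (z₀ : E) :
    ∃ Z : ℝ → E, Z 0 = z₀ ∧ ∀ t, HasDerivAt Z (V (Z t)) t := by
  have step : ∀ n : ℕ, ∃ Z : ℝ → E, Z 0 = z₀ ∧ ∀ t ∈ Ioo (-(n+1:ℝ)) (n+1), HasDerivAt Z (V (Z t)) t := by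
    intro n
    have hn : (0:ℝ) ∈ Icc (-(n+1:ℝ)) (n+1) := ⟨by linarith [n.cast_nonneg (α := ℝ)], by positivity⟩
    have hp : IsPicardLindelof (fun _ : ℝ => V) (⟨0, hn⟩ : Icc (-(n+1:ℝ)) (n+1)) z₀ (L * (n+1)) 0 L K := by
      constructor
      · intro t _; exact hK.lipschitzOnWith
      · intro x _; exact continuousOn_const
      · intro t _ x _; exact hL x
      · simp
    obtain ⟨Z, h0, hZ⟩ := hp.exists_eq_forall_mem_Icc_hasDerivWithinAt₀
    exact ⟨Z, h0, fun t ht => (hZ t (Ioo_subset_Icc_self ht)).hasDerivAt (Icc_mem_nhds ht.1 ht.2)⟩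
  choose Z h0 hZ using step
  have agree : ∀ n m : ℕ, n ≤ m → EqOn (Z n) (Z m) (Ioo (-(n+1:ℝ)) (n+1)) := by
    intro n m hnm
    have hnm' : (n:ℝ) ≤ m := by exact_mod_cast hnm
    have hn0 := n.cast_nonneg (α := ℝ)
    refine ODE_solution_unique_of_mem_Ioo (v := fun _ => V) (s := fun _ => univ) (K := K) (t₀ := 0)
      (fun t _ => hK.lipschitzOnWith) ⟨by linarith, by linarith⟩ (fun t ht => ⟨hZ n t ht, mem_univ _⟩)
      (fun t ht => ⟨hZ m t ⟨by linarith [ht.1], by linarith [ht.2]⟩, mem_univ _⟩) (by rw [h0, h0])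
  refine ⟨fun t => Z ⌈|t|⌉₊ t, h0 _, fun t => ?_⟩
  have hc : |t| < ⌈|t|⌉₊ + 1 := lt_of_le_of_lt (Nat.le_ceil _) (by linarith)
  have hm := hZ ⌈|t|⌉₊ t (by rw [abs_lt] at hc; exact hc)
  have hm2 := hZ (⌈|t|⌉₊ + 1) t (by
    rw [abs_lt] at hc; push_cast; exact ⟨by linarith [hc.1], by linarith [hc.2]⟩)
  have e1 : Z ⌈|t|⌉₊ t = Z (⌈|t|⌉₊ + 1) t := agree _ _ (by lia) (by rw [abs_lt] at hc; exact hc)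
  simp only
  rw [e1]
  refine hm2.congr_of_eventuallyEq ?_
  have : ∀ᶠ y in 𝓝 t, |y| < |t| + 1 := (continuous_abs.tendsto t).eventually (gt_mem_nhds (by linarith))
  filter_upwards [this] with y hy
  apply agree
  · apply Nat.ceil_le.2
    push_cast
    linarith [Nat.le_ceil |t|]
  · have : |y| < ⌈|y|⌉₊ + 1 := lt_of_le_of_lt (Nat.le_ceil _) (by linarith)
    rw [abs_lt] at this; exact this

def ROSol (a h b p x w : ℝ → ℝ) : Prop :=
  ∀ t, HasDerivAt x (a (x t) * (h (x t) - p (w t))) t ∧ HasDerivAt w (b (x t)) t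

structure ROSys (a h b p : ℝ → ℝ) (s ws : ℝ) : Prop where
  ca : Continuous a
  apos : ∀ x, 0 < a x
  hlip : ∃ K, LipschitzWith K h
  cb : Continuous b
  bmono : Monotone b
  b0 : b s = 0
  bpos : ∀ x, s < x → 0 < b x
  bneg : ∀ x, x < s → b x < 0
  pd : ∀ w, ∃ d > 0, HasDerivAt p d w
  hs : h s = p ws
  uniq : ∀ x1 w1 x2 w2 : ℝ → ℝ, ROSol a h b p x1 w1 → ROSol a h b p x2 w2 → ∀ t1 t2,
    x1 t1 = x2 t2 → w1 t1 = w2 t2 → ∀ r, x1 (t1 + r) = x2 (t2 + r) ∧ w1 (t1 + r) = w2 (t2 + r)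

structure RORight (a h b p : ℝ → ℝ) (s ws xc xb y₀ W : ℝ) : Prop where
  sc : s < xc
  hxc : ∀ x ∈ Icc s xc, h x ≤ h xc
  pxc : p ws < h xc
  wedge1 : ∃ k > 0, ∀ x ∈ Ioc s xc, b x < k * (a x * (h x - p (ws + k * (x - s))))
  sb : s < xb
  hxb : h xb = p ws
  hbet : ∀ x ∈ Ioo s xb, p ws < h x
  hanti : AntitoneOn h (Ici xb)
  wedge2 : ∃ wb k, 0 < k ∧ p wb ≤ p ws ∧ y₀ < p wb ∧
    ∀ x ∈ Ioc s xb, b x < k * (a x * (h x - p (wb + k * (x - s))))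
  bound : ∃ X w1 r β, 0 < r ∧ 0 < β ∧ (∀ x, b x ≤ β) ∧ ws ≤ w1 ∧ s < X ∧ (∀ w, h X < p w) ∧
    (∀ x, s ≤ x → ∀ w, w1 ≤ w → a x * (h x - p w) ≤ -r) ∧ w1 + β / r * (X - s) ≤ W

def ROArc (s : ℝ) (x : ℝ → ℝ) (t0 t1 : ℝ) : Prop :=
  t0 < t1 ∧ x t0 = s ∧ x t1 = s ∧ ∀ t ∈ Ioo t0 t1, s < x t

section
variable {a h b p : ℝ → ℝ} {s ws xc xb y₀ W : ℝ} {x w : ℝ → ℝ}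

lemma ROSol.cx (sol : ROSol a h b p x w) : Continuous x :=
  continuous_iff_continuousAt.2 fun t => (sol t).1.continuousAt

lemma ROSol.cw (sol : ROSol a h b p x w) : Continuous w :=
  continuous_iff_continuousAt.2 fun t => (sol t).2.continuousAt

lemma ROSys.cp (S : ROSys a h b p s ws) : Continuous p :=
  continuous_iff_continuousAt.2 fun t => (S.pd t).choose_spec.2.continuousAt

lemma ROSys.ch (S : ROSys a h b p s ws) : Continuous h := S.hlip.choose_spec.continuous

lemma ROSys.pmono (S : ROSys a h b p s ws) : StrictMono p := by
  choose d hd hd2 using S.pd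
  exact strictMono_of_hasDerivAt_pos hd2 hd

lemma ro_wedge (S : ROSys a h b p s ws) {x1 wb k t0 : ℝ} (hk : 0 < k) (hx1 : s < x1) (hwb : p wb ≤ h s)
    (hW : ∀ x ∈ Ioc s x1, b x < k * (a x * (h x - p (wb + k * (x - s)))))
    (sol : ROSol a h b p x w) (hx0 : x t0 = s) (hw0 : w t0 < wb) :
    ∃ t1 > t0, x t1 = x1 ∧ (∀ t ∈ Ioc t0 t1, s < x t) ∧ ∀ t ∈ Icc t0 t1, 0 < h (x t) - p (w t) := by
  have cx := sol.cx
  have cw := sol.cw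
  let ψ : ℝ → ℝ := fun t => w t - wb - k * (x t - s)
  have cψ : Continuous ψ := by fun_prop
  have hpos : ∀ y ∈ Icc s x1, 0 ≤ h y - p (wb + k * (y - s)) := by
    intro y hy
    rcases hy.1.eq_or_lt with e | e
    · subst e; simpa using hwb
    · have h1 := hW y ⟨e, hy.2⟩
      have h2 := S.bpos y e
      have h3 : 0 < k * (a y * (h y - p (wb + k * (y - s)))) := h2.trans h1
      have h4 := (mul_pos_iff_of_pos_left hk).1 h3
      exact ((mul_pos_iff_of_pos_left (S.apos y)).1 h4).le
  have hq : ∀ t, x t ∈ Icc s x1 → ψ t < 0 → 0 < h (x t) - p (w t) := by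
    intro t ht hψ
    have := hpos _ ht
    have h2 : p (w t) < p (wb + k * (x t - s)) := S.pmono (by simp only [ψ] at hψ; linarith)
    linarith
  have claim1 : ∀ T, t0 ≤ T → (∀ t ∈ Icc t0 T, x t ≤ x1) → (∀ t ∈ Ico t0 T, ψ t < 0) →
      ∀ t ∈ Ioc t0 T, s < x t := by
    intro T hT hx hψ
    have A : ∀ t ∈ Ico t0 T, s ≤ x t := by
      intro t ht
      rcases ht.1.eq_or_lt with e | e
      · rw [← e, hx0]
      · have := ro_nc (f := fun t => x t - s) (by fun_prop) (α := t0) (β := t) (by simp [hx0])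
          (fun t' ht' h0 => by
            have h0 : x t' = s := by linarith
            refine ⟨_, ?_, (sol t').1.sub_const s⟩
            exact mul_pos (S.apos _) (hq t' ⟨by rw [h0], by rw [h0]; exact hx1.le⟩ (hψ t' ⟨ht'.1, lt_of_le_of_lt ht'.2 ht.2⟩)))
          t ⟨e, le_rfl⟩
        linarith
    have := ro_smonoOn (α := t0) (β := T) (fun t _ => (sol t).1) (fun t ht =>
      mul_pos (S.apos _) (hq t ⟨A t ⟨ht.1.le, ht.2⟩, hx t (Ioo_subset_Icc_self ht)⟩ (hψ t ⟨ht.1.le, ht.2⟩)))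
    intro t ht
    rw [← hx0]
    exact this ⟨le_rfl, hT⟩ (Ioc_subset_Icc_self ht) ht.1
  have claim2 : ∀ T, t0 ≤ T → (∀ t ∈ Icc t0 T, x t ≤ x1) → ∀ t ∈ Icc t0 T, ψ t < 0 := by
    intro T hT hx t ht
    by_contra hc
    obtain ⟨τ, hτ, hτ0, hτ1⟩ := ro_first cψ ht.1 (by simp only [ψ, hx0]; linarith) (not_lt.1 hc)
    have h1 := claim1 τ hτ.1.le (fun t' ht' => hx t' ⟨ht'.1, ht'.2.trans (hτ.2.trans ht.2)⟩) hτ1 τ ⟨hτ.1, le_rfl⟩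
    have h2 := hW (x τ) ⟨h1, hx τ ⟨hτ.1.le, hτ.2.trans ht.2⟩⟩
    have h3 : HasDerivAt ψ (b (x τ) - k * (a (x τ) * (h (x τ) - p (w τ)))) τ :=
      ((sol τ).2.sub_const wb).sub (((sol τ).1.sub_const s).const_mul k)
    have h4 := ro_first_deriv hτ.1 h3 hτ0 hτ1
    have h5 : w τ = wb + k * (x τ - s) := by simp only [ψ] at hτ0; linarith
    rw [← h5] at h2
    linarith
  have reach : ∃ T, t0 ≤ T ∧ 0 ≤ x T - x1 := by
    by_contra hc
    push Not at hc
    have hle : ∀ t, t0 ≤ t → x t ≤ x1 := fun t ht => by linarith [hc t ht]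
    have hψ : ∀ t, t0 ≤ t → ψ t < 0 := fun t ht => claim2 t ht (fun t' ht' => hle t' ht'.1) t ⟨ht, le_rfl⟩
    have hgt : ∀ t, t0 < t → s < x t := fun t ht =>
      claim1 t ht.le (fun t' ht' => hle t' ht'.1) (fun t' ht' => hψ t' ht'.1) t ⟨ht, le_rfl⟩
    have hqq : ∀ t, t0 ≤ t → 0 < h (x t) - p (w t) := fun t ht => hq t ⟨by
      rcases ht.eq_or_lt with e | e
      · rw [← e, hx0]
      · exact (hgt t e).le, hle t ht⟩ (hψ t ht)
    have hm : ∀ t, t0 + 1 ≤ t → x (t0 + 1) ≤ x t := fun t ht =>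
      ro_mono ht (fun t _ => (sol t).1) (fun t ht => (mul_pos (S.apos _) (hqq t (by linarith [ht.1]))).le)
    have c1 : ContinuousOn (fun y => a y * (h y - p (wb + k * (y - s)))) (Icc (x (t0+1)) x1) := by
      have := S.ca; have := S.ch; have := S.cp
      fun_prop
    obtain ⟨y, hy, hmin⟩ := isCompact_Icc.exists_isMinOn ⟨x1, hle _ (by linarith), le_rfl⟩ c1
    have hys : s < y := lt_of_lt_of_le (hgt (t0+1) (by linarith)) hy.1
    have hm0 : 0 < a y * (h y - p (wb + k * (y - s))) := by
      have h3 := (S.bpos y hys).trans (hW y ⟨hys, hy.2⟩)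
      exact (mul_pos_iff_of_pos_left hk).1 h3
    obtain ⟨t, ht, ht2⟩ := ro_exceed hm0 (fun t => (sol t).1) (α := t0 + 1) (fun t ht => by
      have hxt : x t ∈ Icc (x (t0+1)) x1 := ⟨hm t ht, hle t (by linarith)⟩
      have h1 : a y * (h y - p (wb + k * (y - s))) ≤ a (x t) * (h (x t) - p (wb + k * (x t - s))) :=
        hmin hxt
      refine h1.trans (mul_le_mul_of_nonneg_left ?_ (S.apos _).le)
      have : p (w t) < p (wb + k * (x t - s)) := S.pmono (by
        have := hψ t (by linarith); simp only [ψ] at this; linarith)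
      linarith) x1
    have := hle t (by linarith)
    linarith
  obtain ⟨T, hT, hxT⟩ := reach
  obtain ⟨t1, ht1, h0, hb⟩ := ro_first (f := fun t => x t - x1) (by fun_prop) hT (by simp only [hx0]; linarith) hxT
  have hx : ∀ t ∈ Icc t0 t1, x t ≤ x1 := fun t ht => by
    rcases ht.2.eq_or_lt with e | e
    · rw [e]; linarith
    · linarith [hb t ⟨ht.1, e⟩]
  have h2 := claim2 t1 ht1.1.le hx
  have h3 := claim1 t1 ht1.1.le hx (fun t ht => h2 t (Ico_subset_Icc_self ht))
  refine ⟨t1, ht1.1, by linarith, h3, fun t ht => hq t ⟨?_, hx t ht⟩ (h2 t ht)⟩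
  rcases ht.1.eq_or_lt with e | e
  · rw [← e, hx0]
  · exact (h3 t ⟨e, ht.2⟩).le

lemma ro_w_smono (S : ROSys a h b p s ws) (sol : ROSol a h b p x w) {t0 t1 : ℝ}
    (hx : ∀ t ∈ Ioo t0 t1, s < x t) : StrictMonoOn w (Icc t0 t1) :=
  ro_smonoOn (fun t _ => (sol t).2) (fun t ht => S.bpos _ (hx t ht))

lemma ro_return (S : ROSys a h b p s ws) (R : RORight a h b p s ws xc xb y₀ W)
    (sol : ROSol a h b p x w) {t0 : ℝ} (hx0 : x t0 = s) (hw0 : w t0 < ws) :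
    ∃ t1, ROArc s x t0 t1 ∧ h xc ≤ p (w t1) := by
  have cx := sol.cx
  have cw := sol.cw
  obtain ⟨k, hk, hW⟩ := R.wedge1
  obtain ⟨tc, htc, hxc, hpos, -⟩ := ro_wedge S hk R.sc S.hs.ge hW sol hx0 hw0
  have last : ∀ t2, tc ≤ t2 → x t2 < xc → ∃ td ∈ Ico tc t2, h xc ≤ p (w td) ∧ x td = xc := by
    intro t2 ht2 hx2
    obtain ⟨td, htd, h0, hb⟩ := ro_last (f := fun t => x t - xc) (by fun_prop) ht2 (by simp [hxc]) (by linarith)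
    have h0 : x td = xc := by linarith
    have := ro_last_deriv htd.2 ((sol td).1.sub_const xc) (by simp [h0]) hb
    refine ⟨td, htd, ?_, h0⟩
    rw [h0] at this
    by_contra hc
    have := mul_pos (S.apos xc) (show 0 < h xc - p (w td) by linarith)
    linarith
  have ret : ∃ t, tc ≤ t ∧ 0 ≤ s - x t := by
    by_contra hc
    push Not at hc
    have hgt : ∀ t, t0 < t → s < x t := fun t ht => by
      rcases le_or_gt t tc with e | e
      · exact hpos t ⟨ht, e⟩
      · linarith [hc t e.le]
    have hwm : ∀ t t', t0 ≤ t → t < t' → w t < w t' := fun t t' h1 h2 =>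
      ro_w_smono S sol (t0 := t) (t1 := t') (fun y hy => hgt y (by linarith [hy.1])) ⟨le_rfl, h2.le⟩ ⟨h2.le, le_rfl⟩ h2
    by_cases hA : ∀ t, tc ≤ t → xc ≤ x t
    · obtain ⟨X, w1, r, β, hr, hβ, hb, hw1, hX, hXp, hneg, -⟩ := R.bound
      obtain ⟨t2, ht2, hw2⟩ := ro_exceed (S.bpos xc R.sc) (fun t => (sol t).2) (α := tc)
        (fun t ht => S.bmono (hA t ht)) w1
      obtain ⟨t3, ht3, hx3⟩ := ro_exceed hr (f := fun t => - x t) (fun t => (sol t).1.neg) (α := t2)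
        (fun t ht => by
          have := hneg (x t) (hgt t (by linarith)).le (w t) (by
            rcases ht.eq_or_lt with e | e
            · rw [← e]; exact hw2.le
            · linarith [hwm t2 t (by linarith) e])
          linarith) (-s)
      have := hgt t3 (by linarith)
      linarith
    · push Not at hA
      obtain ⟨t2, ht2, hx2⟩ := hA
      obtain ⟨td, htd, hd, hxd⟩ := last t2 ht2 hx2
      have hw2 : h xc < p (w t2) := lt_of_le_of_lt hd (S.pmono (hwm td t2 (by linarith [htd.1]) htd.2))
      have hw3 : ∀ t, t2 ≤ t → p (w t2) ≤ p (w t) := fun t ht => by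
        rcases ht.eq_or_lt with e | e
        · rw [e]
        · exact (S.pmono (hwm t2 t (by linarith) e)).le
      have hlt : ∀ t, t2 ≤ t → x t < xc := by
        intro t ht
        rcases ht.eq_or_lt with e | e
        · rw [← e]; exact hx2
        have := ro_nc (f := fun t => xc - x t) (by fun_prop) (α := t2) (β := t) (by linarith) (fun t' ht' h0 => by
          have h0 : x t' = xc := by linarith
          refine ⟨_, ?_, (sol t').1.const_sub xc⟩
          rw [h0]
          have := hw3 t' ht'.1
          have := mul_pos (S.apos xc) (show 0 < p (w t') - h xc by linarith)
          linarith) t ⟨e, le_rfl⟩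
        linarith
      obtain ⟨y, hy, hmin⟩ := isCompact_Icc.exists_isMinOn ⟨s, le_rfl, R.sc.le⟩
        (S.ca.continuousOn (s := Icc s xc))
      obtain ⟨t3, ht3, hx3⟩ := ro_exceed (mul_pos (S.apos y) (sub_pos.2 hw2)) (f := fun t => - x t)
        (fun t => (sol t).1.neg) (α := t2)
        (fun t ht => by
          have hxt : x t ∈ Icc s xc := ⟨(hgt t (by linarith)).le, (hlt t ht).le⟩
          have h1 : a y ≤ a (x t) := hmin hxt
          have h2 := R.hxc _ hxt
          have h3 := hw3 t ht
          have : a y * (p (w t2) - h xc) ≤ a (x t) * (p (w t) - h (x t)) :=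
            mul_le_mul h1 (by linarith) (by linarith) (S.apos _).le
          linarith) (-s)
      have := hgt t3 (by linarith)
      linarith
  obtain ⟨T, hT, hxT⟩ := ret
  obtain ⟨t1, ht1, h0, hb⟩ := ro_first (f := fun t => s - x t) (by fun_prop) hT (by linarith [R.sc]) hxT
  have h0 : x t1 = s := by linarith
  have arc : ∀ t ∈ Ioo t0 t1, s < x t := fun t ht => by
    rcases le_or_gt t tc with e | e
    · exact hpos t ⟨ht.1, e⟩
    · linarith [hb t ⟨e.le, ht.2⟩]
  refine ⟨t1, ⟨htc.trans ht1.1, hx0, h0, arc⟩, ?_⟩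
  obtain ⟨td, htd, hd, hxd⟩ := last t1 ht1.1.le (by rw [h0]; exact R.sc)
  exact hd.trans (S.pmono.monotone ((ro_w_smono S sol arc).monotoneOn
    ⟨htc.le.trans htd.1, htd.2.le⟩ ⟨(htc.trans ht1.1).le, le_rfl⟩ htd.2.le))

lemma ro_arc_unique {t0 t1 t1' : ℝ} (A : ROArc s x t0 t1) (A' : ROArc s x t0 t1') : t1 = t1' := by
  rcases lt_trichotomy t1 t1' with e | e | e
  · have := A'.2.2.2 t1 ⟨A.1, e⟩; rw [A.2.2.1] at this; exact absurd this (lt_irrefl _)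
  · exact e
  · have := A.2.2.2 t1' ⟨A'.1, e⟩; rw [A'.2.2.1] at this; exact absurd this (lt_irrefl _)

lemma ro_arc_end (S : ROSys a h b p s ws) (R : RORight a h b p s ws xc xb y₀ W)
    (sol : ROSol a h b p x w) {t0 t1 : ℝ} (A : ROArc s x t0 t1) (hw0 : w t0 < ws) :
    h xc ≤ p (w t1) := by
  obtain ⟨t1', A', h'⟩ := ro_return S R sol A.2.1 hw0
  rw [ro_arc_unique A A']; exact h'

lemma ro_arc_end' (S : ROSys a h b p s ws) (R : RORight a h b p s ws xc xb y₀ W)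
    (sol : ROSol a h b p x w) {t0 t1 : ℝ} (A : ROArc s x t0 t1) (hw0 : w t0 < ws) :
    ws < w t1 :=
  S.pmono.lt_iff_lt.1 (lt_of_lt_of_le R.pxc (ro_arc_end S R sol A hw0))

lemma ROArc.ge {t0 t1 : ℝ} (A : ROArc s x t0 t1) : ∀ t ∈ Icc t0 t1, s ≤ x t := fun t ht => by
  rcases ht.1.eq_or_lt with e | e
  · rw [← e, A.2.1]
  rcases ht.2.eq_or_lt with e' | e'
  · rw [e', A.2.2.1]
  exact (A.2.2.2 t ⟨e, e'⟩).le

lemma ro_bound (S : ROSys a h b p s ws) (R : RORight a h b p s ws xc xb y₀ W)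
    (sol : ROSol a h b p x w) {t0 t1 : ℝ} (A : ROArc s x t0 t1) (hw0 : w t0 < ws) :
    w t1 ≤ W := by
  have cx := sol.cx
  have cw := sol.cw
  obtain ⟨X, w1, r, β, hr, hβ, hb, hw1, hX, hXp, hneg, hW⟩ := R.bound
  refine le_trans ?_ hW
  by_contra hc
  have h0 : 0 ≤ β / r * (X - s) := mul_nonneg (by positivity) (by linarith)
  obtain ⟨td, htd, hd, hlast⟩ := ro_last (f := fun t => w1 - w t) (by fun_prop) A.1.le (by linarith) (by linarith)
  have hd : w td = w1 := by linarith
  have hXx : x td ≤ X := by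
    rcases htd.1.eq_or_lt with e | e
    · rw [← e, A.2.1]; exact hX.le
    · have := ro_nc (f := fun t => X - x t) (by fun_prop) (α := t0) (β := td) (by rw [A.2.1]; linarith) (fun t' ht' h0 => by
          have h0 : x t' = X := by linarith
          refine ⟨_, ?_, (sol t').1.const_sub X⟩
          rw [h0]
          have := mul_pos (S.apos X) (sub_pos.2 (hXp (w t')))
          linarith) td ⟨e, le_rfl⟩
      linarith
  have := ro_mono (f := fun t => -(w t + β / r * x t)) htd.2.le
    (fun t _ => ((sol t).2.add ((sol t).1.const_mul (β / r))).neg) (fun t ht => by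
      have h1 := hneg (x t) (A.ge t ⟨htd.1.trans ht.1.le, ht.2.le⟩) (w t) (by
        linarith [hlast t ⟨ht.1, ht.2.le⟩])
      have h2 := hb (x t)
      have h3 := mul_le_mul_of_nonneg_left h1 (show 0 ≤ β / r by positivity)
      have h4 : β / r * -r = -β := by field_simp
      linarith)
  simp only [hd, A.2.2.1] at this
  have h5 := mul_le_mul_of_nonneg_left hXx (show 0 ≤ β / r by positivity)
  rw [mul_sub] at hc
  linarith

lemma ro_turn (S : ROSys a h b p s ws) (R : RORight a h b p s ws xc xb y₀ W)
    (sol : ROSol a h b p x w) {t0 t1 : ℝ} (A : ROArc s x t0 t1) (hw0 : w t0 < ws) :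
    ∃ tm ∈ Ioo t0 t1, (∀ t ∈ Ico t0 tm, 0 < h (x t) - p (w t)) ∧ h (x tm) - p (w tm) = 0 ∧
      ∀ t ∈ Ioc tm t1, h (x t) - p (w t) < 0 := by
  have cx := sol.cx
  have cw := sol.cw
  have cp := S.cp
  have ch := S.ch
  have q0 : 0 < h (x t0) - p (w t0) := by
    rw [A.2.1, S.hs]; exact sub_pos.2 (S.pmono hw0)
  have q1 : h (x t1) - p (w t1) < 0 := by
    rw [A.2.2.1, S.hs]; exact sub_neg.2 (S.pmono (ro_arc_end' S R sol A hw0))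
  obtain ⟨tm, htm, h0, hb⟩ := ro_first (f := fun t => -(h (x t) - p (w t))) (by fun_prop) A.1.le (by linarith) (by linarith)
  have hm1 : tm < t1 := lt_of_le_of_ne htm.2 (by rintro rfl; linarith)
  refine ⟨tm, ⟨htm.1, hm1⟩, fun t ht => by linarith [hb t ht], by linarith, fun t ht => ?_⟩
  have := ro_nc (f := fun t => -(h (x t) - p (w t))) (by fun_prop) (α := tm) (β := t1) h0.ge (fun t' ht' h0' => by
    have hq : h (x t') - p (w t') = 0 := by linarith
    have ht1 : t' < t1 := lt_of_le_of_ne ht'.2 (by rintro rfl; linarith)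
    have hxs := A.2.2.2 t' ⟨htm.1.trans_le ht'.1, ht1⟩
    obtain ⟨d, hd, hpd⟩ := S.pd (w t')
    obtain ⟨K, hK⟩ := S.hlip
    have h1 : HasDerivAt x 0 t' := by simpa [hq] using (sol t').1
    have h2 := ((ro_lip_comp h1 hK).sub (hpd.comp t' (sol t').2)).neg
    refine ⟨_, ?_, h2⟩
    have := mul_pos hd (S.bpos _ hxs)
    linarith) t ht
  linarith
end

section
variable {a h b p : ℝ → ℝ} {s ws xc xb y₀ W : ℝ} {x w x1 w1 x2 w2 : ℝ → ℝ}

lemma ro_split (S : ROSys a h b p s ws) (R : RORight a h b p s ws xc xb y₀ W)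
    (sol : ROSol a h b p x w) {t0 t1 : ℝ} (A : ROArc s x t0 t1) (hw0 : w t0 < ws) (hy : p (w t0) ≤ y₀) :
    ∃ tb tc, t0 < tb ∧ tb < tc ∧ tc < t1 ∧ x tb = xb ∧ x tc = xb ∧
      (∀ t ∈ Icc t0 tb, 0 < h (x t) - p (w t)) ∧ (∀ t ∈ Icc tc t1, h (x t) - p (w t) < 0) ∧
      (∀ t ∈ Icc tb tc, xb ≤ x t) ∧ (∀ t ∈ Ioo t0 tb, x t ∈ Ioo s xb) ∧
      (∀ t ∈ Ioo tc t1, x t ∈ Ioo s xb) := by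
  have cx := sol.cx
  obtain ⟨wb, k, hk, hwb, hyb, hW⟩ := R.wedge2
  obtain ⟨tb, htb, hxb, hxs, hq⟩ := ro_wedge S hk R.sb (hwb.trans S.hs.ge) hW sol A.2.1
    (S.pmono.lt_iff_lt.1 (lt_of_le_of_lt hy hyb))
  obtain ⟨tm, htm, q1, q2, q3⟩ := ro_turn S R sol A hw0
  have hbm : tb < tm := by
    by_contra hc
    have := hq tm ⟨htm.1.le, not_lt.1 hc⟩
    linarith
  have m1 : StrictMonoOn x (Icc t0 tm) := ro_smonoOn (fun t _ => (sol t).1) (fun t ht =>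
    mul_pos (S.apos _) (q1 t ⟨ht.1.le, ht.2⟩))
  have m2 : StrictMonoOn (fun t => - x t) (Icc tm t1) := ro_smonoOn (fun t _ => (sol t).1.neg) (fun t ht => by
    have := mul_pos (S.apos (x t)) (show 0 < p (w t) - h (x t) by linarith [q3 t ⟨ht.1, ht.2.le⟩])
    linarith)
  have hxm : xb < x tm := hxb ▸ m1 ⟨htb.le, hbm.le⟩ ⟨htm.1.le, le_rfl⟩ hbm
  obtain ⟨tc, htc, hc⟩ := intermediate_value_Icc' htm.2.le cx.continuousOn
    (show xb ∈ Icc (x t1) (x tm) from ⟨by rw [A.2.2.1]; exact R.sb.le, hxm.le⟩)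
  have htc1 : tm < tc := lt_of_le_of_ne htc.1 (by rintro rfl; linarith)
  have htc2 : tc < t1 := lt_of_le_of_ne htc.2 (by rintro rfl; linarith [A.2.2.1, R.sb])
  refine ⟨tb, tc, htb, hbm.trans htc1, htc2, hxb, hc, hq, fun t ht => q3 t ⟨htc1.trans_le ht.1, ht.2⟩, ?_, ?_, ?_⟩
  · intro t ht
    rcases le_or_gt t tm with e | e
    · rw [← hxb]; exact m1.monotoneOn ⟨htb.le, hbm.le⟩ ⟨htb.le.trans ht.1, e⟩ ht.1
    · rw [← hc]
      have := m2.monotoneOn ⟨e.le, ht.2.trans htc2.le⟩ ⟨htc1.le, htc2.le⟩ ht.2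
      simpa using this
  · intro t ht
    exact ⟨hxs t ⟨ht.1, ht.2.le⟩, hxb ▸ m1 ⟨ht.1.le, ht.2.le.trans hbm.le⟩ ⟨htb.le, hbm.le⟩ ht.2⟩
  · intro t ht
    refine ⟨A.2.2.2 t ⟨htm.1.trans (htc1.trans ht.1), ht.2⟩, ?_⟩
    have := m2 ⟨htc1.le, htc2.le⟩ ⟨(htc1.trans ht.1).le, ht.2.le⟩ ht.1
    simp only at this
    linarith

section two
variable {t01 t11 t02 t12 : ℝ}

lemma ro_nomeet (S : ROSys a h b p s ws) (R : RORight a h b p s ws xc xb y₀ W)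
    (sol1 : ROSol a h b p x1 w1) (sol2 : ROSol a h b p x2 w2)
    (A1 : ROArc s x1 t01 t11) (A2 : ROArc s x2 t02 t12) (h12 : w2 t02 < w1 t01) (h1 : w1 t01 < ws) :
    ∀ t ∈ Icc t01 t11, ∀ t' ∈ Icc t02 t12, x1 t = x2 t' → w1 t ≠ w2 t' := by
  intro t ht t' ht' ex ew
  have e1 := ro_arc_end' S R sol1 A1 h1
  have e2 := ro_arc_end' S R sol2 A2 (h12.trans h1)
  rcases lt_trichotomy (t - t01) (t' - t02) with e | e | e
  · obtain ⟨g1, g2⟩ := S.uniq _ _ _ _ sol1 sol2 t t' ex ew (-(t - t01))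
    have r1 : t + -(t - t01) = t01 := by ring
    rw [r1] at g1 g2
    have hl : t02 < t' + -(t - t01) := by linarith
    rcases (show t' + -(t - t01) ≤ t12 by linarith [ht.1, ht'.2]).eq_or_lt with f | f
    · rw [f] at g2; linarith
    · have := A2.2.2.2 _ ⟨hl, f⟩
      rw [← g1, A1.2.1] at this; exact lt_irrefl _ this
  · obtain ⟨g1, g2⟩ := S.uniq _ _ _ _ sol1 sol2 t t' ex ew (-(t - t01))
    have r1 : t + -(t - t01) = t01 := by ring
    have r2 : t' + -(t - t01) = t02 := by rw [e]; ring
    rw [r1, r2] at g2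
    linarith
  · obtain ⟨g1, g2⟩ := S.uniq _ _ _ _ sol1 sol2 t t' ex ew (-(t' - t02))
    have r1 : t' + -(t' - t02) = t02 := by ring
    rw [r1] at g1 g2
    have hl : t01 < t + -(t' - t02) := by linarith
    rcases (show t + -(t' - t02) ≤ t11 by linarith [ht'.1, ht.2]).eq_or_lt with f | f
    · rw [f] at g2; linarith
    · have := A1.2.2.2 _ ⟨hl, f⟩
      rw [g1, A2.2.1] at this; exact lt_irrefl _ this

lemma ro_ends (S : ROSys a h b p s ws) (R : RORight a h b p s ws xc xb y₀ W)
    (sol1 : ROSol a h b p x1 w1) (sol2 : ROSol a h b p x2 w2)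
    (A1 : ROArc s x1 t01 t11) (A2 : ROArc s x2 t02 t12) (h12 : w2 t02 < w1 t01) (h1 : w1 t01 < ws) :
    w1 t11 < w2 t12 ∧ ∀ t ∈ Icc t01 t11, ∀ t' ∈ Icc t02 t12, w1 t = w2 t' → x1 t < x2 t' := by
  have nm := ro_nomeet S R sol1 sol2 A1 A2 h12 h1
  have e1 := ro_arc_end' S R sol1 A1 h1
  have e2 := ro_arc_end' S R sol2 A2 (h12.trans h1)
  have m1 := ro_w_smono S sol1 A1.2.2.2
  have m2 := ro_w_smono S sol2 A2.2.2.2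
  have cx1 := sol1.cx
  have cx2 := sol2.cx
  obtain ⟨ts, hts, es⟩ := intermediate_value_Icc A2.1.le sol2.cw.continuousOn
    (show w1 t01 ∈ Icc (w2 t02) (w2 t12) from ⟨h12.le, by linarith⟩)
  have g1 : t02 < ts := lt_of_le_of_ne hts.1 (by rintro rfl; linarith)
  have g2 : ts < t12 := lt_of_le_of_ne hts.2 (by rintro rfl; linarith)
  have g3 := A2.2.2.2 ts ⟨g1, g2⟩
  have first : w1 t11 < w2 t12 := by
    by_contra hc
    have hle := not_lt.1 hc
    obtain ⟨t2, ht2, f2⟩ := intermediate_value_Icc A1.1.le sol1.cw.continuousOn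
      (show w2 t12 ∈ Icc (w1 t01) (w1 t11) from ⟨by linarith, hle⟩)
    have := ro_order (y1 := w2) (z1 := fun t => - x2 t) (y2 := w1) (z2 := fun t => - x1 t)
      (α1 := ts) (β1 := t12) (α2 := t01) (β2 := t11) A1.1.le sol2.cw (by fun_prop) sol1.cw (by fun_prop) m1
      (fun t ht => ⟨by
        rw [← es]; exact m2.monotoneOn hts ⟨g1.le.trans ht.1, ht.2⟩ ht.1, by
        exact (m2.monotoneOn ⟨g1.le.trans ht.1, ht.2⟩ ⟨A2.1.le, le_rfl⟩ ht.2).trans hle⟩)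
      (fun t ht t' ht' ew ez => nm t' ht' t ⟨g1.le.trans ht.1, ht.2⟩ (by linarith) ew.symm)
      ⟨le_rfl, g2.le⟩ ⟨le_rfl, A1.1.le⟩ es (by rw [A1.2.1]; linarith) t12 ⟨g2.le, le_rfl⟩ t2 ht2 f2.symm
    have h3 := A1.ge t2 ht2
    simp only [A2.2.2.1] at this
    linarith
  refine ⟨first, ?_⟩
  refine ro_order (y1 := w1) (z1 := x1) (y2 := w2) (z2 := x2) A2.1.le sol1.cw cx1 sol2.cw cx2 m2
    (fun t ht => ⟨h12.le.trans (m1.monotoneOn ⟨le_rfl, A1.1.le⟩ ht ht.1),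
      (m1.monotoneOn ht ⟨A1.1.le, le_rfl⟩ ht.2).trans first.le⟩)
    (fun t ht t' ht' ew ex => nm t ht t' ht' ex ew)
    ⟨le_rfl, A1.1.le⟩ hts es.symm (by rw [A1.2.1]; exact g3)

lemma ro_energy (S : ROSys a h b p s ws) (R : RORight a h b p s ws xc xb y₀ W)
    (sol1 : ROSol a h b p x1 w1) (sol2 : ROSol a h b p x2 w2)
    (A1 : ROArc s x1 t01 t11) (A2 : ROArc s x2 t02 t12) (h12 : w2 t02 < w1 t01) (h1 : w1 t01 < ws)
    (hy1 : p (w1 t01) ≤ y₀) {P : ℝ → ℝ} (hP : ∀ w, HasDerivAt P (p w - p ws) w) :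
    P (w2 t12) - P (w2 t02) < P (w1 t11) - P (w1 t01) := by
  have nm := ro_nomeet S R sol1 sol2 A1 A2 h12 h1
  obtain ⟨hend, hord⟩ := ro_ends S R sol1 sol2 A1 A2 h12 h1
  have m1 := ro_w_smono S sol1 A1.2.2.2
  have m2 := ro_w_smono S sol2 A2.2.2.2
  have cx1 := sol1.cx
  have cx2 := sol2.cx
  have cw1 := sol1.cw
  have cw2 := sol2.cw
  have hy2 : p (w2 t02) ≤ y₀ := (S.pmono h12).le.trans hy1
  obtain ⟨tb1, tc1, l1, l2, l3, xb1, xc1, qb1, qc1, g1, ib1, ic1⟩ := ro_split S R sol1 A1 h1 hy1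
  obtain ⟨tb2, tc2, k1, k2, k3, xb2, xc2, qb2, qc2, g2, ib2, ic2⟩ := ro_split S R sol2 A2 (h12.trans h1) hy2
  obtain ⟨B, hB⟩ : ∃ B : ℝ → ℝ, ∀ x, HasDerivAt B (b x / a x) x :=
    ⟨fun u => ∫ y in s..u, b y / a y, fun x =>
      (Continuous.integral_hasStrictDerivAt (S.cb.div S.ca (fun x => (S.apos x).ne')) s x).hasDerivAt⟩
  have hE : ∀ x w : ℝ → ℝ, ROSol a h b p x w → ∀ t,
      HasDerivAt (fun t => P (w t) + B (x t)) (b (x t) * (h (x t) - p ws)) t := by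
    intro x w sol t
    have := ((hP (w t)).comp t (sol t).2).add ((hB (x t)).comp t (sol t).1)
    refine this.congr_deriv ?_
    have := (S.apos (x t)).ne'
    field_simp
    ring
  have cE : ∀ x w : ℝ → ℝ, ROSol a h b p x w → Continuous (fun t => P (w t) + B (x t)) := fun x w sol =>
    continuous_iff_continuousAt.2 fun t => (hE x w sol t).continuousAt
  -- rising monotonicity
  have mx1 : StrictMonoOn x1 (Icc t01 tb1) := ro_smonoOn (fun t _ => (sol1 t).1) (fun t ht =>
    mul_pos (S.apos _) (qb1 t (Ioo_subset_Icc_self ht)))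
  have mx2 : StrictMonoOn x2 (Icc t02 tb2) := ro_smonoOn (fun t _ => (sol2 t).1) (fun t ht =>
    mul_pos (S.apos _) (qb2 t (Ioo_subset_Icc_self ht)))
  have ordA : ∀ t ∈ Icc t02 tb2, ∀ t' ∈ Icc t01 tb1, x2 t = x1 t' → w2 t < w1 t' := by
    refine ro_order l1.le cx2 cw2 cx1 cw1 mx1 ?_ ?_ ⟨le_rfl, k1.le⟩ ⟨le_rfl, l1.le⟩ (by rw [A1.2.1, A2.2.1]) h12
    · intro t ht
      rw [A1.2.1, xb1, ← A2.2.1, ← xb2]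
      exact ⟨mx2.monotoneOn ⟨le_rfl, k1.le⟩ ht ht.1, mx2.monotoneOn ht ⟨k1.le, le_rfl⟩ ht.2⟩
    · intro t ht t' ht' ex ew
      exact nm t' ⟨ht'.1, by linarith [ht'.2]⟩ t ⟨ht.1, by linarith [ht.2]⟩ ex.symm ew.symm
  have stepA := (ro_graph (y1 := x1) (y2 := x2) l1 k1 cx2 (cE _ _ sol2) (fun t _ => (sol1 t).1) (fun t _ => (sol2 t).1)
    (fun t _ => hE _ _ sol1 t) (fun t _ => hE _ _ sol2 t)
    (fun t ht => mul_pos (S.apos _) (qb1 t (Ioo_subset_Icc_self ht)))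
    (fun t ht => mul_pos (S.apos _) (qb2 t (Ioo_subset_Icc_self ht)))
    (by rw [A1.2.1, A2.2.1]) (by rw [xb1, xb2])).2 (fun t ht t' ht' ex => by
      have o := S.pmono (ordA t' (Ioo_subset_Icc_self ht') t (Ioo_subset_Icc_self ht) ex.symm)
      have q1 := qb1 t (Ioo_subset_Icc_self ht)
      have i1 := ib1 t ht
      rw [← ex]
      have n := mul_pos (S.bpos _ i1.1) (sub_pos.2 (R.hbet _ i1))
      exact div_lt_div_of_pos_left n (mul_pos (S.apos _) q1)
        (mul_lt_mul_of_pos_left (by linarith) (S.apos _)))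
  -- falling
  have hrev : ∀ {f : ℝ → ℝ} {f' : ℝ → ℝ}, (∀ t, HasDerivAt f (f' t) t) → ∀ t, HasDerivAt (fun t => f (-t)) (-(f' (-t))) t := by
    intro f f' hf t
    exact ((hf (-t)).comp t (hasDerivAt_neg t)).congr_deriv (by ring)
  have dpos : ∀ {x w : ℝ → ℝ} {tc t1 : ℝ}, (∀ t ∈ Icc tc t1, h (x t) - p (w t) < 0) →
      ∀ t ∈ Ioo (-t1) (-tc), 0 < -(a (x (-t)) * (h (x (-t)) - p (w (-t)))) := by
    intro x w tc t1 hq t ht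
    have := mul_pos_of_neg_of_neg (neg_neg_of_pos (S.apos (x (-t)))) (hq (-t) ⟨by linarith [ht.2], by linarith [ht.1]⟩)
    linarith
  have nx1 : StrictMonoOn (fun t => x1 (-t)) (Icc (-t11) (-tc1)) :=
    ro_smonoOn (fun t _ => hrev (fun t => (sol1 t).1) t) (dpos qc1)
  have nx2 : StrictMonoOn (fun t => x2 (-t)) (Icc (-t12) (-tc2)) :=
    ro_smonoOn (fun t _ => hrev (fun t => (sol2 t).1) t) (dpos qc2)
  have ordC : ∀ t ∈ Icc (-t11) (-tc1), ∀ t' ∈ Icc (-t12) (-tc2), x1 (-t) = x2 (-t') → w1 (-t) < w2 (-t') := by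
    refine ro_order (y1 := fun t => x1 (-t)) (y2 := fun t => x2 (-t)) (z1 := fun t => w1 (-t)) (z2 := fun t => w2 (-t))
      (by linarith) (by fun_prop) (by fun_prop) (by fun_prop) (by fun_prop) nx2 ?_ ?_ ⟨le_rfl, by linarith⟩
      ⟨le_rfl, by linarith⟩ ?_ ?_
    · intro t ht
      have r1 := nx1.monotoneOn ⟨le_rfl, by linarith⟩ ht ht.1
      have r2 := nx1.monotoneOn ht ⟨by linarith, le_rfl⟩ ht.2
      simp only [neg_neg] at r1 r2 ⊢
      rw [A1.2.2.1] at r1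
      rw [xc1] at r2
      rw [A2.2.2.1, xc2]
      exact ⟨r1, r2⟩
    · intro t ht t' ht' ex ew
      exact nm (-t) ⟨by linarith [ht.2], by linarith [ht.1]⟩ (-t') ⟨by linarith [ht'.2], by linarith [ht'.1]⟩ ex ew
    · simp only [neg_neg]; rw [A1.2.2.1, A2.2.2.1]
    · simpa only [neg_neg] using hend
  have stepC := (ro_graph (y1 := fun t => x2 (-t)) (y2 := fun t => x1 (-t)) (α1 := -t12) (β1 := -tc2)
    (α2 := -t11) (β2 := -tc1) (E1 := fun t => P (w2 (-t)) + B (x2 (-t))) (E2 := fun t => P (w1 (-t)) + B (x1 (-t)))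
    (by linarith) (by linarith) (by fun_prop) ((cE _ _ sol1).comp continuous_neg)
    (fun t _ => hrev (fun t => (sol2 t).1) t) (fun t _ => hrev (fun t => (sol1 t).1) t)
    (fun t _ => hrev (fun t => hE _ _ sol2 t) t) (fun t _ => hrev (fun t => hE _ _ sol1 t) t)
    (dpos qc2) (dpos qc1) (by simp only [neg_neg]; rw [A1.2.2.1, A2.2.2.1])
    (by simp only [neg_neg]; rw [xc1, xc2])).2 (fun t ht t' ht' ex => by
      have o := S.pmono (ordC t' (Ioo_subset_Icc_self ht') t (Ioo_subset_Icc_self ht) ex.symm)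
      have i1 := ic1 (-t') ⟨by linarith [ht'.2], by linarith [ht'.1]⟩
      have q1 := qc1 (-t') ⟨by linarith [ht'.2], by linarith [ht'.1]⟩
      rw [ex]
      have n := mul_pos (S.bpos _ i1.1) (sub_pos.2 (R.hbet _ i1))
      rw [neg_div_neg_eq, neg_div_neg_eq]
      have aa := S.apos (x1 (-t'))
      have z1 : a (x1 (-t')) * (p (w1 (-t')) - h (x1 (-t'))) < a (x1 (-t')) * (p (w2 (-t)) - h (x1 (-t'))) :=
        mul_lt_mul_of_pos_left (by linarith) aa
      have z0 := mul_pos aa (show 0 < p (w1 (-t')) - h (x1 (-t')) by linarith)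
      have := div_lt_div_of_pos_left n z0 z1
      have e1 : a (x1 (-t')) * (h (x1 (-t')) - p (w1 (-t'))) = -(a (x1 (-t')) * (p (w1 (-t')) - h (x1 (-t')))) := by
        ring
      have e2 : a (x1 (-t')) * (h (x1 (-t')) - p (w2 (-t))) = -(a (x1 (-t')) * (p (w2 (-t)) - h (x1 (-t')))) := by
        ring
      rw [e1, e2, div_neg, div_neg]
      exact neg_lt_neg this)
  simp only [neg_neg] at stepC
  -- middle
  have wb12 : w2 tb2 < w1 tb1 := ordA tb2 ⟨k1.le, le_rfl⟩ tb1 ⟨l1.le, le_rfl⟩ (by rw [xb1, xb2])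
  have wc12 : w1 tc1 < w2 tc2 := by
    have := ordC (-tc1) ⟨by linarith, le_rfl⟩ (-tc2) ⟨by linarith, le_rfl⟩ (by simp only [neg_neg]; rw [xc1, xc2])
    simpa only [neg_neg] using this
  have wm1 : w1 tb1 < w1 tc1 := m1 ⟨l1.le, by linarith⟩ ⟨by linarith, l3.le⟩ l2
  obtain ⟨ta, hta, ea⟩ := intermediate_value_Icc k2.le cw2.continuousOn
    (show w1 tb1 ∈ Icc (w2 tb2) (w2 tc2) from ⟨wb12.le, by linarith⟩)
  obtain ⟨td, htd, ed⟩ := intermediate_value_Icc hta.2 cw2.continuousOn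
    (show w1 tc1 ∈ Icc (w2 ta) (w2 tc2) from ⟨by linarith, by linarith⟩)
  have had : ta < td := lt_of_le_of_ne htd.1 (by rintro rfl; linarith)
  have hle : ∀ u, xb ≤ u → h u ≤ p ws := fun u hu => R.hxb ▸ R.hanti (mem_Ici.2 le_rfl) (mem_Ici.2 hu) hu
  have dec : ∀ α β, tb2 ≤ α → α ≤ β → β ≤ tc2 → P (w2 β) + B (x2 β) ≤ P (w2 α) + B (x2 α) := by
    intro α β h1 h2 h3
    have := ro_mono (f := fun t => -(P (w2 t) + B (x2 t))) h2 (fun t _ => (hE _ _ sol2 t).neg) (fun t ht => by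
      have r := g2 t ⟨by linarith [ht.1], by linarith [ht.2]⟩
      have r2 := S.bpos _ (R.sb.trans_le r)
      have r3 := hle _ r
      have := mul_nonneg r2.le (sub_nonneg.2 r3)
      linarith)
    linarith
  have d1 := dec tb2 ta le_rfl hta.1 hta.2
  have d2 := dec td tc2 (hta.1.trans htd.1) htd.2 le_rfl
  have stepB := (ro_graph (y1 := w1) (y2 := w2) l2 had cw2 (cE _ _ sol2) (fun t _ => (sol1 t).2) (fun t _ => (sol2 t).2)
    (fun t _ => hE _ _ sol1 t) (fun t _ => hE _ _ sol2 t)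
    (fun t ht => S.bpos _ (R.sb.trans_le (g1 t (Ioo_subset_Icc_self ht))))
    (fun t ht => S.bpos _ (R.sb.trans_le (g2 t ⟨by linarith [ht.1, hta.1], by linarith [ht.2, htd.2]⟩)))
    ea.symm ed.symm).1 (fun t ht t' ht' ew => by
      have i1 := g1 t (Ioo_subset_Icc_self ht)
      have i2 := g2 t' ⟨by linarith [ht'.1, hta.1], by linarith [ht'.2, htd.2]⟩
      have o := hord t ⟨by linarith [ht.1], by linarith [ht.2]⟩ t' ⟨by linarith [ht'.1, hta.1], by linarith [ht'.2, htd.2]⟩ ew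
      rw [mul_div_cancel_left₀ _ (S.bpos _ (R.sb.trans_le i1)).ne', mul_div_cancel_left₀ _ (S.bpos _ (R.sb.trans_le i2)).ne']
      have := R.hanti (mem_Ici.2 i1) (mem_Ici.2 i2) o.le
      linarith)
  rw [A1.2.1, A2.2.1] at stepA
  rw [A1.2.2.1, A2.2.2.1] at stepC
  linarith
end two
end

section
variable {a h b p : ℝ → ℝ} {s ws xR xb yR WR xL xa yL WL : ℝ} {x w x1 w1 x2 w2 : ℝ → ℝ}

lemma ROSol.rot (sol : ROSol a h b p x w) :
    ROSol (fun x => a (-x)) (fun x => -h (-x)) (fun x => -b (-x)) (fun w => -p (-w))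
      (fun t => -x t) (fun t => -w t) := by
  intro t
  refine ⟨(sol t).1.neg.congr_deriv ?_, (sol t).2.neg.congr_deriv ?_⟩
  · simp only [neg_neg]; ring
  · simp only [neg_neg]

lemma ROSol.unrot (sol : ROSol (fun x => a (-x)) (fun x => -h (-x)) (fun x => -b (-x)) (fun w => -p (-w)) x w) :
    ROSol a h b p (fun t => -x t) (fun t => -w t) := by
  intro t
  refine ⟨(sol t).1.neg.congr_deriv ?_, (sol t).2.neg.congr_deriv ?_⟩
  · ring
  · ring

lemma ROSys.rot (S : ROSys a h b p s ws) :
    ROSys (fun x => a (-x)) (fun x => -h (-x)) (fun x => -b (-x)) (fun w => -p (-w)) (-s) (-ws) where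
  ca := S.ca.comp continuous_neg
  apos := fun x => S.apos _
  hlip := by
    obtain ⟨K, hK⟩ := S.hlip
    refine ⟨K, LipschitzWith.of_dist_le_mul fun u v => ?_⟩
    have := hK.dist_le_mul (-u) (-v)
    simpa [dist_neg_neg] using this
  cb := (S.cb.comp continuous_neg).neg
  bmono := fun u v huv => neg_le_neg (S.bmono (neg_le_neg huv))
  b0 := by simp [S.b0]
  bpos := fun x hx => by have := S.bneg (-x) (by linarith); linarith
  bneg := fun x hx => by have := S.bpos (-x) (by linarith); linarith
  pd := fun w => by
    obtain ⟨d, hd, h2⟩ := S.pd (-w)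
    exact ⟨d, hd, ((h2.comp w (hasDerivAt_neg w)).neg).congr_deriv (by ring)⟩
  hs := by simp [S.hs]
  uniq := by
    intro x1 w1 x2 w2 s1 s2 t1 t2 ex ew r
    have := S.uniq _ _ _ _ s1.unrot s2.unrot t1 t2 (by simp [ex]) (by simp [ew]) r
    simpa using this

structure ROBi (a h b p : ℝ → ℝ) (s ws xR xb yR WR xL xa yL WL : ℝ) : Prop where
  S : ROSys a h b p s ws
  R : RORight a h b p s ws xR xb yR WR
  L : RORight (fun x => a (-x)) (fun x => -h (-x)) (fun x => -b (-x)) (fun w => -p (-w)) (-s) (-ws) xL xa yL WL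
  hR : h (-xL) ≤ yR
  hL : -h xR ≤ yL

def ROFull (s : ℝ) (x : ℝ → ℝ) (t0 t1 t2 : ℝ) : Prop :=
  ROArc s x t0 t1 ∧ ROArc (-s) (fun t => -x t) t1 t2

lemma ro_full (Q : ROBi a h b p s ws xR xb yR WR xL xa yL WL) (sol : ROSol a h b p x w) {t0 : ℝ}
    (hx : x t0 = s) (hw : w t0 < ws) : ∃ t1 t2, ROFull s x t0 t1 t2 := by
  obtain ⟨t1, A, -⟩ := ro_return Q.S Q.R sol hx hw
  have := ro_arc_end' Q.S Q.R sol A hw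
  obtain ⟨t2, A2, -⟩ := ro_return Q.S.rot Q.L sol.rot (t0 := t1) (by simp [A.2.2.1]) (by linarith)
  exact ⟨t1, t2, A, A2⟩

lemma ro_full_prop (Q : ROBi a h b p s ws xR xb yR WR xL xa yL WL) (sol : ROSol a h b p x w) {t0 t1 t2 : ℝ}
    (F : ROFull s x t0 t1 t2) (hw : w t0 < ws) : x t2 = s ∧ ws < w t1 ∧ w t2 < ws ∧ p (w t2) ≤ h (-xL) ∧
      p (w t2) ≤ yR ∧ -p (w t1) ≤ yL ∧ w t1 ≤ WR ∧ -WL ≤ w t2 := by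
  have h1 := ro_arc_end' Q.S Q.R sol F.1 hw
  have h1' := ro_arc_end Q.S Q.R sol F.1 hw
  have hw' : -w t1 < -ws := by linarith
  have h2 := ro_arc_end' Q.S.rot Q.L sol.rot F.2 hw'
  have h2' := ro_arc_end Q.S.rot Q.L sol.rot F.2 hw'
  have h3 := ro_bound Q.S Q.R sol F.1 hw
  have h4 := ro_bound Q.S.rot Q.L sol.rot F.2 hw'
  have h5 := F.2.2.2.1
  simp only [neg_neg] at h2'
  have := Q.hR
  have := Q.hL
  refine ⟨by linarith, h1, by linarith, by linarith, by linarith, by linarith, h3, by linarith⟩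

lemma ro_full_lt (Q : ROBi a h b p s ws xR xb yR WR xL xa yL WL) (sol1 : ROSol a h b p x1 w1)
    (sol2 : ROSol a h b p x2 w2) {t01 t11 t21 t02 t12 t22 : ℝ}
    (F1 : ROFull s x1 t01 t11 t21) (F2 : ROFull s x2 t02 t12 t22) (h1 : w1 t01 < ws) (h12 : w2 t02 < w1 t01) :
    w2 t22 < w1 t21 := by
  have e := (ro_ends Q.S Q.R sol1 sol2 F1.1 F2.1 h12 h1).1
  have p1 := ro_full_prop Q sol1 F1 h1
  have := (ro_ends Q.S.rot Q.L sol1.rot sol2.rot F1.2 F2.2 (by linarith) (by linarith [p1.2.1])).1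
  linarith

lemma ro_full_uniq (Q : ROBi a h b p s ws xR xb yR WR xL xa yL WL) (sol1 : ROSol a h b p x1 w1)
    (sol2 : ROSol a h b p x2 w2) {t01 t11 t21 t02 t12 t22 : ℝ}
    (F1 : ROFull s x1 t01 t11 t21) (F2 : ROFull s x2 t02 t12 t22) (h1 : w1 t01 < ws)
    (e1 : w1 t21 = w1 t01) (e2 : w2 t22 = w2 t02) : ¬ w2 t02 < w1 t01 := by
  intro h12
  obtain ⟨P, hP⟩ : ∃ P : ℝ → ℝ, ∀ w, HasDerivAt P (p w - p ws) w :=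
    ⟨fun u => ∫ y in ws..u, (p y - p ws), fun w =>
      (Continuous.integral_hasStrictDerivAt (Q.S.cp.sub continuous_const) ws w).hasDerivAt⟩
  have e := (ro_ends Q.S Q.R sol1 sol2 F1.1 F2.1 h12 h1).1
  have p1 := ro_full_prop Q sol1 F1 h1
  have E1 := ro_energy Q.S Q.R sol1 sol2 F1.1 F2.1 h12 h1 (by rw [← e1]; exact p1.2.2.2.2.1) hP
  have E2 := ro_energy Q.S.rot Q.L sol1.rot sol2.rot F1.2 F2.2 (by linarith) (by linarith [p1.2.1])
    (by simp only [neg_neg]; exact p1.2.2.2.2.2.1) (P := fun w => P (-w)) (fun w =>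
      ((hP (-w)).comp w (hasDerivAt_neg w)).congr_deriv (by simp only [neg_neg]; ring))
  simp only [neg_neg] at E2
  rw [e1, e2] at E2
  linarith

lemma ro_gap (Q : ROBi a h b p s ws xR xb yR WR xL xa yL WL) : ∃ τ > 0, ∀ x w : ℝ → ℝ, ROSol a h b p x w →
    ∀ t0 t1, ROArc s x t0 t1 → w t0 < ws → t0 + τ ≤ t1 := by
  obtain ⟨X, w1, r, β, hr, hβ, hb, -⟩ := Q.R.bound
  obtain ⟨wk, hk1, hk2⟩ : ∃ wk, ws < wk ∧ p wk < h xR := by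
    have : ∀ᶠ y in 𝓝[>] ws, p y < h xR :=
      ((Q.S.cp.tendsto ws).eventually (gt_mem_nhds Q.R.pxc)).filter_mono nhdsWithin_le_nhds
    obtain ⟨y, hy, hy2⟩ := (this.and self_mem_nhdsWithin).exists
    exact ⟨y, hy2, hy⟩
  refine ⟨(wk - ws) / β, div_pos (by linarith) hβ, fun x w sol t0 t1 A hw => ?_⟩
  have h1 := ro_arc_end Q.S Q.R sol A hw
  have h2 : wk < w t1 := Q.S.pmono.lt_iff_lt.1 (hk2.trans_le h1)
  have h3 := ro_mono (f := fun t => β * t - w t) A.1.le (fun t _ => ((hasDerivAt_id t).const_mul β).sub (sol t).2)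
    (fun t _ => by have := hb (x t); simp only [mul_one]; linarith)
  have h4 : (wk - ws) / β ≤ t1 - t0 := by
    rw [div_le_iff₀ hβ]
    linarith
  linarith

lemma ro_full_next {t0 t1 t2 t' : ℝ} (F : ROFull s x t0 t1 t2) (h1 : ws < w t1) (ht : t0 < t') (hx : x t' = s)
    (hw : w t' < ws) : t2 ≤ t' := by
  by_contra hc
  rcases lt_trichotomy t' t1 with e | e | e
  · have := F.1.2.2.2 t' ⟨ht, e⟩; linarith
  · rw [e] at hw; linarith
  · have := F.2.2.2.2 t' ⟨e, by linarith⟩; linarith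

lemma ro_iter (Q : ROBi a h b p s ws xR xb yR WR xL xa yL WL) (sol : ROSol a h b p x w) {τ : ℝ}
    (hτ : ∀ t0 t1, ROArc s x t0 t1 → w t0 < ws → t0 + τ ≤ t1) (n : ℕ) : ∀ t0 t1 t2 t', t0 < t' → t' ≤ t0 + n * τ →
    ROFull s x t0 t1 t2 → w t0 < ws → x t' = s → w t' < ws →
    (w t0 < w t2 → w t0 < w t') ∧ (w t2 < w t0 → w t' < w t0) := by
  induction n with
  | zero => intro t0 t1 t2 t' h1 h2; simp at h2; linarith
  | succ n ih =>
    intro t0 t1 t2 t' h1 h2 F hw0 hx' hw'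
    have q := ro_full_prop Q sol F hw0
    rcases (ro_full_next F q.2.1 h1 hx' hw').eq_or_lt with e | e
    · rw [← e]; exact ⟨id, id⟩
    · obtain ⟨t3, t4, F'⟩ := ro_full Q sol q.1 q.2.2.1
      have h3 := hτ t0 t1 F.1 hw0
      have h4 := F.2.1
      have := ih t2 t3 t4 t' e (by push_cast at h2; linarith) F' q.2.2.1 hx' hw'
      constructor
      · intro h5
        exact h5.trans (this.1 (ro_full_lt Q sol sol F' F q.2.2.1 h5))
      · intro h5
        exact (this.2 (ro_full_lt Q sol sol F F' hw0 h5)).trans h5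

lemma ro_periodic_fixed (Q : ROBi a h b p s ws xR xb yR WR xL xa yL WL) (sol : ROSol a h b p x w) {T : ℝ}
    (hT : 0 < T) (hper : ∀ t, x (t + T) = x t ∧ w (t + T) = w t) (hnc : ∃ t t', ¬ (x t = x t' ∧ w t = w t')) :
    ∃ t0 t1 t2, ROFull s x t0 t1 t2 ∧ w t0 < ws ∧ w t2 = w t0 := by
  have cx := sol.cx
  obtain ⟨tm, -, hmin⟩ := isCompact_Icc.exists_isMinOn ⟨0, le_rfl, hT.le⟩ (sol.cw.continuousOn (s := Icc 0 T))
  have hmin : ∀ t, w tm ≤ w t := by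
    intro t
    have hp : Function.Periodic w T := fun t => (hper t).2
    obtain ⟨y, hy, hy2⟩ := hp.exists_mem_Ico₀ hT t
    rw [hy2]
    exact hmin (Ico_subset_Icc_self hy)
  have hd : b (x tm) = 0 := IsLocalMin.hasDerivAt_eq_zero (Eventually.of_forall hmin) (sol tm).2
  have hxm : x tm = s := by
    rcases lt_trichotomy (x tm) s with e | e | e
    · linarith [Q.S.bneg _ e]
    · exact e
    · linarith [Q.S.bpos _ e]
  have hwm : w tm < ws := by
    rcases lt_trichotomy (w tm) ws with e | e | e
    · exact e
    · exfalso
      have sol0 : ROSol a h b p (fun _ => s) (fun _ => ws) := fun t =>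
        ⟨(hasDerivAt_const t s).congr_deriv (by simp [Q.S.hs]), (hasDerivAt_const t ws).congr_deriv (by simp [Q.S.b0])⟩
      have := Q.S.uniq _ _ _ _ sol sol0 tm tm hxm e
      have h2 : ∀ t, x t = s ∧ w t = ws := fun t => by
        have := this (t - tm); simpa using this
      obtain ⟨t, t', hh⟩ := hnc
      exact hh ⟨by rw [(h2 t).1, (h2 t').1], by rw [(h2 t).2, (h2 t').2]⟩
    · exfalso
      have := ro_nc (f := fun t => s - x t) (by fun_prop) (α := tm) (β := tm + T) (by simp [hxm]) (fun t _ h0 => by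
        have h0 : x t = s := by linarith
        refine ⟨_, ?_, (sol t).1.const_sub s⟩
        rw [h0, Q.S.hs]
        have := mul_pos (Q.S.apos s) (sub_pos.2 (Q.S.pmono (e.trans_le (hmin t))))
        linarith) (tm + T) ⟨by linarith, le_rfl⟩
      rw [(hper tm).1, hxm] at this
      linarith
  obtain ⟨t1, t2, F⟩ := ro_full Q sol hxm hwm
  refine ⟨tm, t1, t2, F, hwm, ?_⟩
  obtain ⟨τ, hτ, hg⟩ := ro_gap Q
  obtain ⟨n, hn⟩ := exists_nat_gt (T / τ)
  rw [div_lt_iff₀ hτ] at hn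
  have := ro_iter Q sol (hg x w sol) n tm t1 t2 (tm + T) (by linarith) (by linarith) F hwm
    (by rw [(hper tm).1, hxm]) (by rw [(hper tm).2]; exact hwm)
  rw [(hper tm).2] at this
  rcases lt_trichotomy (w t2) (w tm) with e | e | e
  · exact absurd (this.2 e) (lt_irrefl _)
  · exact e
  · exact absurd (this.1 e) (lt_irrefl _)

lemma ro_unique (Q : ROBi a h b p s ws xR xb yR WR xL xa yL WL) (sol1 : ROSol a h b p x1 w1)
    (sol2 : ROSol a h b p x2 w2) {T1 T2 : ℝ} (hT1 : 0 < T1) (hT2 : 0 < T2)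
    (hper1 : ∀ t, x1 (t + T1) = x1 t ∧ w1 (t + T1) = w1 t) (hnc1 : ∃ t t', ¬ (x1 t = x1 t' ∧ w1 t = w1 t'))
    (hper2 : ∀ t, x2 (t + T2) = x2 t ∧ w2 (t + T2) = w2 t) (hnc2 : ∃ t t', ¬ (x2 t = x2 t' ∧ w2 t = w2 t')) :
    ∃ t1 t2, ∀ r, x1 (t1 + r) = x2 (t2 + r) ∧ w1 (t1 + r) = w2 (t2 + r) := by
  obtain ⟨t01, t11, t21, F1, l1, e1⟩ := ro_periodic_fixed Q sol1 hT1 hper1 hnc1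
  obtain ⟨t02, t12, t22, F2, l2, e2⟩ := ro_periodic_fixed Q sol2 hT2 hper2 hnc2
  have n1 := ro_full_uniq Q sol1 sol2 F1 F2 l1 e1 e2
  have n2 := ro_full_uniq Q sol2 sol1 F2 F1 l2 e2 e1
  exact ⟨t01, t02, Q.S.uniq _ _ _ _ sol1 sol2 t01 t02 (by rw [F1.1.2.1, F2.1.2.1]) (by linarith)⟩

lemma ro_exists (Q : ROBi a h b p s ws xR xb yR WR xL xa yL WL)
    (glob : ∀ y, ∃ x w : ℝ → ℝ, ROSol a h b p x w ∧ x 0 = s ∧ w 0 = y) :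
    ∃ (x w : ℝ → ℝ) (T : ℝ), 0 < T ∧ ROSol a h b p x w ∧ (∀ t, x (t + T) = x t ∧ w (t + T) = w t) ∧
      (∃ t t', w t ≠ w t') ∧ ∀ t, w t ≤ WR := by
  choose X V sol hX hV using glob
  have hF : ∀ y, ∃ t1 t2, y < ws → ROFull s (X y) 0 t1 t2 := by
    intro y
    by_cases hy : y < ws
    · obtain ⟨t1, t2, F⟩ := ro_full Q (sol y) (hX y) (by rw [hV]; exact hy)
      exact ⟨t1, t2, fun _ => F⟩
    · exact ⟨0, 0, fun h => absurd h hy⟩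
  choose τ1 τ2 F using hF
  let P : ℝ → ℝ := fun y => V y (τ2 y)
  have hP : ∀ y (hy : y < ws), _ := fun y hy => ro_full_prop Q (sol y) (F y hy) (by rw [hV]; exact hy)
  have Pmono : ∀ y y', y ≤ y' → y' < ws → P y ≤ P y' := by
    intro y y' h1 h2
    rcases h1.eq_or_lt with e | e
    · rw [e]
    · exact (ro_full_lt Q (sol y') (sol y) (F y' h2) (F y (h1.trans_lt h2)) (by rw [hV]; exact h2) (by rw [hV, hV]; exact e)).le
  obtain ⟨wk, hk1, hk2⟩ : ∃ wk, wk < ws ∧ h (-xL) < p wk := by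
    have hlt : h (-xL) < p ws := by have := Q.L.pxc; simp only [neg_neg] at this; linarith
    have : ∀ᶠ y in 𝓝[<] ws, h (-xL) < p y :=
      ((Q.S.cp.tendsto ws).eventually (lt_mem_nhds hlt)).filter_mono nhdsWithin_le_nhds
    obtain ⟨y, hy, hy2⟩ := (this.and self_mem_nhdsWithin).exists
    exact ⟨y, hy2, hy⟩
  have hWL : -WL < ws := by
    have := hP (ws - 1) (by linarith)
    linarith [this.2.2.2.2.2.2.2, this.2.2.1]
  let A : Set ℝ := {y | -WL ≤ y ∧ y < ws ∧ y ≤ P y}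
  have hA0 : -WL ∈ A := ⟨le_rfl, hWL, (hP _ hWL).2.2.2.2.2.2.2⟩
  have hAk : ∀ y ∈ A, y ≤ wk := fun y hy => by
    have h1 := (hP y hy.2.1).2.2.2.1
    have h2 : P y < wk := Q.S.pmono.lt_iff_lt.1 (lt_of_le_of_lt h1 hk2)
    linarith [hy.2.2]
  have hbdd : BddAbove A := ⟨wk, hAk⟩
  set c := sSup A with hc
  have hcle : ∀ y ∈ A, y ≤ c := fun y hy => le_csSup hbdd hy
  have hck : c ≤ wk := csSup_le ⟨_, hA0⟩ hAk
  have hcs : c < ws := hck.trans_lt hk1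
  have h1 : c ≤ P c := csSup_le ⟨_, hA0⟩ fun y hy => hy.2.2.trans (Pmono y c (hcle y hy) hcs)
  have q := hP c hcs
  have h2 : P c ≤ c := hcle _ ⟨q.2.2.2.2.2.2.2, q.2.2.1, Pmono _ _ h1 q.2.2.1⟩
  have hfix : V c (τ2 c) = V c 0 := by rw [hV]; exact le_antisymm h2 h1
  have FF := F c hcs
  have hper := Q.S.uniq _ _ _ _ (sol c) (sol c) (τ2 c) 0 (by rw [q.1, hX]) hfix
  have hTpos : 0 < τ2 c := FF.1.1.trans FF.2.1
  have hper' : ∀ t, X c (t + τ2 c) = X c t ∧ V c (t + τ2 c) = V c t := fun t => by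
    have := hper t
    rwa [zero_add, add_comm (τ2 c)] at this
  refine ⟨X c, V c, τ2 c, hTpos, sol c, hper', ⟨0, τ1 c, ?_⟩, ?_⟩
  · rw [hV]; linarith [q.2.1]
  · intro t
    have hp : Function.Periodic (V c) (τ2 c) := fun t => (hper' t).2
    obtain ⟨y, hy, hy2⟩ := hp.exists_mem_Ico₀ hTpos t
    rw [hy2]
    refine le_trans ?_ q.2.2.2.2.2.2.1
    rcases le_or_gt y (τ1 c) with e | e
    · exact (ro_w_smono Q.S (sol c) FF.1.2.2.2).monotoneOn ⟨hy.1, e⟩ ⟨FF.1.1.le, le_rfl⟩ e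
    · have := (ro_w_smono Q.S.rot (sol c).rot FF.2.2.2.2).monotoneOn ⟨le_rfl, FF.2.1.le⟩ ⟨e.le, hy.2.le⟩ e.le
      simpa using this
end

lemma ro_lip_mul {E : Type*} [PseudoMetricSpace E] {f g : E → ℝ} {Kf Kg A B : NNReal} (hf : LipschitzWith Kf f)
    (hg : LipschitzWith Kg g) (hA : ∀ z, |f z| ≤ A) (hB : ∀ z, |g z| ≤ B) :
    LipschitzWith (A * Kg + B * Kf) (fun z => f z * g z) := by
  refine LipschitzWith.of_dist_le_mul fun u v => ?_
  have h1 := hf.dist_le_mul u v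
  have h2 := hg.dist_le_mul u v
  rw [Real.dist_eq] at h1 h2 ⊢
  have e : f u * g u - f v * g v = f u * (g u - g v) + g v * (f u - f v) := by ring
  rw [e]
  refine (abs_add_le _ _).trans ?_
  rw [abs_mul, abs_mul]
  push_cast
  have h3 : |f u| * |g u - g v| ≤ A * (Kg * dist u v) := mul_le_mul (hA u) h2 (abs_nonneg _) A.2
  have h4 : |g v| * |f u - f v| ≤ B * (Kf * dist u v) := mul_le_mul (hB v) h1 (abs_nonneg _) B.2
  linarith

section
variable {a h b p : ℝ → ℝ} {Ka Kh Kb Kp A B C D : NNReal}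

def roField (a h b p : ℝ → ℝ) : ℝ × ℝ → ℝ × ℝ := fun z => (a z.1 * (h z.1 - p z.2), b z.1)

lemma ro_field_lip (la : LipschitzWith Ka a) (lh : LipschitzWith Kh h) (lb : LipschitzWith Kb b)
    (lp : LipschitzWith Kp p) (ba : ∀ x, |a x| ≤ A) (bh : ∀ x, |h x| ≤ B) (bp : ∀ x, |p x| ≤ D) :
    ∃ K, LipschitzWith K (roField a h b p) := by
  have l1 := la.comp (LipschitzWith.prod_fst (α := ℝ) (β := ℝ))
  have l2 := (lh.comp (LipschitzWith.prod_fst (α := ℝ) (β := ℝ))).sub (lp.comp (LipschitzWith.prod_snd (α := ℝ) (β := ℝ)))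
  have l3 := lb.comp (LipschitzWith.prod_fst (α := ℝ) (β := ℝ))
  exact ⟨_, (ro_lip_mul (A := A) (B := B + D) l1 l2 (fun z => ba _) (fun z => (abs_sub _ _).trans
    (add_le_add (bh _) (bp _)))).prodMk l3⟩

lemma ro_field_bdd (ba : ∀ x, |a x| ≤ A) (bh : ∀ x, |h x| ≤ B) (bb : ∀ x, |b x| ≤ C) (bp : ∀ x, |p x| ≤ D) :
    ∃ L : NNReal, ∀ z, ‖roField a h b p z‖ ≤ L := by
  refine ⟨A * (B + D) + C, fun z => ?_⟩
  rw [Prod.norm_def]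
  refine max_le ?_ ?_
  · simp only [roField, Real.norm_eq_abs, abs_mul]
    have := mul_le_mul (ba z.1) ((abs_sub _ _).trans (add_le_add (bh z.1) (bp z.2))) (abs_nonneg _) A.2
    push_cast
    have := C.2
    change (0:ℝ) ≤ (C:ℝ) at this
    linarith
  · simp only [roField, Real.norm_eq_abs]
    have := bb z.1
    have h2 : (0:ℝ) ≤ ((A * (B + D) : NNReal) : ℝ) := NNReal.coe_nonneg _
    rw [NNReal.coe_add]
    linarith

lemma ro_field_uniq {K : NNReal} (hK : LipschitzWith K (roField a h b p)) :
    ∀ x1 w1 x2 w2 : ℝ → ℝ, ROSol a h b p x1 w1 → ROSol a h b p x2 w2 → ∀ t1 t2,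
    x1 t1 = x2 t2 → w1 t1 = w2 t2 → ∀ r, x1 (t1 + r) = x2 (t2 + r) ∧ w1 (t1 + r) = w2 (t2 + r) := by
  intro x1 w1 x2 w2 s1 s2 t1 t2 ex ew r
  have key : ∀ (x w : ℝ → ℝ), ROSol a h b p x w → ∀ t0 t, HasDerivAt (fun r => (x (t0 + r), w (t0 + r)))
      (roField a h b p (x (t0 + t), w (t0 + t))) t := by
    intro x w sol t0 t
    exact HasDerivAt.prodMk ((sol (t0 + t)).1.comp_const_add t0 t) ((sol (t0 + t)).2.comp_const_add t0 t)
  have := ODE_solution_unique_univ (v := fun _ => roField a h b p) (s := fun _ => univ) (K := K) (t₀ := 0)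
    (fun t => hK.lipschitzOnWith) (fun t => ⟨key x1 w1 s1 t1 t, mem_univ _⟩) (fun t => ⟨key x2 w2 s2 t2 t, mem_univ _⟩)
    (by simp [ex, ew])
  have := congrFun this r
  simpa using this

lemma ro_field_glob {K L : NNReal} (hK : LipschitzWith K (roField a h b p))
    (hL : ∀ z, ‖roField a h b p z‖ ≤ L) (x₀ y : ℝ) : ∃ x w : ℝ → ℝ, ROSol a h b p x w ∧ x 0 = x₀ ∧ w 0 = y := by
  obtain ⟨Z, h0, hZ⟩ := ro_global _ hK hL (x₀, y)
  refine ⟨fun t => (Z t).1, fun t => (Z t).2, fun t => ⟨?_, ?_⟩, by simp [h0], by simp [h0]⟩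
  · exact hasFDerivAt_fst.comp_hasDerivAt t (hZ t)
  · exact hasFDerivAt_snd.comp_hasDerivAt t (hZ t)
end

/-- the truncated exponential -/
noncomputable def roP (M w : ℝ) : ℝ := Real.exp M + ∫ y in M..w, Real.exp (M - |y - M|)

lemma roP_deriv (M w : ℝ) : HasDerivAt (roP M) (Real.exp (M - |w - M|)) w :=
  (Continuous.integral_hasStrictDerivAt (f := fun y => Real.exp (M - |y - M|)) (by fun_prop) M w).hasDerivAt.const_add _

lemma roP_eq {M w : ℝ} (hw : w ≤ M) : roP M w = Real.exp w := by
  have : ∫ y in M..w, Real.exp (M - |y - M|) = ∫ y in M..w, Real.exp y := by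
    apply intervalIntegral.integral_congr
    intro y hy
    rw [uIcc_of_ge hw] at hy
    have : |y - M| = M - y := by rw [abs_of_nonpos (by linarith [hy.2])]; ring
    simp only [this]
    congr 1; ring
  rw [roP, this, integral_exp]; ring

lemma roP_mono (M : ℝ) : StrictMono (roP M) :=
  strictMono_of_hasDerivAt_pos (roP_deriv M) (fun _ => Real.exp_pos _)

lemma roP_pos (M w : ℝ) : 0 < roP M w := by
  rcases le_total w M with h | h
  · rw [roP_eq h]; exact Real.exp_pos _
  · have := (roP_mono M).monotone h
    rw [roP_eq le_rfl] at this
    exact (Real.exp_pos _).trans_le this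

lemma roP_lt (M w : ℝ) : roP M w < 2 * Real.exp M := by
  have hM := Real.exp_pos M
  rcases le_total w M with h | h
  · have := (roP_mono M).monotone h
    rw [roP_eq le_rfl] at this
    linarith
  · have h1 := ro_mono (f := fun y => - Real.exp (2 * M - y) - roP M y) (f' := fun y => Real.exp (2 * M - y) - Real.exp (M - |y - M|)) h
      (fun y _ => by
        refine HasDerivAt.sub ?_ (roP_deriv M y)
        exact ((((hasDerivAt_id y).const_sub (2*M)).exp).neg).congr_deriv (by simp))
      (fun y hy => by
        rw [abs_of_pos (by linarith [hy.1])]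
        apply le_of_eq
        rw [show 2 * M - y = M - (y - M) by ring, sub_self])
    simp only [roP_eq (le_refl M)] at h1
    rw [show 2 * M - M = M by ring] at h1
    have := Real.exp_pos (2 * M - w)
    linarith

lemma roP_lip (M : ℝ) : ∃ K, LipschitzWith K (roP M) := by
  refine ⟨(Real.exp M).toNNReal, lipschitzWith_of_nnnorm_deriv_le (fun w => (roP_deriv M w).differentiableAt) fun w => ?_⟩
  rw [(roP_deriv M w).deriv, ← NNReal.coe_le_coe]
  rw [coe_nnnorm, Real.norm_eq_abs, Real.abs_exp, Real.coe_toNNReal _ (Real.exp_pos _).le]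
  exact Real.exp_le_exp.2 (by linarith [abs_nonneg (w - M)])

/-- wedge condition from the saddle-like slope, abstract form -/
lemma ro_E1 {A Hf B Pf : ℝ → ℝ} {s xc ws m M a0 C : ℝ} (hsc : s < xc) (hm : 0 < m) (hM : 0 < M) (ha : 0 < a0)
    (hC : 0 < C) (hs : Pf ws = Hf s) (hH : ∀ x ∈ Ioc s xc, Hf s + 2 * m * (x - s) ≤ Hf x)
    (hP : ∀ z ∈ Icc (0:ℝ) 1, Pf (ws + z) ≤ Pf ws + M * z) (hA : ∀ x ∈ Ioc s xc, a0 ≤ A x)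
    (hB : ∀ x ∈ Ioc s xc, B x ≤ C * (x - s)) :
    ∃ k > 0, ∃ e > 0, k * (xc - s) ≤ 1 ∧ ∀ ε, 0 < ε → ε < e → ∀ x ∈ Ioc s xc,
      ε * B x < k * (A x * (Hf x - Pf (ws + k * (x - s)))) := by
  have hd : 0 < xc - s := by linarith
  refine ⟨min (1 / (xc - s)) (m / M), lt_min (by positivity) (by positivity), ?_⟩
  set k := min (1 / (xc - s)) (m / M) with hk
  have hk0 : 0 < k := lt_min (by positivity) (by positivity)
  have hk1 : k * (xc - s) ≤ 1 := by
    rw [← le_div_iff₀ hd]; exact min_le_left _ _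
  have hk2 : k * M ≤ m := by
    rw [← le_div_iff₀ hM]; exact min_le_right _ _
  refine ⟨k * a0 * m / C, by positivity, hk1, fun ε h0 hε x hx => ?_⟩
  rw [lt_div_iff₀ hC] at hε
  have hxs : 0 < x - s := by linarith [hx.1]
  have hz : k * (x - s) ∈ Icc (0:ℝ) 1 := ⟨by positivity, le_trans (mul_le_mul_of_nonneg_left (by linarith [hx.2]) hk0.le) hk1⟩
  have h1 := hP _ hz
  have h2 := hH x hx
  have h3 : m * (x - s) ≤ Hf x - Pf (ws + k * (x - s)) := by
    have := mul_le_mul_of_nonneg_right hk2 hxs.le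
    nlinarith
  have h4 : a0 * (m * (x - s)) ≤ A x * (Hf x - Pf (ws + k * (x - s))) :=
    mul_le_mul (hA x hx) h3 (by positivity) (ha.le.trans (hA x hx))
  have h5 := mul_le_mul_of_nonneg_left h4 hk0.le
  have h6 := mul_le_mul_of_nonneg_left (hB x hx) h0.le
  have h7 := mul_lt_mul_of_pos_right hε hxs
  nlinarith

lemma ro_E2 {A Hf B Pf : ℝ → ℝ} {s xb wb ws H0 a0 C : ℝ} (hsb : s < xb) (hw : wb < ws) (ha : 0 < a0)
    (hC : 0 < C) (hH : ∀ x ∈ Ioc s xb, H0 ≤ Hf x) (hPm : Monotone Pf)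
    (hP : Pf ((wb + ws) / 2) < H0) (hA : ∀ x ∈ Ioc s xb, a0 ≤ A x)
    (hB : ∀ x ∈ Ioc s xb, B x ≤ C) :
    ∃ k > 0, ∃ e > 0, k * (xb - s) ≤ (ws - wb) / 2 ∧ ∀ ε, 0 < ε → ε < e → ∀ x ∈ Ioc s xb,
      ε * B x < k * (A x * (Hf x - Pf (wb + k * (x - s)))) := by
  have hd : 0 < xb - s := by linarith
  have hd2 : 0 < ws - wb := by linarith
  have hg : 0 < H0 - Pf ((wb + ws) / 2) := by linarith
  refine ⟨(ws - wb) / 2 / (xb - s), by positivity, ?_⟩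
  set k := (ws - wb) / 2 / (xb - s) with hk
  have hk0 : 0 < k := by positivity
  have hk1 : k * (xb - s) = (ws - wb) / 2 := by rw [hk]; field_simp
  refine ⟨k * a0 * (H0 - Pf ((wb + ws) / 2)) / C, by positivity, hk1.le, fun ε h0 hε x hx => ?_⟩
  rw [lt_div_iff₀ hC] at hε
  have h1 : Pf (wb + k * (x - s)) ≤ Pf ((wb + ws) / 2) := hPm (by
    have := mul_le_mul_of_nonneg_left (show x - s ≤ xb - s by linarith [hx.2]) hk0.le
    linarith)
  have h2 := hH x hx
  have h4 : a0 * (H0 - Pf ((wb + ws) / 2)) ≤ A x * (Hf x - Pf (wb + k * (x - s))) :=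
    mul_le_mul (hA x hx) (by linarith) hg.le (ha.le.trans (hA x hx))
  have h5 := mul_le_mul_of_nonneg_left h4 hk0.le
  have h6 := mul_le_mul_of_nonneg_left (hB x hx) h0.le
  nlinarith

def roCl (l x : ℝ) : ℝ := max l (min 1 x)

lemma roCl_ge (l x : ℝ) : l ≤ roCl l x := le_max_left _ _
lemma roCl_le {l : ℝ} (hl : l ≤ 1) (x : ℝ) : roCl l x ≤ 1 := max_le hl (min_le_left _ _)
lemma roCl_eq {l x : ℝ} (h1 : l ≤ x) (h2 : x ≤ 1) : roCl l x = x := by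
  simp [roCl, h1, h2]
lemma roCl_mono (l : ℝ) : Monotone (roCl l) := fun _ _ h => max_le_max le_rfl (min_le_min le_rfl h)
lemma roCl_lip (l : ℝ) : LipschitzWith 1 (roCl l) :=
  (LipschitzWith.id.const_min 1).const_max l

structure ROH (H : ℝ → ℝ) (um s uM : ℝ) : Prop where
  m0 : 0 < um
  ms : um < s
  sM : s < uM
  M1 : uM < 1
  anti1 : StrictAntiOn H (Ioc 0 um)
  mono : StrictMonoOn H (Icc um uM)
  anti2 : StrictAntiOn H (Icc uM 1)
  H1 : H 1 = 0
  pos : ∀ u ∈ Ioo (0:ℝ) 1, 0 < H u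
  slope : ∃ m > 0, ∀ x y, (um + s) / 2 ≤ x → x ≤ y → y ≤ (s + uM) / 2 → H x + 2 * m * (y - x) ≤ H y
  lip : ∀ l, 0 < l → l ≤ 1 → ∃ K, LipschitzOnWith K H (Icc l 1)
  blow : ∀ M, ∃ l > 0, l < 1 ∧ ∀ u ∈ Ioc 0 l, M < H u

section
variable {H : ℝ → ℝ} {um s uM : ℝ}

lemma ROH.cont (hH : ROH H um s uM) {α β : ℝ} (hα : 0 < α) (hβ : β ≤ 1) : ContinuousOn H (Icc α β) := by
  rcases le_or_gt α 1 with h | h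
  · obtain ⟨K, hK⟩ := hH.lip α hα h
    exact hK.continuousOn.mono (Icc_subset_Icc le_rfl hβ)
  · rw [Icc_eq_empty (by linarith)]; exact continuousOn_empty _

lemma ROH.xb (hH : ROH H um s uM) : ∃ xb, uM < xb ∧ xb < 1 ∧ H xb = H s := by
  have h1 := hH.m0; have h2 := hH.ms; have h3 := hH.sM; have h4 := hH.M1
  have hs := hH.pos s ⟨by linarith, by linarith⟩
  have hM := hH.mono ⟨h2.le, h3.le⟩ ⟨by linarith, le_rfl⟩ h3
  obtain ⟨xb, hx, e⟩ := intermediate_value_Icc' h4.le (hH.cont (by linarith) le_rfl)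
    (show H s ∈ Icc (H 1) (H uM) from ⟨by rw [hH.H1]; exact hs.le, hM.le⟩)
  refine ⟨xb, lt_of_le_of_ne hx.1 ?_, lt_of_le_of_ne hx.2 ?_, e⟩
  · rintro rfl; linarith
  · rintro rfl; rw [hH.H1] at e; linarith

lemma ROH.xa (hH : ROH H um s uM) : ∃ xa, 0 < xa ∧ xa < um ∧ H xa = H s := by
  have h1 := hH.m0; have h2 := hH.ms; have h3 := hH.sM; have h4 := hH.M1
  have hm := hH.mono ⟨le_rfl, by linarith⟩ ⟨h2.le, h3.le⟩ h2
  obtain ⟨l, hl, -, hb⟩ := hH.blow (H s)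
  have hl2 : H s < H (min l um) := hb _ ⟨lt_min hl h1, min_le_left _ _⟩
  obtain ⟨xa, hx, e⟩ := intermediate_value_Icc' (min_le_right l um) (hH.cont (lt_min hl h1) (by linarith))
    (show H s ∈ Icc (H um) (H (min l um)) from ⟨hm.le, hl2.le⟩)
  refine ⟨xa, lt_of_lt_of_le (lt_min hl h1) hx.1, lt_of_le_of_ne hx.2 ?_, e⟩
  rintro rfl; linarith

lemma ro_trunc (hH : ROH H um s uM) {l M ε c : ℝ} (hl : 0 < l) (hls : l < s) (hM : Real.log (H s) ≤ M)
    (hε : 0 < ε) (hε1 : ε ≤ 1) (hc : 0 < c) (hc1 : c ≤ 1) :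
    ROSys (fun x => roCl l x ^ 2) (fun x => H (roCl l x)) (fun x => ε * (c * (roCl l x ^ 2 - s ^ 2))) (roP M) s
      (Real.log (H s)) ∧
    (∀ y, ∃ x w : ℝ → ℝ, ROSol (fun x => roCl l x ^ 2) (fun x => H (roCl l x))
      (fun x => ε * (c * (roCl l x ^ 2 - s ^ 2))) (roP M) x w ∧ x 0 = s ∧ w 0 = y) ∧
    (∀ x, |ε * (c * (roCl l x ^ 2 - s ^ 2))| ≤ 1) := by
  have h1 := hH.m0; have h2 := hH.ms; have h3 := hH.sM; have h4 := hH.M1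
  have hs0 : 0 < s := by linarith
  have hs1 : s < 1 := by linarith
  have hl1 : l ≤ 1 := by linarith
  have hHs := hH.pos s ⟨hs0, hs1⟩
  have cl0 : ∀ x, 0 < roCl l x := fun x => hl.trans_le (roCl_ge l x)
  have cl1 : ∀ x, roCl l x ≤ 1 := roCl_le hl1
  have la : LipschitzWith (1 * 1 + 1 * 1) (fun x => roCl l x ^ 2) := by
    have bd : ∀ x, |roCl l x| ≤ ((1 : NNReal) : ℝ) := fun x => by
      rw [abs_of_pos (cl0 x)]; simpa using cl1 x
    have := ro_lip_mul (roCl_lip l) (roCl_lip l) bd bd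
    simpa only [sq] using this
  have ba : ∀ x, |roCl l x ^ 2| ≤ ((1 : NNReal) : ℝ) := fun x => by
    rw [abs_of_pos (pow_pos (cl0 x) 2)]
    rw [NNReal.coe_one]; exact pow_le_one₀ (cl0 x).le (cl1 x)
  obtain ⟨K, hK⟩ := hH.lip l hl hl1
  have mem : ∀ x, roCl l x ∈ Icc l 1 := fun x => ⟨roCl_ge l x, cl1 x⟩
  have lh : LipschitzWith K (fun x => H (roCl l x)) := LipschitzWith.of_dist_le_mul fun u v => by
    refine (hK.dist_le_mul _ (mem u) _ (mem v)).trans ?_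
    have := (roCl_lip l).dist_le_mul u v
    simp only [NNReal.coe_one, one_mul] at this
    exact mul_le_mul_of_nonneg_left this K.2
  have bh : ∀ x, |H (roCl l x)| ≤ K := fun x => by
    have := hK.dist_le_mul _ (mem x) 1 ⟨hl1, le_rfl⟩
    rw [Real.dist_eq, Real.dist_eq, hH.H1, sub_zero] at this
    have h5 : |roCl l x - 1| ≤ 1 := by
      rw [abs_le]; exact ⟨by linarith [cl0 x], by linarith [cl1 x]⟩
    have h6 := mul_le_mul_of_nonneg_left h5 K.2
    change (K:ℝ) * _ ≤ (K:ℝ) * 1 at h6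
    linarith
  have hεc : 0 < ε * c := mul_pos hε hc
  have hεc1 : ε * c ≤ 1 := mul_le_one₀ hε1 hc.le hc1
  have bb : ∀ x, |ε * (c * (roCl l x ^ 2 - s ^ 2))| ≤ 1 := fun x => by
    rw [← mul_assoc, abs_mul, abs_of_pos hεc]
    refine mul_le_one₀ hεc1 (abs_nonneg _) ?_
    have g1 := pow_le_one₀ (cl0 x).le (cl1 x) (n := 2)
    have g2 := pow_pos (cl0 x) 2
    have g3 : s ^ 2 ≤ 1 := pow_le_one₀ hs0.le hs1.le
    have g4 := pow_pos hs0 2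
    rw [abs_le]; constructor <;> linarith
  have lb : LipschitzWith (1 * 1 + 1 * 1) (fun x => ε * (c * (roCl l x ^ 2 - s ^ 2))) :=
    LipschitzWith.of_dist_le_mul fun u v => by
      refine le_trans ?_ (la.dist_le_mul u v)
      rw [Real.dist_eq, Real.dist_eq]
      have e : ε * (c * (roCl l u ^ 2 - s ^ 2)) - ε * (c * (roCl l v ^ 2 - s ^ 2)) = (ε * c) * (roCl l u ^ 2 - roCl l v ^ 2) := by
        ring
      rw [e, abs_mul, abs_of_pos hεc]
      exact mul_le_of_le_one_left (abs_nonneg _) hεc1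
  obtain ⟨Kp, lp⟩ := roP_lip M
  have bp : ∀ w, |roP M w| ≤ ((2 * Real.exp M).toNNReal : ℝ) := fun w => by
    rw [abs_of_pos (roP_pos M w), Real.coe_toNNReal _ (by positivity)]
    exact (roP_lt M w).le
  obtain ⟨K', hK'⟩ := ro_field_lip la lh lb lp ba bh bp
  obtain ⟨L', hL'⟩ := ro_field_bdd (C := 1) (b := fun x => ε * (c * (roCl l x ^ 2 - s ^ 2))) ba bh
    (fun x => by rw [NNReal.coe_one]; exact bb x) bp
  have cls : roCl l s = s := roCl_eq hls.le hs1.le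
  refine ⟨?_, fun y => ro_field_glob hK' hL' s y, bb⟩
  have sqm : ∀ u v, roCl l u ≤ roCl l v → roCl l u ^ 2 ≤ roCl l v ^ 2 := fun u v huv =>
    pow_le_pow_left₀ (cl0 u).le huv 2
  constructor
  · exact la.continuous
  · exact fun x => pow_pos (cl0 x) 2
  · exact ⟨K, lh⟩
  · exact lb.continuous
  · intro u v huv
    have := sqm u v (roCl_mono l huv)
    exact mul_le_mul_of_nonneg_left (mul_le_mul_of_nonneg_left (by linarith) hc.le) hε.le
  · simp [cls]
  · intro x hx
    have : s < roCl l x := lt_max_of_lt_right (lt_min hs1 hx)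
    have := pow_lt_pow_left₀ this hs0.le two_ne_zero
    exact mul_pos hε (mul_pos hc (by linarith))
  · intro x hx
    have : roCl l x < s := max_lt hls (lt_of_le_of_lt (min_le_right _ _) hx)
    have := pow_lt_pow_left₀ this (cl0 x).le two_ne_zero
    exact mul_neg_of_pos_of_neg hε (mul_neg_of_pos_of_neg hc (by linarith))
  · exact fun w => ⟨_, Real.exp_pos _, roP_deriv M w⟩
  · simp only [cls]
    rw [roP_eq hM, Real.exp_log hHs]
  · exact ro_field_uniq hK'
end

section
variable {H : ℝ → ℝ} {um s uM : ℝ}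

lemma ro_exp_up (ws z : ℝ) (hz : z ∈ Icc (0:ℝ) 1) : Real.exp (ws + z) ≤ Real.exp ws + Real.exp (ws + 1) * z := by
  have h1 := Real.add_one_le_exp (-z)
  have h2 := Real.exp_pos (ws + z)
  have h3 : Real.exp ws = Real.exp (ws + z) * Real.exp (-z) := by rw [← Real.exp_add]; congr 1; ring
  have h4 : Real.exp (ws + z) ≤ Real.exp (ws + 1) := Real.exp_le_exp.2 (by linarith [hz.2])
  have h5 := mul_le_mul_of_nonneg_right h4 hz.1
  rw [h3]
  nlinarith

lemma ro_exp_down (ws z : ℝ) (_hz : z ∈ Icc (0:ℝ) 1) : -Real.exp (-(-ws + z)) ≤ -Real.exp (-(-ws)) + Real.exp ws * z := by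
  have h1 := Real.add_one_le_exp (-z)
  have h2 := Real.exp_pos ws
  have h3 : Real.exp (-(-ws + z)) = Real.exp ws * Real.exp (-z) := by rw [← Real.exp_add]; congr 1; ring
  rw [h3, neg_neg]
  nlinarith

set_option maxHeartbeats 4000000 in
lemma ro_concrete (hH : ROH H um s uM) {c : ℝ} (hc : 0 < c) (hc1 : c ≤ 1) :
    ∃ ε₀ > 0, ∃ l0 > 0, l0 < s ∧ ∃ M0 WR xb xa : ℝ, WR ≤ M0 ∧ Real.log (H s) ≤ M0 ∧
      ∀ ε, 0 < ε → ε < ε₀ → ε ≤ 1 ∧ ∀ l, 0 < l → l ≤ l0 → ∀ M, M0 ≤ M → 2 * Real.exp M < H l →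
      ∃ WL, ROBi (fun x => roCl l x ^ 2) (fun x => H (roCl l x)) (fun x => ε * (c * (roCl l x ^ 2 - s ^ 2)))
        (roP M) s (Real.log (H s)) ((s + uM) / 2) xb (H ((um + s) / 2)) WR (-((um + s) / 2)) (-xa)
        (-H ((s + uM) / 2)) WL := by
  have h1 := hH.m0; have h2 := hH.ms; have h3 := hH.sM; have h4 := hH.M1
  obtain ⟨xb, hb1, hb2, hbe⟩ := hH.xb
  obtain ⟨xa, ha1, ha2, hae⟩ := hH.xa
  obtain ⟨m, hm, hsl⟩ := hH.slope
  have hs0 : 0 < s := by linarith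
  have hs1 : s < 1 := by linarith
  have hHs := hH.pos s ⟨hs0, hs1⟩
  set xm := (um + s) / 2 with hxm
  set xM := (s + uM) / 2 with hxM
  set ws := Real.log (H s) with hws
  have ews : Real.exp ws = H s := Real.exp_log hHs
  have xm1 : um < xm := by rw [hxm]; linarith
  have xm2 : xm < s := by rw [hxm]; linarith
  have xM1 : s < xM := by rw [hxM]; linarith
  have xM2 : xM < uM := by rw [hxM]; linarith
  have Hm : H xm < H s := hH.mono ⟨xm1.le, by linarith⟩ ⟨h2.le, h3.le⟩ xm2
  have HM : H s < H xM := hH.mono ⟨h2.le, h3.le⟩ ⟨by linarith, xM2.le⟩ xM1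
  have Hm0 : 0 < H xm := hH.pos xm ⟨by linarith, by linarith⟩
  have Hum0 : 0 < H um := hH.pos um ⟨by linarith, by linarith⟩
  have Hums : H um < H s := hH.mono ⟨le_rfl, by linarith⟩ ⟨h2.le, h3.le⟩ h2
  have HuM0 : 0 < H uM := hH.pos uM ⟨by linarith, by linarith⟩
  have HsuM : H s < H uM := hH.mono ⟨h2.le, h3.le⟩ ⟨by linarith, le_rfl⟩ h3
  -- global shape facts
  have gt_right : ∀ x ∈ Ioo s xb, H s < H x := by
    intro x hx
    rcases le_or_gt x uM with e | e
    · exact hH.mono ⟨h2.le, h3.le⟩ ⟨by linarith [hx.1], e⟩ hx.1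
    · rw [← hbe]; exact hH.anti2 ⟨e.le, by linarith [hx.2]⟩ ⟨hb1.le, hb2.le⟩ hx.2
  have lt_left : ∀ x ∈ Ioo xa s, H x < H s := by
    intro x hx
    rcases le_or_gt um x with e | e
    · exact hH.mono ⟨e, by linarith [hx.2]⟩ ⟨h2.le, h3.le⟩ hx.2
    · rw [← hae]; exact hH.anti1 ⟨ha1, ha2.le⟩ ⟨by linarith [hx.1], e.le⟩ hx.1
  have le_right : ∀ x ∈ Icc s 1, H x ≤ H uM := by
    intro x hx
    rcases le_or_gt x uM with e | e
    · exact hH.mono.monotoneOn ⟨by linarith [hx.1], e⟩ ⟨by linarith, le_rfl⟩ e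
    · exact hH.anti2.antitoneOn ⟨le_rfl, h4.le⟩ ⟨e.le, hx.2⟩ e.le
  have ge_left : ∀ x, 0 < x → x ≤ s → H um ≤ H x := by
    intro x hx0 hx
    rcases le_or_gt um x with e | e
    · exact hH.mono.monotoneOn ⟨le_rfl, by linarith⟩ ⟨e, by linarith⟩ e
    · exact hH.anti1.antitoneOn ⟨hx0, e.le⟩ ⟨h1, le_rfl⟩ e.le
  -- eps conditions
  obtain ⟨k1, hk1, e1, he1, hkk1, hw1⟩ := ro_E1 (A := fun x => x ^ 2) (Hf := H) (B := fun x => c * (x ^ 2 - s ^ 2))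
    (Pf := Real.exp) (s := s) (xc := xM) (ws := ws) (m := m) (M := Real.exp (ws + 1)) (a0 := s ^ 2) (C := 2) xM1 hm
    (Real.exp_pos _) (by positivity) (by norm_num) ews
    (fun x hx => hsl s x xm2.le hx.1.le hx.2) (fun z hz => ro_exp_up ws z hz)
    (fun x hx => pow_le_pow_left₀ hs0.le hx.1.le 2)
    (fun x hx => by
      have q1 : 0 < x - s := by linarith [hx.1]
      have q2 : x < 1 := by linarith [hx.2]
      have q3 : c * (x - s) ≤ 1 * (x - s) := mul_le_mul_of_nonneg_right hc1 q1.le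
      have q4 := mul_nonneg hc.le q1.le
      nlinarith)
  set wb := Real.log ((H xm + H s) / 2) with hwb
  have ewb : Real.exp wb = (H xm + H s) / 2 := Real.exp_log (by linarith)
  have wbs : wb < ws := Real.exp_lt_exp.1 (by rw [ewb, ews]; linarith)
  obtain ⟨k2, hk2, e2, he2, hkk2, hw2⟩ := ro_E2 (A := fun x => x ^ 2) (Hf := H) (B := fun x => c * (x ^ 2 - s ^ 2))
    (Pf := Real.exp) (s := s) (xb := xb) (wb := wb) (ws := ws) (H0 := H s) (a0 := s ^ 2) (C := 2) (by linarith) wbs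
    (by positivity) (by norm_num)
    (fun x hx => by
      rcases hx.2.eq_or_lt with e | e
      · rw [e, hbe]
      · exact (gt_right x ⟨hx.1, e⟩).le) Real.exp_monotone (by rw [← ews]; exact Real.exp_lt_exp.2 (by linarith))
    (fun x hx => pow_le_pow_left₀ hs0.le hx.1.le 2)
    (fun x hx => by
      have q0 : 0 < x := by linarith [hx.1]
      have q2 : x < 1 := by linarith [hx.2]
      have q3 : x ^ 2 ≤ 1 := pow_le_one₀ q0.le q2.le
      have q4 : c * (x ^ 2 - s ^ 2) ≤ c * 1 := mul_le_mul_of_nonneg_left (by nlinarith) hc.le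
      linarith)
  obtain ⟨k3, hk3, e3, he3, hkk3, hw3⟩ := ro_E1 (A := fun x => (-x) ^ 2) (Hf := fun x => -H (-x))
    (B := fun x => -(c * ((-x) ^ 2 - s ^ 2)))
    (Pf := fun w => -Real.exp (-w)) (s := -s) (xc := -xm) (ws := -ws) (m := m) (M := Real.exp ws) (a0 := xm ^ 2) (C := 2)
    (by linarith) hm (Real.exp_pos _) (by have : 0 < xm := by linarith
                                          positivity) (by norm_num) (by simp [ews])
    (fun x hx => by
      have := hsl (-x) s (by linarith [hx.2]) (by linarith [hx.1]) xM1.le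
      simp only [neg_neg]; linarith) (fun z hz => ro_exp_down ws z hz)
    (fun x hx => pow_le_pow_left₀ (by linarith) (by linarith [hx.2]) 2)
    (fun x hx => by
      have q1 : 0 < s + x := by linarith [hx.1]
      have q2 : 0 < -x := by linarith [hx.2]
      have q3 : c * (s + x) ≤ 1 * (s + x) := mul_le_mul_of_nonneg_right hc1 q1.le
      have q4 := mul_nonneg hc.le q1.le
      have q5 : -(c * ((-x) ^ 2 - s ^ 2)) = c * (s + x) * (s - x) := by ring
      rw [q5]
      have q6 : c * (s + x) * (s - x) ≤ c * (s + x) * 2 := mul_le_mul_of_nonneg_left (by linarith) q4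
      linarith)
  set wb' := Real.log ((H xM + H s) / 2) with hwb'
  have ewb' : Real.exp wb' = (H xM + H s) / 2 := Real.exp_log (by linarith)
  have wbs' : ws < wb' := Real.exp_lt_exp.1 (by rw [ewb', ews]; linarith)
  obtain ⟨k4, hk4, e4, he4, hkk4, hw4⟩ := ro_E2 (A := fun x => (-x) ^ 2) (Hf := fun x => -H (-x))
    (B := fun x => -(c * ((-x) ^ 2 - s ^ 2)))
    (Pf := fun w => -Real.exp (-w)) (s := -s) (xb := -xa) (wb := -wb') (ws := -ws) (H0 := -H s) (a0 := xa ^ 2) (C := 2)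
    (by linarith) (by linarith)
    (by positivity) (by norm_num)
    (fun x hx => by
      rcases hx.2.eq_or_lt with e | e
      · simp only [e, neg_neg, hae, le_refl]
      · exact neg_le_neg (lt_left (-x) ⟨by linarith, by linarith [hx.1]⟩).le)
    (fun u v huv => neg_le_neg (Real.exp_le_exp.2 (neg_le_neg huv)))
    (by rw [← ews]; exact neg_lt_neg (Real.exp_lt_exp.2 (by linarith)))
    (fun x hx => pow_le_pow_left₀ ha1.le (by linarith [hx.2]) 2)
    (fun x hx => by
      have q3 : s ^ 2 ≤ 1 := pow_le_one₀ hs0.le hs1.le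
      have q4 : c * (s ^ 2 - (-x) ^ 2) ≤ c * 1 := mul_le_mul_of_nonneg_left (by nlinarith) hc.le
      linarith)
  set wr := Real.log (H uM + 1) with hwr
  have ewr : Real.exp wr = H uM + 1 := Real.exp_log (by linarith)
  have wsr : ws ≤ wr := Real.exp_le_exp.1 (by rw [ews, ewr]; linarith)
  set wl := Real.log (H um / 2) with hwl
  have ewl : Real.exp wl = H um / 2 := Real.exp_log (by linarith)
  have wsl : wl ≤ ws := Real.exp_le_exp.1 (by rw [ews, ewl]; linarith)
  set WR := wr + 1 / s ^ 2 * (1 - s) with hWR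
  have hWRr : wr ≤ WR := by
    have : 0 ≤ 1 / s ^ 2 * (1 - s) := mul_nonneg (by positivity) (by linarith)
    linarith
  refine ⟨min 1 (min (min e1 e2) (min e3 e4)), by positivity, xa, ha1, by linarith,
    max WR (max (ws + 1) wb'), WR, xb, xa, le_max_left _ _,
    le_trans (by linarith) ((le_max_left (ws + 1) wb').trans (le_max_right _ _)), fun ε hε hεlt => ?_⟩
  have E0 : ε < 1 := hεlt.trans_le (min_le_left _ _)
  have E1 : ε < e1 := hεlt.trans_le ((min_le_right _ _).trans ((min_le_left _ _).trans (min_le_left _ _)))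
  have E2 : ε < e2 := hεlt.trans_le ((min_le_right _ _).trans ((min_le_left _ _).trans (min_le_right _ _)))
  have E3 : ε < e3 := hεlt.trans_le ((min_le_right _ _).trans ((min_le_right _ _).trans (min_le_left _ _)))
  have E4 : ε < e4 := hεlt.trans_le ((min_le_right _ _).trans ((min_le_right _ _).trans (min_le_right _ _)))
  refine ⟨E0.le, fun l hl hla M hM hlM => ?_⟩
  have M1 : WR ≤ M := (le_max_left _ _).trans hM
  have M2 : ws + 1 ≤ M := ((le_max_left (ws + 1) wb').trans (le_max_right _ _)).trans hM
  have M3 : wb' ≤ M := ((le_max_right (ws + 1) wb').trans (le_max_right _ _)).trans hM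
  obtain ⟨S, -, bb⟩ := ro_trunc hH (l := l) (M := M) hl (by linarith) (by linarith) hε E0.le hc hc1
  have cle : ∀ x, l ≤ x → x ≤ 1 → roCl l x = x := fun x => roCl_eq
  have cl1 : ∀ x, roCl l x ≤ 1 := roCl_le (by linarith)
  have cl0 : ∀ x, 0 < roCl l x := fun x => hl.trans_le (roCl_ge l x)
  have cls : roCl l s = s := cle s (by linarith) hs1.le
  have pws : roP M ws = H s := by rw [roP_eq (by linarith), ews]
  have clxm : roCl l xm = xm := cle _ (by linarith) (by linarith)
  have clxM : roCl l xM = xM := cle _ (by linarith) (by linarith)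
  refine ⟨-wl + 1 / (l ^ 2 * (H um / 2)) * (-l - -s), S, ?_, ?_, ?_, ?_⟩
  · constructor
    · exact xM1
    · intro x hx
      beta_reduce
      rw [clxM, cle x (by linarith [hx.1]) (by linarith [hx.2])]
      exact hH.mono.monotoneOn ⟨by linarith [hx.1], by linarith [hx.2]⟩ ⟨by linarith, xM2.le⟩ hx.2
    · beta_reduce
      rw [clxM, pws]; exact HM
    · refine ⟨k1, hk1, fun x hx => ?_⟩
      have := hw1 ε hε E1 x hx
      have q : k1 * (x - s) ≤ 1 := le_trans (mul_le_mul_of_nonneg_left (by linarith [hx.2]) hk1.le) hkk1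
      beta_reduce
      rw [cle x (by linarith [hx.1]) (by linarith [hx.2]), roP_eq (by linarith)]
      exact this
    · linarith
    · beta_reduce
      rw [cle xb (by linarith) hb2.le, pws, hbe]
    · intro x hx
      beta_reduce
      rw [cle x (by linarith [hx.1]) (by linarith [hx.2]), pws]; exact gt_right x hx
    · intro u hu v hv huv
      beta_reduce
      have hu : xb ≤ u := hu
      have hv : xb ≤ v := hv
      have g : ∀ y, xb ≤ y → xb ≤ roCl l y := fun y hy => le_max_of_le_right (le_min hb2.le hy)
      exact hH.anti2.antitoneOn ⟨hb1.le.trans (g u hu), cl1 u⟩ ⟨hb1.le.trans (g v hv), cl1 v⟩ (roCl_mono l huv)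
    · refine ⟨wb, k2, hk2, ((roP_mono M).monotone wbs.le), ?_, fun x hx => ?_⟩
      · rw [roP_eq (by linarith), ewb]; linarith
      have := hw2 ε hε E2 x hx
      have q : k2 * (x - s) ≤ (ws - wb) / 2 := le_trans (mul_le_mul_of_nonneg_left (by linarith [hx.2]) hk2.le) hkk2
      beta_reduce
      rw [cle x (by linarith [hx.1]) (by linarith [hx.2]), roP_eq (by linarith)]
      exact this
    · refine ⟨1, wr, s ^ 2, 1, by positivity, one_pos, fun x => (le_abs_self _).trans (bb x), wsr, hs1, ?_, ?_, le_rfl⟩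
      · intro w
        beta_reduce
        rw [cle 1 (by linarith) le_rfl, hH.H1]; exact roP_pos M w
      · intro x hx w hw
        beta_reduce
        have g1 : s ≤ roCl l x := by rw [← cls]; exact roCl_mono l hx
        have g2 := le_right _ ⟨g1, cl1 x⟩
        have g3 : H uM + 1 ≤ roP M w := by
          rw [← ewr, ← roP_eq (M := M) (by linarith)]; exact (roP_mono M).monotone hw
        have g4 : s ^ 2 ≤ roCl l x ^ 2 := pow_le_pow_left₀ hs0.le g1 2
        nlinarith
  · constructor
    · linarith
    · intro x hx
      simp only [neg_neg]
      rw [clxm, cle (-x) (by linarith [hx.2]) (by linarith [hx.1])]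
      exact neg_le_neg (hH.mono.monotoneOn ⟨xm1.le, by linarith⟩ ⟨by linarith [hx.2], by linarith [hx.1]⟩ (by linarith [hx.2]))
    · simp only [neg_neg]
      rw [clxm, pws]; linarith
    · refine ⟨k3, hk3, fun x hx => ?_⟩
      have := hw3 ε hε E3 x hx
      have q0 : 0 < k3 * (x - -s) := mul_pos hk3 (by linarith [hx.1])
      beta_reduce
      rw [cle (-x) (by linarith [hx.2]) (by linarith [hx.1]), roP_eq (by linarith)]
      rw [← mul_neg]
      exact this
    · linarith
    · simp only [neg_neg]
      rw [cle xa (by linarith) (by linarith), pws, hae]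
    · intro x hx
      simp only [neg_neg]
      rw [cle (-x) (by linarith [hx.2]) (by linarith [hx.1]), pws]
      exact neg_lt_neg (lt_left (-x) ⟨by linarith [hx.2], by linarith [hx.1]⟩)
    · intro u hu v hv huv
      beta_reduce
      have hu : -xa ≤ u := hu
      have hv : -xa ≤ v := hv
      have g : ∀ y, -xa ≤ y → roCl l (-y) ≤ xa := fun y hy => max_le hla ((min_le_right _ _).trans (by linarith))
      exact neg_le_neg (hH.anti1.antitoneOn ⟨cl0 _, (g v hv).trans ha2.le⟩ ⟨cl0 _, (g u hu).trans ha2.le⟩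
        (roCl_mono l (neg_le_neg huv)))
    · refine ⟨-wb', k4, hk4, ?_, ?_, fun x hx => ?_⟩
      · simp only [neg_neg]; exact neg_le_neg ((roP_mono M).monotone wbs'.le)
      · simp only [neg_neg]
        rw [roP_eq M3, ewb']; linarith
      have := hw4 ε hε E4 x hx
      have q0 : 0 < k4 * (x - -s) := mul_pos hk4 (by linarith [hx.1])
      beta_reduce
      rw [cle (-x) (by linarith [hx.2]) (by linarith [hx.1]), roP_eq (by linarith)]
      rw [← mul_neg]
      exact this
    · refine ⟨-l, -wl, l ^ 2 * (H um / 2), 1, by positivity, one_pos, fun x => (neg_le_abs _).trans (bb (-x)), by linarith,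
        by linarith, ?_, ?_, le_rfl⟩
      · intro w
        simp only [neg_neg]
        rw [cle l le_rfl (by linarith)]
        have := roP_lt M (-w)
        linarith
      · intro x hx w hw
        beta_reduce
        have g1 : roCl l (-x) ≤ s := by rw [← cls]; exact roCl_mono l (by linarith)
        have g2 := ge_left _ (cl0 (-x)) g1
        have g3 : roP M (-w) ≤ H um / 2 := by
          rw [← ewl, ← roP_eq (M := M) (by linarith)]; exact (roP_mono M).monotone (by linarith)
        have g4 : l ^ 2 ≤ roCl l (-x) ^ 2 := pow_le_pow_left₀ hl.le (roCl_ge l _) 2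
        nlinarith
  · simp only [neg_neg]; rw [clxm]
  · beta_reduce; rw [clxM]
end

noncomputable def roH (θ η u : ℝ) : ℝ := (1 - u) * (u + θ) * (u ^ 2 + η) / u

def roF (θ η : ℝ) (u : ℝ) : ℝ :=
  3 * u ^ 4 - 2 * (1 - θ) * u ^ 3 - (θ - η) * u ^ 2 + η * θ

lemma roH_deriv (θ η : ℝ) {u : ℝ} (hu : 0 < u) : HasDerivAt (roH θ η) (-roF θ η u / u ^ 2) u := by
  have h1 : HasDerivAt (fun u : ℝ => (1 - u) * (u + θ) * (u ^ 2 + η))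
      (((-1) * (u + θ) + (1 - u) * 1) * (u ^ 2 + η) + (1 - u) * (u + θ) * (2 * u)) u := by
    have a1 : HasDerivAt (fun u : ℝ => 1 - u) (-1) u := by simpa using (hasDerivAt_id u).const_sub 1
    have a2 : HasDerivAt (fun u : ℝ => u + θ) 1 u := (hasDerivAt_id u).add_const θ
    have a3 : HasDerivAt (fun u : ℝ => u ^ 2 + η) (2 * u) u := by
      simpa using (hasDerivAt_pow 2 u).add_const η
    exact (a1.mul a2).mul a3
  have h2 := h1.div (hasDerivAt_id u) hu.ne'
  refine h2.congr_deriv ?_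
  simp only [id, roF]
  field_simp
  ring

lemma roF_cont (θ η : ℝ) : Continuous (roF θ η) := by unfold roF; fun_prop

lemma roH_derivCont (θ η l r : ℝ) (hl : 0 < l) : ContinuousOn (fun u => -roF θ η u / u ^ 2) (Icc l r) := by
  apply ContinuousOn.div
  · exact (roF_cont θ η).neg.continuousOn
  · fun_prop
  · intro x hx
    have : 0 < x := hl.trans_le hx.1
    positivity

lemma roH_cont (θ η : ℝ) {D : Set ℝ} (hD : ∀ x ∈ D, 0 < x) : ContinuousOn (roH θ η) D :=
  fun x hx => (roH_deriv θ η (hD x hx)).continuousAt.continuousWithinAt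

lemma roH_ROH {θ η um s uM : ℝ} (hθ : 0 < θ) (hη : 0 < η) (m0 : 0 < um) (ms : um < s) (sM : s < uM) (M1 : uM < 1)
    (p1 : ∀ u ∈ Ioo (0:ℝ) um, 0 < roF θ η u) (n1 : ∀ u ∈ Ioo um uM, roF θ η u < 0)
    (p2 : ∀ u ∈ Ioc uM (1:ℝ), 0 < roF θ η u) : ROH (roH θ η) um s uM := by
  have hanti : ∀ D : Set ℝ, Convex ℝ D → (∀ x ∈ D, 0 < x) → (∀ x ∈ interior D, 0 < roF θ η x) →
      StrictAntiOn (roH θ η) D := by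
    intro D hD h0 hF
    refine strictAntiOn_of_deriv_neg hD (roH_cont θ η h0) fun x hx => ?_
    have x0 := h0 x (interior_subset hx)
    rw [(roH_deriv θ η x0).deriv]
    exact div_neg_of_neg_of_pos (by linarith [hF x hx]) (by positivity)
  refine ⟨m0, ms, sM, M1, ?_, ?_, ?_, ?_, ?_, ?_, ?_, ?_⟩
  · refine hanti _ (convex_Ioc 0 um) (fun x hx => hx.1) fun x hx => p1 x ?_
    rwa [interior_Ioc] at hx
  · refine strictMonoOn_of_deriv_pos (convex_Icc um uM) (roH_cont θ η fun x hx => m0.trans_le hx.1) fun x hx => ?_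
    rw [interior_Icc] at hx
    have x0 : 0 < x := m0.trans hx.1
    rw [(roH_deriv θ η x0).deriv]
    exact div_pos (by linarith [n1 x hx]) (by positivity)
  · refine hanti _ (convex_Icc uM 1) (fun x hx => by linarith [hx.1]) fun x hx => p2 x ?_
    rw [interior_Icc] at hx
    exact ⟨hx.1, hx.2.le⟩
  · simp [roH]
  · intro x hx
    have := hx.1
    have h2 : 0 < 1 - x := by linarith [hx.2]
    unfold roH
    positivity
  · set a := (um + s) / 2 with ha
    set b := (s + uM) / 2 with hb
    have hab : a ≤ b := by rw [ha, hb]; linarith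
    have ha0 : 0 < a := by rw [ha]; linarith
    obtain ⟨z, hz, hmin⟩ := isCompact_Icc.exists_isMinOn (nonempty_Icc.2 hab) (roH_derivCont θ η a b ha0)
    have z0 : 0 < z := ha0.trans_le hz.1
    have hzF := n1 z ⟨by linarith [hz.1], by linarith [hz.2]⟩
    have hmpos : 0 < -roF θ η z / z ^ 2 := div_pos (by linarith) (by positivity)
    refine ⟨(-roF θ η z / z ^ 2) / 2, by positivity, fun x y hx hxy hy => ?_⟩
    rcases hxy.eq_or_lt with e | e
    · rw [e]; simp
    · obtain ⟨w, hw, hw2⟩ := exists_hasDerivAt_eq_slope (roH θ η) (fun u => -roF θ η u / u ^ 2) e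
        (roH_cont θ η fun t ht => by linarith [ht.1]) (fun t ht => roH_deriv θ η (by linarith [ht.1]))
      have := hmin (show w ∈ Icc a b from ⟨by linarith [hw.1], by linarith [hw.2]⟩)
      simp only [mem_ofPred_eq] at this
      rw [hw2, le_div_iff₀ (by linarith)] at this
      linarith
  · intro l hl hl1
    obtain ⟨C, hC⟩ := isCompact_Icc.exists_bound_of_continuousOn (roH_derivCont θ η l 1 hl)
    refine ⟨C.toNNReal, ?_⟩
    refine (convex_Icc l 1).lipschitzOnWith_of_nnnorm_hasDerivWithin_le
      (f' := fun u => -roF θ η u / u ^ 2) (fun x hx => (roH_deriv θ η (hl.trans_le hx.1)).hasDerivWithinAt) fun x hx => ?_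
    have h := hC x hx
    rw [← NNReal.coe_le_coe, coe_nnnorm]
    exact h.trans (Real.le_coe_toNNReal C)
  · intro M
    set K := |M| + 1 with hK
    have K0 : 0 < K := by positivity
    refine ⟨min (1/2) (θ * η / (2 * K)), by positivity, by
      exact lt_of_le_of_lt (min_le_left _ _) (by norm_num), fun u hu => ?_⟩
    have u0 := hu.1
    have u1 : u ≤ 1 / 2 := hu.2.trans (min_le_left _ _)
    have u2 : u ≤ θ * η / (2 * K) := hu.2.trans (min_le_right _ _)
    rw [le_div_iff₀ (by positivity)] at u2
    unfold roH
    rw [lt_div_iff₀ u0]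
    have hMK : M < K := by rw [hK]; linarith [le_abs_self M]
    have e1 : M * u < K * u := mul_lt_mul_of_pos_right hMK u0
    have e2 : θ * η ≤ (u + θ) * (u ^ 2 + η) := by
      apply mul_le_mul (by linarith) (by nlinarith) hη.le (by linarith)
    have e3 : (1/2) * (θ * η) ≤ (1 - u) * ((u + θ) * (u ^ 2 + η)) :=
      mul_le_mul (by linarith) e2 (by positivity) (by linarith)
    rw [mul_assoc]
    linarith

lemma ro_per_max {x : ℝ → ℝ} (hx : Continuous x) {T : ℝ} (hT : 0 < T) (hp : ∀ t, x (t + T) = x t) :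
    ∃ t0, ∀ t, x t ≤ x t0 := by
  obtain ⟨t0, -, h⟩ := isCompact_Icc.exists_isMaxOn (nonempty_Icc.2 hT.le) hx.continuousOn
  refine ⟨t0, fun t => ?_⟩
  obtain ⟨y, hy, e⟩ := (show Function.Periodic x T from hp).exists_mem_Ico₀ hT t
  rw [e]; exact h ⟨hy.1, hy.2.le⟩

lemma ro_per_min {x : ℝ → ℝ} (hx : Continuous x) {T : ℝ} (hT : 0 < T) (hp : ∀ t, x (t + T) = x t) :
    ∃ t0, ∀ t, x t0 ≤ x t := by
  obtain ⟨t0, h⟩ := ro_per_max hx.neg hT (fun t => by simp [hp])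
  exact ⟨t0, fun t => neg_le_neg_iff.1 (h t)⟩

lemma ro_f_eq (θ η : ℝ) {u : ℝ} (hu : 0 < u) (v : ℝ) : fPoly θ η u v = u ^ 2 * (roH θ η u - v) := by
  unfold fPoly roH
  field_simp

lemma ro_g_eq {δ η : ℝ} {s : ℝ} (hδ : δ < 1) (hs : s ^ 2 = δ * η / (1 - δ)) (u v : ℝ) :
    gPoly δ η u v = v * ((1 - δ) * (u ^ 2 - s ^ 2)) := by
  have : (1 - δ) ≠ 0 := by linarith
  rw [hs]; unfold gPoly
  field_simp
  ring

lemma ro_orbit_lt_one {δ θ η ε : ℝ} {u v : ℝ → ℝ} (h : IsPeriodicOrbitInQuadrant δ θ η ε u v)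
    (hθ : 0 < θ) (hη : 0 < η) : ∀ t, u t < 1 := by
  obtain ⟨sol, pos, ⟨T, hT, per⟩, -⟩ := h
  have cu : Continuous u := continuous_iff_continuousAt.2 fun t => (sol t).1.continuousAt
  obtain ⟨t0, h0⟩ := ro_per_max cu hT fun t => (per t).1
  intro t
  refine (h0 t).trans_lt ?_
  have hd := IsLocalMax.hasDerivAt_eq_zero (Filter.Eventually.of_forall h0 : IsLocalMax u t0) (sol t0).1
  by_contra hc
  push Not at hc
  have p1 := (pos t0).1
  have p2 := (pos t0).2
  unfold fPoly at hd
  have q1 : 0 < u t0 ^ 2 * v t0 := by positivity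
  have q2 : 0 ≤ (u t0 - 1) * (u t0 * (u t0 + θ) * (u t0 ^ 2 + η)) :=
    mul_nonneg (by linarith) (by positivity)
  nlinarith

/-- A true periodic orbit gives a periodic solution of the truncated system, for all suitable truncations. -/
lemma ro_orbit_trunc {δ θ η ε s : ℝ} {u v : ℝ → ℝ} (h : IsPeriodicOrbitInQuadrant δ θ η ε u v)
    (hθ : 0 < θ) (hη : 0 < η) (hδ : δ < 1) (hs : s ^ 2 = δ * η / (1 - δ)) :
    ∃ l1 > 0, ∃ M1, ∀ l, 0 < l → l ≤ l1 → ∀ M, M1 ≤ M →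
      ROSol (fun x => roCl l x ^ 2) (fun x => roH θ η (roCl l x))
        (fun x => ε * ((1 - δ) * (roCl l x ^ 2 - s ^ 2))) (roP M) u (fun t => Real.log (v t)) := by
  have hlt := ro_orbit_lt_one h hθ hη
  obtain ⟨sol, pos, ⟨T, hT, per⟩, -⟩ := h
  have cu : Continuous u := continuous_iff_continuousAt.2 fun t => (sol t).1.continuousAt
  have cv : Continuous v := continuous_iff_continuousAt.2 fun t => (sol t).2.continuousAt
  obtain ⟨t0, h0⟩ := ro_per_min cu hT fun t => (per t).1
  obtain ⟨t1, h1⟩ := ro_per_max cv hT fun t => (per t).2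
  refine ⟨u t0, (pos t0).1, Real.log (v t1), fun l hl hl0 M hM t => ?_⟩
  have e1 : roCl l (u t) = u t := roCl_eq (hl0.trans (h0 t)) (hlt t).le
  have vt := (pos t).2
  have e2 : roP M (Real.log (v t)) = v t := by
    rw [roP_eq ((Real.log_le_log vt (h1 t)).trans hM), Real.exp_log vt]
  simp only [e1, e2]
  constructor
  · rw [← ro_f_eq θ η (pos t).1]; exact (sol t).1
  · have := (sol t).2.log vt.ne'
    refine this.congr_deriv ?_
    rw [ro_g_eq hδ hs]
    field_simp

lemma ro_main
    (δ θ η : ℝ) (hδ : 0 < δ) (hθ : θ ∈ Set.Ioo (0:ℝ) 1) (hη : η ∈ Set.Ioo (0:ℝ) 1)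
    (um uM : ℝ) (h0m : 0 < um) (hM1 : uM < 1)
    (hpos1 : ∀ u ∈ Set.Ioo (0:ℝ) um, 0 < quarticF θ η u)
    (hneg : ∀ u ∈ Set.Ioo um uM, quarticF θ η u < 0)
    (hpos2 : ∀ u ∈ Set.Ioc uM (1:ℝ), 0 < quarticF θ η u)
    (hδη : δ < 1 / (1 + η))
    (hstar : um < Real.sqrt (δ * η / (1 - δ)) ∧ Real.sqrt (δ * η / (1 - δ)) < uM) :
    ∃ ε₀ > (0:ℝ), ∀ ε : ℝ, 0 < ε → ε < ε₀ →
      (∃ u v : ℝ → ℝ, IsPeriodicOrbitInQuadrant δ θ η ε u v) ∧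
      (∀ u₁ v₁ u₂ v₂ : ℝ → ℝ,
        IsPeriodicOrbitInQuadrant δ θ η ε u₁ v₁ →
        IsPeriodicOrbitInQuadrant δ θ η ε u₂ v₂ →
        Set.range (fun t => (u₁ t, v₁ t)) = Set.range (fun t => (u₂ t, v₂ t))) := by
  have hθ0 := hθ.1
  have hη0 := hη.1
  have hδ1 : δ < 1 := by
    refine hδη.trans ?_
    rw [div_lt_one (by linarith)]; linarith
  set s := Real.sqrt (δ * η / (1 - δ)) with hs
  have hs2 : s ^ 2 = δ * η / (1 - δ) := Real.sq_sqrt (div_nonneg (by positivity) (by linarith))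
  have hH : ROH (roH θ η) um s uM := roH_ROH hθ0 hη0 h0m hstar.1 hstar.2 hM1 hpos1 hneg hpos2
  have hc : 0 < 1 - δ := by linarith
  have hc1 : 1 - δ ≤ 1 := by linarith
  obtain ⟨ε₀, hε₀, l0, hl0, hls, M0, WR, xb, xa, hWM, hsM, key⟩ := ro_concrete hH hc hc1
  -- choice of `l` given `M`
  have pick : ∀ M l1 : ℝ, 0 < l1 → ∃ l, 0 < l ∧ l ≤ l1 ∧ 2 * Real.exp M < roH θ η l := by
    intro M l1 hl1
    obtain ⟨l, hl, -, hb⟩ := hH.blow (2 * Real.exp M)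
    exact ⟨min l l1, lt_min hl hl1, min_le_right _ _, hb _ ⟨lt_min hl hl1, min_le_left _ _⟩⟩
  refine ⟨ε₀, hε₀, fun ε hε hεlt => ?_⟩
  obtain ⟨hε1, key⟩ := key ε hε hεlt
  constructor
  · obtain ⟨l, hl, hll, hlM⟩ := pick M0 l0 hl0
    obtain ⟨WL, Q⟩ := key l hl hll M0 le_rfl hlM
    obtain ⟨-, glob, -⟩ := ro_trunc hH (l := l) (M := M0) hl (by linarith) hsM hε hε1 hc hc1
    obtain ⟨x, w, T, hT, sol, per, ⟨ta, tb, hab⟩, hwle⟩ := ro_exists Q glob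
    have hl1 : l < 1 := by linarith [hstar.2]
    have cx : Continuous x := continuous_iff_continuousAt.2 fun t => (sol t).1.continuousAt
    have eqn : ∀ t, roCl l (x t) ^ 2 * (roH θ η (roCl l (x t)) - roP M0 (w t)) = 0 →
        roH θ η (roCl l (x t)) = roP M0 (w t) := by
      intro t ht
      have : 0 < roCl l (x t) := hl.trans_le (roCl_ge l _)
      rcases mul_eq_zero.1 ht with e | e
      · exact absurd e (by positivity)
      · linarith
    have xlt : ∀ t, x t < 1 := by
      obtain ⟨t0, h0⟩ := ro_per_max cx hT fun t => (per t).1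
      intro t
      refine (h0 t).trans_lt ?_
      have hd := eqn t0 (IsLocalMax.hasDerivAt_eq_zero (Filter.Eventually.of_forall h0 : IsLocalMax x t0) (sol t0).1)
      by_contra hcon
      push Not at hcon
      have : roCl l (x t0) = 1 := by
        refine le_antisymm (roCl_le hl1.le _) ?_
        have := roCl_mono l hcon
        rwa [roCl_eq hl1.le le_rfl] at this
      rw [this, hH.H1] at hd
      linarith [roP_pos M0 (w t0)]
    have xgt : ∀ t, l < x t := by
      obtain ⟨t0, h0⟩ := ro_per_min cx hT fun t => (per t).1
      intro t
      refine lt_of_lt_of_le ?_ (h0 t)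
      have hd := eqn t0 (IsLocalMin.hasDerivAt_eq_zero (Filter.Eventually.of_forall h0 : IsLocalMin x t0) (sol t0).1)
      by_contra hcon
      push Not at hcon
      have : roCl l (x t0) = l := by
        refine le_antisymm ?_ (roCl_ge l _)
        have := roCl_mono l hcon
        rwa [roCl_eq le_rfl hl1.le] at this
      rw [this] at hd
      linarith [roP_lt M0 (w t0)]
    have ecl : ∀ t, roCl l (x t) = x t := fun t => roCl_eq (xgt t).le (xlt t).le
    have x0 : ∀ t, 0 < x t := fun t => hl.trans (xgt t)
    have eP : ∀ t, roP M0 (w t) = Real.exp (w t) := fun t => roP_eq ((hwle t).trans hWM)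
    refine ⟨x, fun t => Real.exp (w t), fun t => ?_, fun t => ⟨x0 t, Real.exp_pos _⟩,
      ⟨T, hT, fun t => ⟨(per t).1, congrArg Real.exp (per t).2⟩⟩, ta, tb, fun he => hab ?_⟩
    · have h1 := (sol t).1
      have h2 := (sol t).2.exp
      simp only [ecl, eP] at h1 h2
      constructor
      · rw [ro_f_eq θ η (x0 t)]; exact h1
      · refine h2.congr_deriv ?_
        rw [ro_g_eq hδ1 hs2]; ring
    · exact Real.exp_injective (Prod.mk.inj he).2
  · intro u₁ v₁ u₂ v₂ o1 o2
    obtain ⟨l1, hl1, M1, k1⟩ := ro_orbit_trunc o1 hθ0 hη0 hδ1 hs2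
    obtain ⟨l2, hl2, M2, k2⟩ := ro_orbit_trunc o2 hθ0 hη0 hδ1 hs2
    obtain ⟨l, hl, hll, hlM⟩ := pick (max M0 (max M1 M2)) (min l0 (min l1 l2)) (by positivity)
    set M := max M0 (max M1 M2) with hMdef
    have hll0 : l ≤ l0 := hll.trans (min_le_left _ _)
    have hll1 : l ≤ l1 := hll.trans ((min_le_right _ _).trans (min_le_left _ _))
    have hll2 : l ≤ l2 := hll.trans ((min_le_right _ _).trans (min_le_right _ _))
    have hm1 : M1 ≤ M := (le_max_left _ _).trans (le_max_right _ _)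
    have hm2 : M2 ≤ M := (le_max_right _ _).trans (le_max_right _ _)
    obtain ⟨WL, Q⟩ := key l hl hll0 M (le_max_left _ _) hlM
    obtain ⟨-, pos1, ⟨T1, hT1, per1⟩, ⟨a1, b1, n1⟩⟩ := o1
    obtain ⟨-, pos2, ⟨T2, hT2, per2⟩, ⟨a2, b2, n2⟩⟩ := o2
    have linj : ∀ a b : ℝ, 0 < a → 0 < b → Real.log a = Real.log b → a = b := fun a b ha hb e =>
      Real.log_injOn_pos ha hb e
    obtain ⟨t1, t2, he⟩ := ro_unique Q (k1 l hl hll1 M hm1) (k2 l hl hll2 M hm2) hT1 hT2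
      (fun t => ⟨(per1 t).1, by simp only [(per1 t).2]⟩)
      ⟨a1, b1, fun e => n1 (Prod.ext e.1 (linj _ _ (pos1 _).2 (pos1 _).2 e.2))⟩
      (fun t => ⟨(per2 t).1, by simp only [(per2 t).2]⟩)
      ⟨a2, b2, fun e => n2 (Prod.ext e.1 (linj _ _ (pos2 _).2 (pos2 _).2 e.2))⟩
    have he2 : ∀ r, (u₁ (t1 + r), v₁ (t1 + r)) = (u₂ (t2 + r), v₂ (t2 + r)) := fun r =>
      Prod.ext (he r).1 (linj _ _ (pos1 _).2 (pos2 _).2 (he r).2)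
    apply Set.Subset.antisymm
    · rintro _ ⟨t, rfl⟩
      refine ⟨t2 + (t - t1), ?_⟩
      have := he2 (t - t1)
      rw [add_sub_cancel] at this
      exact this.symm
    · rintro _ ⟨t, rfl⟩
      refine ⟨t1 + (t - t2), ?_⟩
      have := he2 (t - t2)
      rw [add_sub_cancel] at this
      exact this

end ROProof

/-- if `F` has exactly two zeros `u_m < u_M` in `(0,1)` with the
S-shaped sign pattern, `0 < δ < 1/(1+η)`, and the interior equilibrium coordinate
`u* = √(δη/(1−δ))` satisfies `u_m < u* < u_M`, then for all sufficiently small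
`ε > 0` the system has a nonconstant periodic solution in the open first quadrant
(a relaxation oscillation), unique up to its orbit. -/
theorem relaxation_oscillation_exists_unique
    (δ θ η : ℝ) (hδ : 0 < δ) (hθ : θ ∈ Set.Ioo (0:ℝ) 1) (hη : η ∈ Set.Ioo (0:ℝ) 1)
    (um uM : ℝ) (h0m : 0 < um) (hmM : um < uM) (hM1 : uM < 1)
    (hFm : quarticF θ η um = 0) (hFM : quarticF θ η uM = 0)
    (honly : ∀ u ∈ Set.Ioo (0:ℝ) 1, quarticF θ η u = 0 → u = um ∨ u = uM)
    (hpos1 : ∀ u ∈ Set.Ioo (0:ℝ) um, 0 < quarticF θ η u)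
    (hneg : ∀ u ∈ Set.Ioo um uM, quarticF θ η u < 0)
    (hpos2 : ∀ u ∈ Set.Ioc uM (1:ℝ), 0 < quarticF θ η u)
    (hδη : δ < 1 / (1 + η))
    (hstar : um < Real.sqrt (δ * η / (1 - δ)) ∧ Real.sqrt (δ * η / (1 - δ)) < uM) :
    ∃ ε₀ > (0:ℝ), ∀ ε : ℝ, 0 < ε → ε < ε₀ →
      (∃ u v : ℝ → ℝ, IsPeriodicOrbitInQuadrant δ θ η ε u v) ∧
      (∀ u₁ v₁ u₂ v₂ : ℝ → ℝ,
        IsPeriodicOrbitInQuadrant δ θ η ε u₁ v₁ →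
        IsPeriodicOrbitInQuadrant δ θ η ε u₂ v₂ →
        Set.range (fun t => (u₁ t, v₁ t)) = Set.range (fun t => (u₂ t, v₂ t))) := by
  exact ro_main δ θ η hδ hθ hη um uM h0m hM1 hpos1 hneg hpos2 hδη hstar
end

section
/- Suppose F has exactly two zeros u_m < u_M in (0,1), with F > 0 on (0,u_m), F < 0 on (u_m, u_M), and F > 0 on (u_M, 1], and suppose 0 < δ < 1/(1+η) with u* > u_M, where u* = √(δη/(1−δ)) and v* = (1−u*)(u*+θ)(u*²+η)/u*. Then there exists ε₀ > 0 such that for every ε ∈ (0, ε₀), the interior equilibrium (u*, v*) is globally asymptotically stable on the open first quadrant: every solution defined on [0,∞) with u(0) > 0 and v(0) > 0 satisfies (u(t), v(t)) → (u*, v*) as t → ∞. -/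
open Filter Topology Set

lemma gron {a x x' : ℝ → ℝ} (ha : Continuous a) {T S : ℝ} (hTS : T ≤ S)
    (hx : ∀ t ∈ Icc T S, HasDerivAt x (x' t) t)
    (hle : ∀ t ∈ Icc T S, x' t ≤ a t * x t) :
    x S ≤ x T * Real.exp (∫ r in T..S, a r) := by
  have hI : ∀ t, HasDerivAt (fun t => ∫ r in T..t, a r) (a t) t := fun t =>
    (ha.integral_hasStrictDerivAt T t).hasDerivAt
  have hE : ∀ t, HasDerivAt (fun t => Real.exp (-∫ r in T..t, a r))
      (Real.exp (-∫ r in T..t, a r) * (-(a t))) t := fun t => (hI t).neg.exp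
  have hy : ∀ t ∈ Icc T S, HasDerivAt (fun t => x t * Real.exp (-∫ r in T..t, a r))
      (x' t * Real.exp (-∫ r in T..t, a r) +
        x t * (Real.exp (-∫ r in T..t, a r) * (-(a t)))) t :=
    fun t ht => (hx t ht).mul (hE t)
  have hanti : AntitoneOn (fun t => x t * Real.exp (-∫ r in T..t, a r)) (Icc T S) := by
    apply antitoneOn_of_deriv_nonpos (convex_Icc T S)
    · exact fun t ht => (hy t ht).continuousAt.continuousWithinAt
    · intro t ht
      exact (hy t (interior_subset ht)).differentiableAt.differentiableWithinAt
    · intro t ht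
      have ht' := interior_subset ht
      rw [(hy t ht').deriv]
      have := hle t ht'
      have he := Real.exp_pos (-∫ r in T..t, a r)
      nlinarith
  have h := hanti (left_mem_Icc.2 hTS) (right_mem_Icc.2 hTS) hTS
  simp only [intervalIntegral.integral_same, neg_zero, Real.exp_zero, mul_one] at h
  rw [Real.exp_neg] at h
  have he := Real.exp_pos (∫ r in T..S, a r)
  calc x S = x S * (Real.exp (∫ r in T..S, a r))⁻¹ * Real.exp (∫ r in T..S, a r) := by
        field_simp
    _ ≤ _ := by gcongr

lemma first_exit {p : ℝ → ℝ} {a b : ℝ} (hab : a ≤ b) (hp : ContinuousOn p (Icc a b))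
    (ha : 0 < p a) (hb : p b ≤ 0) :
    ∃ s ∈ Ioc a b, p s ≤ 0 ∧ ∀ t ∈ Ico a s, 0 < p t := by
  have hc : IsCompact (Icc a b ∩ p ⁻¹' Iic 0) :=
    isCompact_Icc.of_isClosed_subset (hp.preimage_isClosed_of_isClosed isClosed_Icc isClosed_Iic)
      inter_subset_left
  obtain ⟨s, ⟨hs1, hs2⟩, hs3⟩ := hc.exists_isLeast ⟨b, ⟨hab, le_rfl⟩, hb⟩
  refine ⟨s, ⟨lt_of_le_of_ne hs1.1 ?_, hs1.2⟩, hs2, ?_⟩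
  · rintro rfl
    exact absurd hs2 (not_le.2 ha)
  · intro t ht
    by_contra hcon
    have := hs3 ⟨⟨ht.1, ht.2.le.trans hs1.2⟩, not_lt.1 hcon⟩
    exact absurd this (not_le.2 ht.2)

lemma deriv_pos_right {x : ℝ → ℝ} {d s : ℝ} (h : HasDerivAt x d s) (hd : 0 < d) :
    ∀ᶠ t in 𝓝[>] s, x s < x t := by
  have h1 := (hasDerivAt_iff_tendsto_slope.1 h).eventually (lt_mem_nhds hd)
  have h2 : ∀ᶠ t in 𝓝[>] s, 0 < slope x s t :=
    h1.filter_mono (nhdsWithin_mono _ (fun t ht => ne_of_gt ht))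
  filter_upwards [h2, self_mem_nhdsWithin] with t ht hts
  rw [slope_def_field] at ht
  have : 0 < t - s := sub_pos.2 hts
  have := (div_pos_iff_of_pos_right this).1 ht
  linarith

lemma deriv_pos_left {x : ℝ → ℝ} {d s : ℝ} (h : HasDerivAt x d s) (hd : 0 < d) :
    ∀ᶠ t in 𝓝[<] s, x t < x s := by
  have h1 := (hasDerivAt_iff_tendsto_slope.1 h).eventually (lt_mem_nhds hd)
  have h2 : ∀ᶠ t in 𝓝[<] s, 0 < slope x s t :=
    h1.filter_mono (nhdsWithin_mono _ (fun t ht => ne_of_lt ht))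
  filter_upwards [h2, self_mem_nhdsWithin] with t ht hts
  rw [slope_def_field] at ht
  have : t - s < 0 := sub_neg.2 hts
  by_contra hcon
  exact absurd ht (not_lt.2 (div_nonpos_of_nonneg_of_nonpos (by linarith) this.le))

/-- Barbalat's lemma. -/
lemma barbalat {x g g' : ℝ → ℝ} {T M L : ℝ}
    (hx : ∀ t, T ≤ t → HasDerivAt x (g t) t) (hg : ∀ t, T ≤ t → HasDerivAt g (g' t) t)
    (hM : ∀ t, T ≤ t → |g' t| ≤ M) (hL : Tendsto x atTop (𝓝 L)) :
    Tendsto g atTop (𝓝 0) := by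
  have hM0 : 0 ≤ M := (abs_nonneg _).trans (hM T le_rfl)
  rw [Metric.tendsto_atTop]
  intro e he
  set r := e / (4 * (M + 1)) with hr
  have hr0 : 0 < r := by positivity
  have hMr : M * r ≤ e / 4 := by
    rw [hr, mul_div_assoc', div_le_div_iff₀ (by positivity) (by norm_num)]
    nlinarith
  rw [Metric.tendsto_atTop] at hL
  obtain ⟨N, hN⟩ := hL (r * e / 4) (by positivity)
  refine ⟨max N T, fun t ht => ?_⟩
  have htT : T ≤ t := (le_max_right _ _).trans ht
  have htN : N ≤ t := (le_max_left _ _).trans ht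
  have h1 := hN t htN
  have h2 := hN (t + r) (by linarith)
  obtain ⟨c, hc, hc'⟩ := exists_hasDerivAt_eq_slope x g (by linarith : t < t + r)
    (fun y hy => (hx y (htT.trans hy.1)).continuousAt.continuousWithinAt)
    (fun y hy => hx y (htT.trans hy.1.le))
  have hgl : |g c - g t| ≤ M * |c - t| := by
    have := (convex_Ici T).norm_image_sub_le_of_norm_hasDerivWithin_le (f := g) (f' := g') (C := M)
      (fun y hy => (hg y hy).hasDerivWithinAt) (fun y hy => hM y hy)
      (show t ∈ Ici T from htT) (show c ∈ Ici T from htT.trans hc.1.le)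
    simpa [Real.norm_eq_abs] using this
  rw [abs_of_pos (by linarith [hc.1] : 0 < c - t)] at hgl
  have hgl2 : |g c - g t| ≤ e / 4 := hgl.trans ((mul_le_mul_of_nonneg_left
    (by linarith [hc.2]) hM0).trans hMr)
  rw [Real.dist_eq] at h1 h2 ⊢
  have hgc : g c * r = x (t + r) - x t := by
    rw [hc', show t + r - t = r by ring]; field_simp
  have h1' := abs_lt.1 h1
  have h2' := abs_lt.1 h2
  have h3 : |g c| < e / 2 := by
    rw [abs_lt]
    constructor
    · by_contra hh
      nlinarith
    · by_contra hh
      nlinarith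
  have h3' := abs_lt.1 h3
  have hgl3 := abs_le.1 hgl2
  rw [sub_zero, abs_lt]
  constructor <;> linarith

lemma conv_core {θ η s vs k A B T L : ℝ} {u v : ℝ → ℝ} (hT : 0 ≤ T) (hk : 0 < k) (hs : 0 < s)
    (hvs : s * vs = (1 - s) * (s + θ) * (s ^ 2 + η))
    (hu : ∀ t, 0 ≤ t → HasDerivAt u (fPoly θ η (u t) (v t)) t)
    (hv : ∀ t, 0 ≤ t → HasDerivAt v (k * v t * (u t ^ 2 - s ^ 2)) t)
    (hu0 : ∀ t, 0 ≤ t → 0 < u t) (hv0 : ∀ t, 0 ≤ t → 0 < v t)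
    (huA : ∀ t, T ≤ t → u t ≤ A) (hvB : ∀ t, T ≤ t → v t ≤ B)
    (hL0 : 0 < L) (hL : Tendsto v atTop (𝓝 L)) :
    Tendsto (fun t => (u t, v t)) atTop (𝓝 (s, vs)) := by
  have key : ∀ G : ℝ × ℝ → ℝ, Continuous G → ∃ M, ∀ t, T ≤ t → |G (u t, v t)| ≤ M := by
    intro G hG
    obtain ⟨M, hM⟩ := ((isCompact_Icc (a := (0:ℝ)) (b := A)).prod
      (isCompact_Icc (a := (0:ℝ)) (b := B))).exists_bound_of_continuousOn hG.continuousOn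
    exact ⟨M, fun t ht => hM _ ⟨⟨(hu0 t (hT.trans ht)).le, huA t ht⟩,
      ⟨(hv0 t (hT.trans ht)).le, hvB t ht⟩⟩⟩
  have hv' : Tendsto (fun t => k * v t * (u t ^ 2 - s ^ 2)) atTop (𝓝 0) := by
    obtain ⟨M, hM⟩ := key (fun p => k * (k * p.2 * (p.1 ^ 2 - s ^ 2)) * (p.1 ^ 2 - s ^ 2)
      + k * p.2 * (2 * p.1 * fPoly θ η p.1 p.2)) (by unfold fPoly; fun_prop)
    refine barbalat (T := T) (fun t ht => hv t (hT.trans ht)) (fun t ht => ?_) hM hL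
    have h1 := hu t (hT.trans ht)
    have h2 := hv t (hT.trans ht)
    have := (h2.const_mul k).mul ((h1.pow 2).sub_const (s ^ 2))
    refine this.congr_deriv ?_
    simp
  have huT : Tendsto u atTop (𝓝 s) := by
    have h2 : Tendsto (fun t => |k * v t * (u t ^ 2 - s ^ 2)| * (2 / (k * L * s))) atTop (𝓝 0) := by
      have := hv'.abs.mul_const (2 / (k * L * s))
      simpa using this
    rw [tendsto_iff_norm_sub_tendsto_zero]
    refine squeeze_zero' (Eventually.of_forall fun t => norm_nonneg _) ?_ h2
    filter_upwards [hL.eventually (lt_mem_nhds (by linarith : L / 2 < L)),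
      eventually_ge_atTop 0] with t ht ht0
    rw [Real.norm_eq_abs, mul_div_assoc', le_div_iff₀ (by positivity)]
    have hup := hu0 t ht0
    have : |k * v t * (u t ^ 2 - s ^ 2)| = k * v t * (u t + s) * |u t - s| := by
      rw [show k * v t * (u t ^ 2 - s ^ 2) = (k * v t * (u t + s)) * (u t - s) by ring, abs_mul,
        abs_of_pos (a := k * v t * (u t + s))]
      have := hv0 t ht0
      positivity
    rw [this]
    have h3 : L * s ≤ (2 * v t) * (u t + s) := by
      apply mul_le_mul <;> linarith [hv0 t ht0]
    have h4 : 0 ≤ k * |u t - s| := by positivity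
    nlinarith
  have hu' : Tendsto (fun t => fPoly θ η (u t) (v t)) atTop (𝓝 0) := by
    obtain ⟨M, hM⟩ := key (fun p =>
      ((1 - p.1) * (p.1 + θ) * (p.1 ^ 2 + η) - p.1 * (p.1 + θ) * (p.1 ^ 2 + η)
        + p.1 * (1 - p.1) * (p.1 ^ 2 + η) + p.1 * (1 - p.1) * (p.1 + θ) * (2 * p.1)
        - 2 * p.1 * p.2) * fPoly θ η p.1 p.2
      - p.1 ^ 2 * (k * p.2 * (p.1 ^ 2 - s ^ 2))) (by unfold fPoly; fun_prop)
    refine barbalat (T := T) (fun t ht => hu t (hT.trans ht)) (fun t ht => ?_) hM huT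
    have h1 := hu t (hT.trans ht)
    have h2 := hv t (hT.trans ht)
    have := (((h1.mul (h1.const_sub 1)).mul (h1.add_const θ)).mul ((h1.pow 2).add_const η)).sub
      ((h1.pow 2).mul h2)
    refine this.congr_deriv ?_
    simp
    ring
  have hlim : Tendsto (fun t => fPoly θ η (u t) (v t)) atTop (𝓝 (fPoly θ η s L)) := by
    have hc : Continuous (fun p : ℝ × ℝ => fPoly θ η p.1 p.2) := by unfold fPoly; fun_prop
    exact (hc.tendsto (s, L)).comp (huT.prodMk_nhds hL)
  have h0 := tendsto_nhds_unique hlim hu'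
  have hLv : L = vs := by
    unfold fPoly at h0
    have : s ^ 2 * (vs - L) = 0 := by linear_combination h0 + s * hvs
    have h5 := (mul_eq_zero.1 this).resolve_left (by positivity)
    linarith
  rw [← hLv]
  exact huT.prodMk_nhds hL

lemma pos_lemma {a x : ℝ → ℝ} {T : ℝ} (hT : 0 ≤ T)
    (ha : Continuous fun t => a (max t 0))
    (hx : ∀ t, 0 ≤ t → HasDerivAt x (a t * x t) t) (hxT : 0 < x 0) : 0 < x T := by
  have := gron (x := fun t => - x t) (x' := fun t => - (a t * x t)) ha hT
    (fun t ht => (hx t ht.1).neg) (fun t ht => by rw [max_eq_left ht.1]; linarith)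
  have h2 := Real.exp_pos (∫ r in (0:ℝ)..T, a (max r 0))
  nlinarith

lemma cont_max {x x' : ℝ → ℝ} (hx : ∀ t, 0 ≤ t → HasDerivAt x (x' t) t) :
    ∃ X : ℝ → ℝ, Continuous X ∧ ∀ t, X t = x (max t 0) := by
  refine ⟨fun t => x (max t 0), ?_, fun _ => rfl⟩
  rw [continuous_iff_continuousAt]
  intro t
  have h := (hx (max t 0) (le_max_right _ _)).continuousAt
  exact ContinuousAt.comp (f := fun t : ℝ => max t 0) h (by fun_prop)

lemma caseA {θ η s vs k T : ℝ} {u v : ℝ → ℝ} (hT : 0 ≤ T) (hk : 0 < k) (hs : 0 < s)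
    (hs1 : s < 1) (hθ : 0 < θ) (hη : 0 < η)
    (hvs : s * vs = (1 - s) * (s + θ) * (s ^ 2 + η))
    (hu : ∀ t, 0 ≤ t → HasDerivAt u (fPoly θ η (u t) (v t)) t)
    (hv : ∀ t, 0 ≤ t → HasDerivAt v (k * v t * (u t ^ 2 - s ^ 2)) t)
    (hu0 : ∀ t, 0 ≤ t → 0 < u t) (hv0 : ∀ t, 0 ≤ t → 0 < v t)
    (hus : ∀ t, T ≤ t → u t < s) :
    Tendsto (fun t => (u t, v t)) atTop (𝓝 (s, vs)) := by
  have hanti : AntitoneOn v (Ici T) := by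
    apply antitoneOn_of_deriv_nonpos (convex_Ici T)
    · exact fun t ht => (hv t (hT.trans ht)).continuousAt.continuousWithinAt
    · intro t ht
      exact (hv t (hT.trans (interior_subset ht))).differentiableAt.differentiableWithinAt
    · intro t ht
      have ht' : T ≤ t := interior_subset ht
      rw [(hv t (hT.trans ht')).deriv]
      have h1 := hus t ht'
      have h2 := hu0 t (hT.trans ht')
      have h3 := hv0 t (hT.trans ht')
      apply mul_nonpos_of_nonneg_of_nonpos (by positivity)
      nlinarith
  -- positive lower bound for `v`
  set c := (1 - s) * θ * η with hc
  have hc0 : 0 < c := by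
    have : 0 < 1 - s := by linarith
    positivity
  have hlow : ∀ t, T ≤ t → c / (2 * s) ≤ v t := by
    intro T' hT'
    by_contra! hcon
    have hT'0 := hT.trans hT'
    have hvT : ∀ t, T' ≤ t → v t < c / (2 * s) := fun t ht =>
      (hanti hT' (hT'.trans ht) ht).trans_lt hcon
    set S := T' + 2 * s / (c * u T') with hS
    have huT' := hu0 T' hT'0
    have hTS : T' ≤ S := by
      have : 0 ≤ 2 * s / (c * u T') := by positivity
      linarith
    have hg := gron (a := fun _ => c / 2) (x := fun t => - u t)
      (x' := fun t => -(fPoly θ η (u t) (v t))) continuous_const hTS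
      (fun t ht => (hu t (hT'0.trans ht.1)).neg) (by
        intro t ht
        have h1 := hus t (hT'.trans ht.1)
        have h2 := hu0 t (hT'0.trans ht.1)
        have h3 := hvT t ht.1
        have h4 := hv0 t (hT'0.trans ht.1)
        rw [lt_div_iff₀ (by positivity)] at h3
        have h5 : c ≤ (1 - u t) * (u t + θ) * (u t ^ 2 + η) := by
          rw [hc]
          have : 0 < 1 - u t := by linarith
          gcongr
          · linarith
          · nlinarith
        have h6 : u t * v t ≤ c / 2 := by nlinarith
        have h7 : fPoly θ η (u t) (v t) =
          u t * ((1 - u t) * (u t + θ) * (u t ^ 2 + η) - u t * v t) := by unfold fPoly; ring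
        rw [h7]
        nlinarith)
    simp only [intervalIntegral.integral_const, smul_eq_mul] at hg
    have h1 := hus S (hT'.trans hTS)
    have h2 := Real.add_one_le_exp ((S - T') * (c / 2))
    have h3 : (S - T') * (c / 2) * u T' = s := by
      rw [hS]; field_simp; ring
    nlinarith
  have hb : BddBelow (v '' Ici T) := ⟨c / (2 * s), by rintro _ ⟨t, ht, rfl⟩; exact hlow t ht⟩
  obtain ⟨L, hL⟩ : ∃ L, Tendsto v atTop (𝓝 L) := by
    have hm : Antitone (fun t => v (max t T)) := fun x y hxy =>
      hanti (mem_Ici.2 (le_max_right _ _)) (mem_Ici.2 (le_max_right _ _)) (max_le_max_right _ hxy)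
    have hbb : BddBelow (range fun t => v (max t T)) :=
      ⟨c / (2 * s), by rintro _ ⟨t, rfl⟩; exact hlow _ (le_max_right _ _)⟩
    refine ⟨_, (tendsto_atTop_ciInf hm hbb).congr' ?_⟩
    filter_upwards [eventually_ge_atTop T] with t ht
    rw [max_eq_left ht]
  have hL0 : 0 < L := lt_of_lt_of_le (by positivity : 0 < c / (2 * s))
    (ge_of_tendsto hL ((eventually_ge_atTop T).mono hlow))
  exact conv_core (A := s) (B := v T) hT hk hs hvs hu hv hu0 hv0 (fun t ht => (hus t ht).le)
    (fun t ht => hanti self_mem_Ici ht ht) hL0 hL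

lemma u_upper {θ η : ℝ} {u v : ℝ → ℝ} (hθ : 0 < θ) (hη : 0 < η)
    (hu : ∀ t, 0 ≤ t → HasDerivAt u (fPoly θ η (u t) (v t)) t)
    (hu0 : ∀ t, 0 ≤ t → 0 < u t) (hv0 : ∀ t, 0 ≤ t → 0 < v t)
    {T S : ℝ} (hT : 0 ≤ T) (hTS : T ≤ S) :
    ∃ e : ℝ, 0 < e ∧ e ≤ 1 ∧ u S - 1 ≤ (u T - 1) * e := by
  obtain ⟨U, hcU, hU⟩ := cont_max hu
  refine ⟨Real.exp (∫ r in T..S, -(u (max r 0) * (u (max r 0) + θ) * (u (max r 0) ^ 2 + η))),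
    Real.exp_pos _, ?_, ?_⟩
  · rw [Real.exp_le_one_iff, intervalIntegral.integral_neg, neg_nonpos]
    apply intervalIntegral.integral_nonneg hTS
    intro t _
    have := hu0 (max t 0) (le_max_right _ _)
    positivity
  · refine gron (x := fun t => u t - 1) (x' := fun t => fPoly θ η (u t) (v t))
      (by simp only [← hU]; fun_prop) hTS
      (fun t ht => (hu t (hT.trans ht.1)).sub_const 1) ?_
    intro t ht
    have ht0 := hT.trans ht.1
    simp only [max_eq_left ht0]
    have h1 := hv0 t ht0
    have h2 : 0 ≤ u t ^ 2 * v t := by positivity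
    unfold fPoly
    linarith

lemma caseB {θ η s vs k T : ℝ} {u v : ℝ → ℝ} (hT : 0 ≤ T) (hk : 0 < k) (hs : 0 < s)
    (hθ : 0 < θ) (hη : 0 < η)
    (hvs : s * vs = (1 - s) * (s + θ) * (s ^ 2 + η))
    (hu : ∀ t, 0 ≤ t → HasDerivAt u (fPoly θ η (u t) (v t)) t)
    (hv : ∀ t, 0 ≤ t → HasDerivAt v (k * v t * (u t ^ 2 - s ^ 2)) t)
    (hu0 : ∀ t, 0 ≤ t → 0 < u t) (hv0 : ∀ t, 0 ≤ t → 0 < v t)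
    (hus : ∀ t, T ≤ t → s < u t) :
    Tendsto (fun t => (u t, v t)) atTop (𝓝 (s, vs)) := by
  have hmono : MonotoneOn v (Ici T) := by
    apply monotoneOn_of_deriv_nonneg (convex_Ici T)
    · exact fun t ht => (hv t (hT.trans ht)).continuousAt.continuousWithinAt
    · intro t ht
      exact (hv t (hT.trans (interior_subset ht))).differentiableAt.differentiableWithinAt
    · intro t ht
      have ht' : T ≤ t := interior_subset ht
      rw [(hv t (hT.trans ht')).deriv]
      have h1 := hus t ht'
      have h3 := hv0 t (hT.trans ht')
      apply mul_nonneg (by positivity)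
      nlinarith
  set A := max (u T) 1 with hA
  have huA : ∀ t, T ≤ t → u t ≤ A := by
    intro t ht
    obtain ⟨e, he0, he1, he⟩ := u_upper hθ hη hu hu0 hv0 hT ht
    have h1 : u T ≤ A := le_max_left _ _
    have h2 : 1 ≤ A := le_max_right _ _
    nlinarith
  obtain ⟨C, hC⟩ := (isCompact_Icc (a := (0:ℝ)) (b := A)).exists_bound_of_continuousOn
    (f := fun x : ℝ => x * (1 - x) * (x + θ) * (x ^ 2 + η)) (by fun_prop)
  set B := (C + 1) / s ^ 2 with hB
  have hvB : ∀ t, T ≤ t → v t ≤ B := by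
    intro T' hT'
    by_contra! hcon
    have hT'0 := hT.trans hT'
    have huT' := hu0 T' hT'0
    obtain ⟨c, hc, hc'⟩ := exists_hasDerivAt_eq_slope u (fun t => fPoly θ η (u t) (v t))
      (by linarith : T' < T' + u T')
      (fun y hy => (hu y (hT'0.trans hy.1)).continuousAt.continuousWithinAt)
      (fun y hy => hu y (hT'0.trans hy.1.le))
    have hcT : T ≤ c := hT'.trans hc.1.le
    have hvc : B < v c := hcon.trans_le (hmono hT' hcT hc.1.le)
    rw [hB, div_lt_iff₀ (by positivity)] at hvc
    have h1 := (le_abs_self _).trans (hC (u c) ⟨(hu0 c (hT.trans hcT)).le, huA c hcT⟩)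
    have h2 := hus c hcT
    have h3 : s ^ 2 * v c ≤ u c ^ 2 * v c := by
      have := hv0 c (hT.trans hcT)
      gcongr
    have h4 : fPoly θ η (u c) (v c) < -1 := by unfold fPoly; linarith
    rw [hc', show T' + u T' - T' = u T' by ring, div_lt_iff₀ huT'] at h4
    have := hu0 (T' + u T') (by linarith)
    linarith
  obtain ⟨L, hL⟩ : ∃ L, Tendsto v atTop (𝓝 L) := by
    have hm : Monotone (fun t => v (max t T)) := fun x y hxy =>
      hmono (mem_Ici.2 (le_max_right _ _)) (mem_Ici.2 (le_max_right _ _)) (max_le_max_right _ hxy)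
    have hbb : BddAbove (range fun t => v (max t T)) :=
      ⟨B, by rintro _ ⟨t, rfl⟩; exact hvB _ (le_max_right _ _)⟩
    refine ⟨_, (tendsto_atTop_ciSup hm hbb).congr' ?_⟩
    filter_upwards [eventually_ge_atTop T] with t ht
    rw [max_eq_left ht]
  have hL0 : 0 < L := lt_of_lt_of_le (hv0 T hT)
    (ge_of_tendsto hL ((eventually_ge_atTop T).mono fun t ht => hmono self_mem_Ici ht ht))
  exact conv_core hT hk hs hvs hu hv hu0 hv0 huA hvB hL0 hL

lemma case_eq {θ η s vs k T : ℝ} {u v : ℝ → ℝ} (hT : 0 ≤ T)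
    (hvs : s * vs = (1 - s) * (s + θ) * (s ^ 2 + η))
    (hu : ∀ t, 0 ≤ t → HasDerivAt u (fPoly θ η (u t) (v t)) t)
    (hv : ∀ t, 0 ≤ t → HasDerivAt v (k * v t * (u t ^ 2 - s ^ 2)) t)
    (huT : u T = s) (hvT : v T = vs) :
    Tendsto (fun t => (u t, v t)) atTop (𝓝 (s, vs)) := by
  obtain ⟨U, hcU, hU⟩ := cont_max hu
  obtain ⟨V, hcV, hV⟩ := cont_max hv
  -- difference quotient of `u (1-u) (u+θ) (u²+η)`
  let P : ℝ → ℝ → ℝ := fun x y =>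
    -(x ^ 4 + x ^ 3 * s + x ^ 2 * s ^ 2 + x * s ^ 3 + s ^ 4)
      + (1 - θ) * (x ^ 3 + x ^ 2 * s + x * s ^ 2 + s ^ 3)
      + (θ - η) * (x ^ 2 + x * s + s ^ 2) + (1 - θ) * η * (x + s) + θ * η - (x + s) * y
  let R : ℝ → ℝ → ℝ := fun x y => -s ^ 2 + k * y * (x + s)
  have hP : ∀ x y, fPoly θ η x y = P x y * (x - s) - s ^ 2 * (y - vs) := by
    intro x y
    simp only [P, fPoly]
    linear_combination (-s) * hvs
  have hd : ∀ S, T ≤ S → (u S - s) ^ 2 + (v S - vs) ^ 2 ≤ 0 := by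
    intro S hTS
    have hg := gron (a := fun t => 2 * |P (u (max t 0)) (v (max t 0))|
        + |R (u (max t 0)) (v (max t 0))|)
      (x := fun t => (u t - s) ^ 2 + (v t - vs) ^ 2)
      (x' := fun t => 2 * (u t - s) * fPoly θ η (u t) (v t)
        + 2 * (v t - vs) * (k * v t * (u t ^ 2 - s ^ 2)))
      (by simp only [P, R, ← hU, ← hV]; fun_prop) hTS
      (by
        intro t ht
        have h1 := hu t (hT.trans ht.1)
        have h2 := hv t (hT.trans ht.1)
        refine (((h1.sub_const s).pow 2).add ((h2.sub_const vs).pow 2)).congr_deriv ?_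
        simp)
      (by
        intro t ht
        simp only [max_eq_left (hT.trans ht.1)]
        rw [hP]
        set w := u t - s with hw
        set z := v t - vs with hz
        have e : 2 * w * (P (u t) (v t) * w - s ^ 2 * z) + 2 * z * (k * v t * (u t ^ 2 - s ^ 2))
          = 2 * P (u t) (v t) * w ^ 2 + R (u t) (v t) * (2 * w * z) := by
          simp only [R, hw]; ring
        rw [e]
        have h1 := le_abs_self (P (u t) (v t))
        have h2 : R (u t) (v t) * (2 * w * z) ≤ |R (u t) (v t)| * (w ^ 2 + z ^ 2) := by
          have h3 : |2 * w * z| ≤ w ^ 2 + z ^ 2 := by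
            rw [abs_le]; constructor <;> nlinarith [sq_nonneg (w - z), sq_nonneg (w + z)]
          calc _ ≤ |R (u t) (v t) * (2 * w * z)| := le_abs_self _
            _ = |R (u t) (v t)| * |2 * w * z| := abs_mul _ _
            _ ≤ _ := by gcongr
        have h4 : P (u t) (v t) * w ^ 2 ≤ |P (u t) (v t)| * w ^ 2 := by gcongr
        have h5 : 0 ≤ |P (u t) (v t)| * z ^ 2 := by positivity
        linarith)
    simpa [huT, hvT] using hg
  refine (tendsto_const_nhds (x := (s, vs))).congr' ?_
  filter_upwards [eventually_ge_atTop T] with t ht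
  have h := hd t ht
  have h1 : u t - s = 0 := by nlinarith [sq_nonneg (u t - s), sq_nonneg (v t - vs)]
  have h2 : v t - vs = 0 := by nlinarith [sq_nonneg (u t - s), sq_nonneg (v t - vs)]
  rw [sub_eq_zero.1 h1, sub_eq_zero.1 h2]

lemma trap {θ η s vs k m T : ℝ} {u v : ℝ → ℝ} (hT : 0 ≤ T) (hk : 0 < k) (hs : 0 < s)
    (hs1 : s < 1) (hθ : 0 < θ) (hη : 0 < η) (hm : 0 < m)
    (hvs : s * vs = (1 - s) * (s + θ) * (s ^ 2 + η))
    (hφ : ∀ x ∈ Icc s 1, (1 - x) * (x + θ) * (x ^ 2 + η) ≤ x * (vs - 2 * m * (x - s)))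
    (hkm : 2 * k * vs ≤ m ^ 2 * s ^ 2)
    (hu : ∀ t, 0 ≤ t → HasDerivAt u (fPoly θ η (u t) (v t)) t)
    (hv : ∀ t, 0 ≤ t → HasDerivAt v (k * v t * (u t ^ 2 - s ^ 2)) t)
    (hu0 : ∀ t, 0 ≤ t → 0 < u t) (hv0 : ∀ t, 0 ≤ t → 0 < v t)
    (huT : u T = s) (hvT : v T < vs) : ∀ t, T < t → s < u t := by
  obtain ⟨U, hcU, hU⟩ := cont_max hu
  have hf : ∀ y, fPoly θ η s y = s ^ 2 * (vs - y) := by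
    intro y; unfold fPoly; linear_combination (-s) * hvs
  have hle1 : ∀ t, T ≤ t → u t ≤ 1 := by
    intro t ht
    obtain ⟨e, he0, he1, he⟩ := u_upper hθ hη hu hu0 hv0 hT ht
    rw [huT] at he
    nlinarith
  let h : ℝ → ℝ := fun t => v t - vs + m * (u t - s)
  have hh : ∀ t, 0 ≤ t → HasDerivAt h
      (k * v t * (u t ^ 2 - s ^ 2) + m * fPoly θ η (u t) (v t)) t := fun t ht =>
    ((hv t ht).sub_const vs).add (((hu t ht).sub_const s).const_mul m)
  have hhT : h T < 0 := by simp only [h, huT]; linarith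
  intro b hb
  by_contra! hcon
  -- a starting time strictly inside
  have e1 : ∀ᶠ t in 𝓝[>] T, u T < u t := deriv_pos_right (hu T hT) (by
    rw [huT, hf]; have : 0 < vs - v T := by linarith
    positivity)
  have e2 : ∀ᶠ t in 𝓝[>] T, h t < 0 :=
    ((hh T hT).continuousAt.eventually (gt_mem_nhds hhT)).filter_mono nhdsWithin_le_nhds
  have e3 : ∀ᶠ t in 𝓝[>] T, t ∈ Ioo T b := Ioo_mem_nhdsGT hb
  obtain ⟨a, ha1, ha2, ha3⟩ := (e1.and (e2.and e3)).exists
  rw [huT] at ha1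
  have ha0 : 0 ≤ a := hT.trans ha3.1.le
  obtain ⟨r, hr, hr1, hr2⟩ := first_exit (p := fun t => min (u t - s) (-(h t))) ha3.2.le
    (by
      intro t ht
      have ht0 := ha0.trans ht.1
      have q1 : ContinuousAt u t := (hu t ht0).continuousAt
      have q2 : ContinuousAt h t := (hh t ht0).continuousAt
      have q3 : ContinuousAt (fun t => min (u t - s) (-(h t))) t :=
        Filter.Tendsto.min (q1.sub continuousAt_const) q2.neg
      exact q3.continuousWithinAt)
    (lt_min (by linarith) (by linarith)) ((min_le_left _ _).trans (by linarith))
  have hin : ∀ t ∈ Ico a r, s < u t ∧ h t < 0 := by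
    intro t ht
    obtain ⟨q1, q2⟩ := lt_min_iff.1 (hr2 t ht)
    exact ⟨by linarith, by linarith⟩
  have hr0 : 0 ≤ r := ha0.trans hr.1.le
  have hnear : ∀ᶠ t in 𝓝[<] r, t ∈ Ico a r := Ico_mem_nhdsLT hr.1
  have hur : s ≤ u r := by
    refine ge_of_tendsto ((hu r hr0).continuousAt.tendsto.mono_left nhdsWithin_le_nhds)
      (hnear.mono fun t ht => (hin t ht).1.le)
  have hhr : h r ≤ 0 := by
    refine le_of_tendsto ((hh r hr0).continuousAt.tendsto.mono_left nhdsWithin_le_nhds)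
      (hnear.mono fun t ht => (hin t ht).2.le)
  have hin' : ∀ t ∈ Icc a r, s ≤ u t ∧ h t ≤ 0 := by
    intro t ht
    rcases eq_or_lt_of_le ht.2 with h1 | h1
    · rw [h1]; exact ⟨hur, hhr⟩
    · exact ⟨(hin t ⟨ht.1, h1⟩).1.le, (hin t ⟨ht.1, h1⟩).2.le⟩
  have hg := gron (a := fun t => -(m * u (max t 0) ^ 2)) (x := h) (by simp only [← hU]; fun_prop) hr.1.le
    (fun t ht => hh t (ha0.trans ht.1)) (by
      intro t ht
      have ht0 := ha0.trans ht.1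
      simp only [max_eq_left ht0]
      obtain ⟨q1, q2⟩ := hin' t ht
      have q3 := hle1 t (ha3.1.le.trans ht.1)
      have q4 := hφ (u t) ⟨q1, q3⟩
      have q5 := hu0 t ht0
      have q6 := hv0 t ht0
      have q7 : v t ≤ vs := by
        simp only [h] at q2
        nlinarith
      have q8 : fPoly θ η (u t) (v t) ≤ u t ^ 2 * (-(m * (u t - s)) - h t) := by
        have : fPoly θ η (u t) (v t) =
          u t * ((1 - u t) * (u t + θ) * (u t ^ 2 + η)) - u t ^ 2 * v t := by unfold fPoly; ring
        rw [this]
        have := mul_le_mul_of_nonneg_left q4 q5.le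
        simp only [h]
        linarith
      have q9 : k * v t * (u t + s) ≤ m ^ 2 * u t ^ 2 := by
        calc k * v t * (u t + s) ≤ k * vs * 2 := by
              have : 0 ≤ vs := q6.le.trans q7
              gcongr
              linarith
          _ ≤ m ^ 2 * s ^ 2 := by linarith
          _ ≤ _ := by gcongr
      have q10 := mul_le_mul_of_nonneg_right q9 (by linarith : 0 ≤ u t - s)
      have q11 := mul_le_mul_of_nonneg_left q8 hm.le
      linarith)
  have hhr' : h r < 0 := by
    have := Real.exp_pos (∫ t in a..r, -(m * u (max t 0) ^ 2))
    nlinarith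
  have hur' : u r = s := by
    rcases min_le_iff.1 hr1 with q | q <;> linarith
  have hvr : v r < vs := by simp only [h, hur'] at hhr'; linarith
  have e4 : ∀ᶠ t in 𝓝[<] r, u t < u r := deriv_pos_left (hu r hr0) (by
    rw [hur', hf]; have : 0 < vs - v r := by linarith
    positivity)
  obtain ⟨t, ht1, ht2⟩ := (e4.and hnear).exists
  have := (hin t ht2).1
  linarith

lemma traj {θ η s vs k m : ℝ} {u v : ℝ → ℝ} (hk : 0 < k) (hs : 0 < s)
    (hs1 : s < 1) (hθ : 0 < θ) (hη : 0 < η) (hm : 0 < m)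
    (hvs : s * vs = (1 - s) * (s + θ) * (s ^ 2 + η))
    (hφ : ∀ x ∈ Icc s 1, (1 - x) * (x + θ) * (x ^ 2 + η) ≤ x * (vs - 2 * m * (x - s)))
    (hkm : 2 * k * vs ≤ m ^ 2 * s ^ 2)
    (hu : ∀ t, 0 ≤ t → HasDerivAt u (fPoly θ η (u t) (v t)) t)
    (hv : ∀ t, 0 ≤ t → HasDerivAt v (k * v t * (u t ^ 2 - s ^ 2)) t)
    (hui : 0 < u 0) (hvi : 0 < v 0) :
    Tendsto (fun t => (u t, v t)) atTop (𝓝 (s, vs)) := by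
  obtain ⟨U, hcU, hU⟩ := cont_max hu
  obtain ⟨V, hcV, hV⟩ := cont_max hv
  have hu0 : ∀ t, 0 ≤ t → 0 < u t := fun t ht => pos_lemma
    (a := fun t => (1 - u t) * (u t + θ) * (u t ^ 2 + η) - u t * v t) ht (by simp only [← hU, ← hV]; fun_prop)
    (fun t ht => (hu t ht).congr_deriv (by unfold fPoly; ring)) hui
  have hv0 : ∀ t, 0 ≤ t → 0 < v t := fun t ht => pos_lemma
    (a := fun t => k * (u t ^ 2 - s ^ 2)) ht (by simp only [← hU]; fun_prop)
    (fun t ht => (hv t ht).congr_deriv (by ring)) hvi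
  have hf : ∀ y, fPoly θ η s y = s ^ 2 * (vs - y) := by
    intro y; unfold fPoly; linear_combination (-s) * hvs
  have hlow : ∀ T, 0 ≤ T → u T = s → v T ≤ vs →
      Tendsto (fun t => (u t, v t)) atTop (𝓝 (s, vs)) := by
    intro T hT h1 h2
    rcases eq_or_lt_of_le h2 with h2 | h2
    · exact case_eq hT hvs hu hv h1 h2
    · have := trap hT hk hs hs1 hθ hη hm hvs hφ hkm hu hv hu0 hv0 h1 h2
      exact caseB (T := T + 1) (by linarith) hk hs hθ hη hvs hu hv hu0 hv0
        (fun t ht => this t (by linarith))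
  -- starting from a point with `u < s`
  have hbelow : ∀ T, 0 ≤ T → u T < s →
      Tendsto (fun t => (u t, v t)) atTop (𝓝 (s, vs)) := by
    intro T hT h1
    by_cases hall : ∀ t, T ≤ t → u t < s
    · exact caseA hT hk hs hs1 hθ hη hvs hu hv hu0 hv0 hall
    push Not at hall
    obtain ⟨b, hb, hb'⟩ := hall
    obtain ⟨r, hr, hr1, hr2⟩ := first_exit (p := fun t => s - u t) hb
      (fun t ht => (continuousAt_const.sub
        (hu t (hT.trans ht.1)).continuousAt).continuousWithinAt)
      (by linarith) (by linarith)
    have hr0 : 0 ≤ r := hT.trans hr.1.le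
    have hnear : ∀ᶠ t in 𝓝[<] r, t ∈ Ico T r := Ico_mem_nhdsLT hr.1
    have hur : u r ≤ s :=
      le_of_tendsto ((hu r hr0).continuousAt.tendsto.mono_left nhdsWithin_le_nhds)
        (hnear.mono fun t ht => by linarith [hr2 t ht])
    have hur' : u r = s := by linarith
    refine hlow r hr0 hur' ?_
    by_contra! hcon
    have e4 : ∀ᶠ t in 𝓝[<] r, -u t < -u r := deriv_pos_left (hu r hr0).neg (by
      rw [hur', hf]
      have : 0 < v r - vs := by linarith
      have : 0 < s ^ 2 * (v r - vs) := by positivity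
      linarith)
    obtain ⟨t, ht1, ht2⟩ := (e4.and hnear).exists
    have := hr2 t ht2
    linarith
  by_cases hall : ∀ t, 0 ≤ t → s < u t
  · exact caseB le_rfl hk hs hθ hη hvs hu hv hu0 hv0 hall
  push Not at hall
  obtain ⟨T, hT, hT'⟩ := hall
  rcases eq_or_lt_of_le hT' with h1 | h1
  · rcases le_or_gt (v T) vs with h2 | h2
    · exact hlow T hT h1 h2
    · have e1 : ∀ᶠ t in 𝓝[>] T, -u T < -u t := deriv_pos_right (hu T hT).neg (by
        rw [h1, hf]
        have : 0 < v T - vs := by linarith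
        have : 0 < s ^ 2 * (v T - vs) := by positivity
        linarith)
      obtain ⟨t, ht1, ht2⟩ := (e1.and self_mem_nhdsWithin).exists
      have ht2' : T < t := ht2
      exact hbelow t (by linarith) (by linarith)
  · exact hbelow T hT h1

lemma exists_slope {θ η s vs : ℝ} (hs : 0 < s) (hs1 : s < 1)
    (hvs : s * vs = (1 - s) * (s + θ) * (s ^ 2 + η))
    (hF : ∀ x ∈ Icc s 1, 0 < quarticF θ η x) :
    ∃ m > 0, ∀ x ∈ Icc s 1, (1 - x) * (x + θ) * (x ^ 2 + η) ≤ x * (vs - 2 * m * (x - s)) := by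
  obtain ⟨x0, hx0, hmin⟩ := (isCompact_Icc (a := s) (b := 1)).exists_isMinOn
    ⟨s, le_rfl, hs1.le⟩ (f := quarticF θ η) (by unfold quarticF; fun_prop)
  set F0 := quarticF θ η x0 with hF0
  have hF0pos : 0 < F0 := hF x0 hx0
  refine ⟨F0 / 2, by positivity, ?_⟩
  have hd : ∀ x ∈ Icc s 1, HasDerivAt
      (fun x => (1 - x) * (x + θ) * (x ^ 2 + η) / x + F0 * x) (-quarticF θ η x / x ^ 2 + F0) x := by
    intro x hx
    have hx0 : x ≠ 0 := (hs.trans_le hx.1).ne'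
    have hi := hasDerivAt_id x
    refine ((((hi.const_sub 1).mul (hi.add_const θ)).mul ((hi.pow 2).add_const η)).div hi hx0
      |>.add (hi.const_mul F0)).congr_deriv ?_
    simp [quarticF]
    field_simp
    ring
  have hanti : AntitoneOn (fun x => (1 - x) * (x + θ) * (x ^ 2 + η) / x + F0 * x) (Icc s 1) := by
    apply antitoneOn_of_deriv_nonpos (convex_Icc s 1)
    · exact fun t ht => (hd t ht).continuousAt.continuousWithinAt
    · intro t ht
      exact (hd t (interior_subset ht)).differentiableAt.differentiableWithinAt
    · intro t ht
      have ht' : t ∈ Icc s 1 := interior_subset ht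
      rw [(hd t ht').deriv]
      have h1 : F0 ≤ quarticF θ η t := hmin ht'
      have h2 : 0 < t := hs.trans_le ht'.1
      have h3 : F0 ≤ quarticF θ η t / t ^ 2 := by
        rw [le_div_iff₀ (by positivity)]
        have : t ^ 2 ≤ 1 := by nlinarith [ht'.2]
        nlinarith
      rw [neg_div]
      linarith
  intro x hx
  have h := hanti ⟨le_rfl, hs1.le⟩ hx hx.1
  simp only [← hvs] at h
  rw [mul_div_cancel_left₀ _ hs.ne'] at h
  have hx0 : 0 < x := hs.trans_le hx.1
  have h2 : (1 - x) * (x + θ) * (x ^ 2 + η) / x ≤ vs - 2 * (F0 / 2) * (x - s) := by linarith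
  rw [div_le_iff₀ hx0] at h2
  linarith

/-- if `F` has exactly two zeros `u_m < u_M` in `(0,1)` with the
S-shaped sign pattern, `0 < δ < 1/(1+η)`, and `u* = √(δη/(1−δ)) > u_M`, then for all
sufficiently small `ε > 0` the interior equilibrium
`(u*, v*)`, `v* = (1−u*)(u*+θ)(u*²+η)/u*`, is globally asymptotically stable on the
open first quadrant. -/
theorem interior_equilibrium_globally_stable
    (δ θ η : ℝ) (hδ : 0 < δ) (hθ : θ ∈ Set.Ioo (0:ℝ) 1) (hη : η ∈ Set.Ioo (0:ℝ) 1)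
    (um uM : ℝ) (h0m : 0 < um) (hmM : um < uM) (hM1 : uM < 1)
    (hFm : quarticF θ η um = 0) (hFM : quarticF θ η uM = 0)
    (honly : ∀ u ∈ Set.Ioo (0:ℝ) 1, quarticF θ η u = 0 → u = um ∨ u = uM)
    (hpos1 : ∀ u ∈ Set.Ioo (0:ℝ) um, 0 < quarticF θ η u)
    (hneg : ∀ u ∈ Set.Ioo um uM, quarticF θ η u < 0)
    (hpos2 : ∀ u ∈ Set.Ioc uM (1:ℝ), 0 < quarticF θ η u)
    (hδη : δ < 1 / (1 + η))
    (hstar : uM < Real.sqrt (δ * η / (1 - δ))) :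
    ∃ ε₀ > (0:ℝ), ∀ ε : ℝ, 0 < ε → ε < ε₀ →
      ∀ u v : ℝ → ℝ,
        (∀ t : ℝ, 0 ≤ t → HasDerivAt u (fPoly θ η (u t) (v t)) t) →
        (∀ t : ℝ, 0 ≤ t → HasDerivAt v (ε * gPoly δ η (u t) (v t)) t) →
        0 < u 0 → 0 < v 0 →
        Filter.Tendsto (fun t => (u t, v t)) Filter.atTop
          (nhds (Real.sqrt (δ * η / (1 - δ)),
            (1 - Real.sqrt (δ * η / (1 - δ))) * (Real.sqrt (δ * η / (1 - δ)) + θ) *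
              ((Real.sqrt (δ * η / (1 - δ))) ^ 2 + η) / Real.sqrt (δ * η / (1 - δ)))) := by
  have hθ0 := hθ.1
  have hη0 := hη.1
  have hδ1 : δ * (1 + η) < 1 := by
    rwa [lt_div_iff₀ (by linarith)] at hδη
  have hδ' : 0 < 1 - δ := by nlinarith
  set s := Real.sqrt (δ * η / (1 - δ)) with hs
  have hs0 : 0 < s := Real.sqrt_pos.2 (by positivity)
  have hsq : (1 - δ) * s ^ 2 = δ * η := by
    rw [hs, Real.sq_sqrt (by positivity)]; field_simp
  have hs1 : s < 1 := by
    by_contra! hcon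
    have h1 : 1 ≤ s ^ 2 := by nlinarith
    have h2 := mul_le_mul_of_nonneg_left h1 hδ'.le
    linarith
  set vs := (1 - s) * (s + θ) * (s ^ 2 + η) / s with hvs
  have hvs' : s * vs = (1 - s) * (s + θ) * (s ^ 2 + η) := by
    rw [hvs]; field_simp
  have hvs0 : 0 < vs := by
    have : 0 < 1 - s := by linarith
    positivity
  obtain ⟨m, hm, hφ⟩ := exists_slope hs0 hs1 hvs'
    (fun x hx => hpos2 x ⟨hstar.trans_le hx.1, hx.2⟩)
  refine ⟨m ^ 2 * s ^ 2 / (2 * (1 - δ) * vs), by positivity, ?_⟩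
  intro ε hε hε' u v hu hv hui hvi
  rw [lt_div_iff₀ (by positivity)] at hε'
  refine traj (k := ε * (1 - δ)) (by positivity) hs0 hs1 hθ0 hη0 hm hvs' hφ (by linarith) hu
    (fun t ht => (hv t ht).congr_deriv ?_) hui hvi
  unfold gPoly
  linear_combination (ε * v t) * hsq
end
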